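/- For β = 1 (θ = 1/2) and any m ≥ 1, the joint law of the non-zero eigenvalue arrays μ^1 ≺ ⋯ ≺ μ^m of the first m levels of the multilevel generalized β-Wishart ensemble with parameters (π, π̂) equals the multivariate Bessel ensemble with parameters (π, π̂) and m levels. -/

import Mathlib

open MeasureTheory ProbabilityTheory Filter Finset
open scoped ENNReal NNReal BigOperators Classical

noncomputable section

namespace RMT

/-- `Δ(x) = ∏_{i<j<k} (x i - x j)`. -/
def vand (k : ℕ) (x : ℕ → ℝ) : ℝ :=
  ∏ i ∈ range k, ∏ j ∈ range k, if i < j then x i - x j else 1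

/-- `Δ^trig(x) = ∏_{i<j<k} (e^{(x i - x j)/2} - e^{(x j - x i)/2})`. -/
def vandTrig (k : ℕ) (x : ℕ → ℝ) : ℝ :=
  ∏ i ∈ range k, ∏ j ∈ range k,
    if i < j then Real.exp ((x i - x j) / 2) - Real.exp ((x j - x i) / 2) else 1

/-- `Δ(x, y) = ∏_{i<a, j<b} |x i - y j|`. -/
def cross (a b : ℕ) (x y : ℕ → ℝ) : ℝ :=
  ∏ i ∈ range a, ∏ j ∈ range b, |x i - y j|

/-- `|x| = ∑_{i<k} x i`. -/
def asum (k : ℕ) (x : ℕ → ℝ) : ℝ := ∑ i ∈ range k, x i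

/-- `x` (of length `a`) interlaces `y` (of length `b`), `a ∈ {b-1, b}`:
`y 0 ≥ x 0 ≥ y 1 ≥ x 1 ≥ ⋯` (0-based). -/
def interlaces (a b : ℕ) (x y : ℕ → ℝ) : Prop :=
  (∀ i, i < a → x i ≤ y i) ∧ ∀ i, i < a → i + 1 < b → y (i + 1) ≤ x i

/-- `x` is decreasing on its first `k` entries. -/
def decrOn (k : ℕ) (x : ℕ → ℝ) : Prop := ∀ i j, i ≤ j → j < k → x j ≤ x i

/-- strictly decreasing and positive on the first `k` entries -/
def sdecrPos (k : ℕ) (x : ℕ → ℝ) : Prop :=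
  (∀ i j, i < j → j < k → x j < x i) ∧ ∀ i, i < k → 0 < x i

/-- Coordinates of a `k`-level triangular array capped at width `n`:
level `l` (0-based) has `min (l+1) n` entries. -/
def coords (k n : ℕ) : Finset (ℕ × ℕ) :=
  (range k ×ˢ range n).filter fun p => p.2 < min (p.1 + 1) n

/-- The space of `k`-level arrays capped at width `n`. -/
abbrev Arr (k n : ℕ) : Type := { p // p ∈ coords k n } → ℝ

/-- Entry accessor, `0` outside the allowed coordinates. -/
def ent {k n : ℕ} (μ : Arr k n) (l i : ℕ) : ℝ :=
  if h : (l, i) ∈ coords k n then μ ⟨(l, i), h⟩ else 0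

/-- Level `l` (1-based) of an `m`-level array; level `0` is the zero sequence. -/
def lev {m n : ℕ} (μ : Arr m n) (l : ℕ) : ℕ → ℝ :=
  fun i => if l = 0 then 0 else ent μ (l - 1) i

/-- Level `l` (1-based) of a Gelfand–Tsetlin pattern with interior `μ`
(levels `1, …, m-1`) and prescribed top level `lam` (level `m`). -/
def levT {m n : ℕ} (μ : Arr (m - 1) n) (lam : ℕ → ℝ) (l : ℕ) : ℕ → ℝ :=
  fun i => if l = 0 then 0 else if l = m then lam i else ent μ (l - 1) i

/-- The Gelfand–Tsetlin polytope `GT_lam^{(m)}` (interior coordinates). -/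
def GTset (m n : ℕ) (lam : ℕ → ℝ) : Set (Arr (m - 1) n) :=
  {μ | ∀ l, 1 ≤ l → l < m →
    interlaces (min l n) (min (l + 1) n) (levT μ lam l) (levT μ lam (l + 1))}

/-- extension of a finite vector by zero -/
def extF {k : ℕ} (x : Fin k → ℝ) : ℕ → ℝ := fun i => if h : i < k then x ⟨i, h⟩ else 0

/-! ### Multivariate Bessel functions -/

/-- The integral `φ^{n,m}_θ(λ, s)`. -/
def phiB (θ : ℝ) (n m : ℕ) (lam s : ℕ → ℝ) : ℝ :=
  (Real.Gamma θ)⁻¹ ^ (n * (n - 1) / 2 + n * (m - n)) *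
    ∫ μ in GTset m n lam,
      (Real.exp (∑ l ∈ Icc 1 m,
          s (l - 1) * (asum (min l n) (levT μ lam l) - asum (min (l - 1) n) (levT μ lam (l - 1)))) *
        ∏ i ∈ range n, levT μ lam n i ^ (θ - 1) / lam i ^ (θ - 1)) *
      ∏ l ∈ Ico 1 m,
        cross (min l n) (min (l + 1) n) (levT μ lam l) (levT μ lam (l + 1)) ^ (θ - 1) /
          (vand (min l n) (levT μ lam l) ^ (θ - 1) *
            vand (min (l + 1) n) (levT μ lam (l + 1)) ^ (θ - 1))

/-- `Γ(mθ)Γ((m-1)θ)⋯Γ((m-n+1)θ)` -/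
def gammaProd (θ : ℝ) (n m : ℕ) : ℝ := ∏ k ∈ Icc (m - n + 1) m, Real.Gamma (k * θ)

/-- The multivariate Bessel function `B^{n,m}_β(λ, s)`, `θ = β/2`. -/
def mvBessel (θ : ℝ) (n m : ℕ) (lam s : ℕ → ℝ) : ℝ :=
  gammaProd θ n m / Real.Gamma θ ^ n *
    (phiB θ n m lam s / (vand n lam ^ θ * ∏ i ∈ range n, lam i ^ (θ * ((m - n : ℕ) : ℝ))))

/-- The conjugate multivariate Bessel function `B̃^{n,m}_β(λ, s)`. -/
def mvBesselC (θ : ℝ) (n m : ℕ) (lam s : ℕ → ℝ) : ℝ :=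
  (Real.Gamma θ)⁻¹ ^ n * (∏ i ∈ range n, lam i ^ (θ - 1)) * mvBessel θ n m lam s

/-! ### Heckman–Opdam hypergeometric functions -/

/-- The integral `Φ^{n,m}_θ(λ, s)`. -/
def phiHO (θ : ℝ) (n m : ℕ) (lam s : ℕ → ℝ) : ℝ :=
  (Real.Gamma θ)⁻¹ ^ (n * (m - n) + n * (n - 1) / 2) *
    ∫ μ in GTset m n lam,
      (Real.exp (∑ l ∈ Icc 1 m,
          s (l - 1) * (asum (min l n) (levT μ lam l) - asum (min (l - 1) n) (levT μ lam (l - 1)))) *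
        ∏ i ∈ range n,
          (1 - Real.exp (-levT μ lam n i)) ^ (θ - 1) / (1 - Real.exp (-lam i)) ^ (θ - 1)) *
      ∏ l ∈ Ico 1 m,
        cross (min l n) (min (l + 1) n) (fun i => Real.exp (-levT μ lam l i))
            (fun i => Real.exp (-levT μ lam (l + 1) i)) ^ (θ - 1) /
          (vand (min l n) (fun i => Real.exp (-levT μ lam l i)) ^ (θ - 1) *
            vand (min (l + 1) n) (fun i => Real.exp (-levT μ lam (l + 1) i)) ^ (θ - 1)) *
        Real.exp ((θ - 1) * asum (min l n) (levT μ lam l))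

/-- The Heckman–Opdam hypergeometric function `F^{n,m}_β(λ, s)`, `θ = β/2`. -/
def hoF (θ : ℝ) (n m : ℕ) (lam s : ℕ → ℝ) : ℝ :=
  gammaProd θ n m / Real.Gamma θ ^ n *
    (phiHO θ n m lam s /
      (vandTrig n lam ^ θ * ∏ i ∈ range n, (1 - Real.exp (-lam i)) ^ (θ * ((m - n : ℕ) : ℝ))))

/-- The conjugate Heckman–Opdam hypergeometric function `F̃^{n,m}_β(λ, s)`. -/
def hoFC (θ : ℝ) (n m : ℕ) (lam s : ℕ → ℝ) : ℝ :=
  (Real.Gamma θ)⁻¹ ^ n * (∏ i ∈ range n, (1 - Real.exp (-lam i)) ^ (θ - 1)) * hoF θ n m lam s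

/-! ### Ensembles -/

/-- Support of an `m`-level ensemble: interlacing chain with non-negative entries. -/
def chainSupp {m n : ℕ} (μ : Arr m n) : Prop :=
  (∀ l, 1 ≤ l → l < m → interlaces (min l n) (min (l + 1) n) (lev μ l) (lev μ (l + 1))) ∧
  ∀ l i, 1 ≤ l → l ≤ m → i < min l n → 0 ≤ lev μ l i

/-- Unnormalized density of the multivariate Bessel ensemble. -/
def mvbDensity (θ : ℝ) (n m : ℕ) (piv pih : ℕ → ℝ) : Arr m n → ℝ :=
  Set.indicator {μ | chainSupp μ} fun μ =>
    vand (min m n) (lev μ m) ^ θ *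
    Real.exp (-θ * ∑ l ∈ Icc 1 m,
      pih (l - 1) * (asum (min l n) (lev μ l) - asum (min (l - 1) n) (lev μ (l - 1)))) *
    (∏ i ∈ range (min m n), lev μ m i ^ (θ * ((n - min n m : ℕ) : ℝ))) *
    (∏ i ∈ range (min n m), lev μ (min n m) i ^ (θ - 1) / lev μ m i ^ (θ - 1)) *
    (∏ l ∈ Ico 1 m,
      cross (min l n) (min (l + 1) n) (lev μ l) (lev μ (l + 1)) ^ (θ - 1) /
        (vand (min l n) (lev μ l) ^ (θ - 1) * vand (min (l + 1) n) (lev μ (l + 1)) ^ (θ - 1))) *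
    mvBesselC θ (min n m) n (lev μ m) fun i => -θ * piv i

/-- Unnormalized density of the Heckman–Opdam ensemble. -/
def hoDensity (θ : ℝ) (n m : ℕ) (piv pih : ℕ → ℝ) : Arr m n → ℝ :=
  Set.indicator {μ | chainSupp μ} fun μ =>
    vandTrig (min m n) (lev μ m) ^ θ *
    (∏ i ∈ range (min m n), (1 - Real.exp (-lev μ m i)) ^ (θ * ((n - min m n : ℕ) : ℝ))) *
    (∏ i ∈ range (min m n),
      (1 - Real.exp (-lev μ (min m n) i)) ^ (θ - 1) / (1 - Real.exp (-lev μ m i)) ^ (θ - 1)) *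
    Real.exp (-θ * ∑ l ∈ Icc 1 m,
      pih (l - 1) * (asum (min l n) (lev μ l) - asum (min (l - 1) n) (lev μ (l - 1)))) *
    (∏ l ∈ Ico 1 m,
      cross (min l n) (min (l + 1) n) (fun i => Real.exp (-lev μ l i))
          (fun i => Real.exp (-lev μ (l + 1) i)) ^ (θ - 1) /
        (vand (min l n) (fun i => Real.exp (-lev μ l i)) ^ (θ - 1) *
          vand (min (l + 1) n) (fun i => Real.exp (-lev μ (l + 1) i)) ^ (θ - 1)) *
      Real.exp ((θ - 1) * asum (min l n) (lev μ l))) *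
    hoFC θ (min m n) n (lev μ m) fun i => -θ * piv i

/-! ### Random matrices -/

instance matMeasurableSpace (m n : ℕ) (α : Type*) [MeasurableSpace α] :
    MeasurableSpace (Matrix (Fin m) (Fin n) α) :=
  inferInstanceAs (MeasurableSpace (Fin m → Fin n → α))

/-- Eigenvalues (real parts of the roots of the characteristic polynomial, with
multiplicity) of a complex matrix, sorted in decreasing order; `0` beyond index `n`. -/
def eigsDesc {n : ℕ} (M : Matrix (Fin n) (Fin n) ℂ) : ℕ → ℝ := fun i =>
  (((M.charpoly.roots.map Complex.re).toList.insertionSort (· ≥ ·)).getD i 0)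

/-- `(B^T B)` for the first `k` rows of `B`. -/
def gramR {n : ℕ} (k : ℕ) (B : ℕ → Fin n → ℝ) : Matrix (Fin n) (Fin n) ℝ :=
  Matrix.of fun a b => ∑ i ∈ range k, B i a * B i b

/-- `(B^* B)` for the first `k` rows of `B`. -/
def gramC {n : ℕ} (k : ℕ) (B : ℕ → Fin n → ℂ) : Matrix (Fin n) (Fin n) ℂ :=
  Matrix.of fun a b => ∑ i ∈ range k, (starRingEnd ℂ) (B i a) * B i b

/-- decreasing eigenvalues of the level-`k` real Wishart matrix built from rows of `B` -/
def wishEigR {n : ℕ} (k : ℕ) (B : ℕ → Fin n → ℝ) : ℕ → ℝ :=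
  eigsDesc ((gramR k B).map Complex.ofReal)

/-- decreasing eigenvalues of the level-`k` complex Wishart matrix built from rows of `B` -/
def wishEigC {n : ℕ} (k : ℕ) (B : ℕ → Fin n → ℂ) : ℕ → ℝ :=
  eigsDesc (gramC k B)

/-- the multilevel array of nonzero Wishart eigenvalues (real entries) -/
def wishArrR (n m : ℕ) {Ω : Type*} (A : ℕ → Fin n → Ω → ℝ) (ω : Ω) : Arr m n :=
  fun p => wishEigR (p.1.1 + 1) (fun i j => A i j ω) p.1.2

/-- the multilevel array of nonzero Wishart eigenvalues (complex entries) -/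
def wishArrC (n m : ℕ) {Ω : Type*} (A : ℕ → Fin n → Ω → ℂ) (ω : Ω) : Arr m n :=
  fun p => wishEigC (p.1.1 + 1) (fun i j => A i j ω) p.1.2

/-- The complex Gaussian distribution with mean `0` and variance `v = E|z|²`. -/
def complexGaussian (v : ℝ) : Measure ℂ :=
  Measure.map (fun p : ℝ × ℝ => (⟨p.1, p.2⟩ : ℂ))
    ((gaussianReal 0 (v / 2).toNNReal).prod (gaussianReal 0 (v / 2).toNNReal))

/-- Law of the first `m` levels of eigenvalue arrays of the real generalized Wishart
ensemble with parameters `(p, 0)`. -/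
def wishartLawR (n m : ℕ) (p : Fin n → ℝ) : Measure (Arr m n) :=
  Measure.map
    (fun Z : Fin m × Fin n → ℝ => fun c : { q // q ∈ coords m n } =>
      wishEigR (c.1.1 + 1) (fun i j => if h : i < m then Z (⟨i, h⟩, j) else 0) c.1.2)
    (Measure.pi fun q : Fin m × Fin n => gaussianReal 0 ((p q.2)⁻¹).toNNReal)

/-- Law of the first `m` levels of eigenvalue arrays of the complex generalized Wishart
ensemble with parameters `(p, 0)`. -/
def wishartLawC (n m : ℕ) (p : Fin n → ℝ) : Measure (Arr m n) :=
  Measure.map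
    (fun Z : Fin m × Fin n → ℂ => fun c : { q // q ∈ coords m n } =>
      wishEigC (c.1.1 + 1) (fun i j => if h : i < m then Z (⟨i, h⟩, j) else 0) c.1.2)
    (Measure.pi fun q : Fin m × Fin n => complexGaussian (p q.2)⁻¹)

/-! ### Haar-type measures and HCIZ integrals -/

/-- `ν` is the Haar probability measure on the orthogonal group `O(n)` (identified with the
unique left-invariant probability measure carried by `O(n) ⊆ Matrix (Fin n) (Fin n) ℝ`). -/
def IsHaarOrth (n : ℕ) (ν : Measure (Matrix (Fin n) (Fin n) ℝ)) : Prop :=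
  IsProbabilityMeasure ν ∧
    ν ((↑(Matrix.orthogonalGroup (Fin n) ℝ) : Set (Matrix (Fin n) (Fin n) ℝ))ᶜ) = 0 ∧
    ∀ U ∈ Matrix.orthogonalGroup (Fin n) ℝ, Measure.map (fun V => U * V) ν = ν

/-- `ν` is the Haar probability measure on the unitary group `U(n)`. -/
def IsHaarUnitary (n : ℕ) (ν : Measure (Matrix (Fin n) (Fin n) ℂ)) : Prop :=
  IsProbabilityMeasure ν ∧
    ν ((↑(Matrix.unitaryGroup (Fin n) ℂ) : Set (Matrix (Fin n) (Fin n) ℂ))ᶜ) = 0 ∧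
    ∀ U ∈ Matrix.unitaryGroup (Fin n) ℂ, Measure.map (fun V => U * V) ν = ν

/-- first `k` entries of `x`, padded with zeros, as a `Fin n`-vector -/
def pad (n : ℕ) (x : ℕ → ℝ) (k : ℕ) : Fin n → ℝ := fun j => if (j : ℕ) < k then x j else 0

/-- The real HCIZ integral `h¹_a(b) = ∫_{O(n)} e^{-Tr(V a Vᵀ b)/2} dν` with `a` of length
`ka` and `b` of length `kb`, both padded by zeros. -/
def hcizR (n : ℕ) (ν : Measure (Matrix (Fin n) (Fin n) ℝ)) (a : ℕ → ℝ) (ka : ℕ)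
    (b : ℕ → ℝ) (kb : ℕ) : ℝ :=
  ∫ V, Real.exp (-(Matrix.trace (V * Matrix.diagonal (pad n a ka) * V.transpose *
    Matrix.diagonal (pad n b kb))) / 2) ∂ν

/-! ### Jacobi matrices -/

/-- `J_l = (X^{An})^* X^{An} ((X^{An})^* X^{An} + (Y^{ln})^* Y^{ln})⁻¹`, real entries. -/
def jacMatR (A n l : ℕ) (X Y : ℕ → ℕ → ℝ) : Matrix (Fin n) (Fin n) ℝ :=
  (Matrix.of fun a b : Fin n => ∑ i ∈ range A, X i a * X i b) *
    ((Matrix.of fun a b : Fin n => ∑ i ∈ range A, X i a * X i b) +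
      Matrix.of fun a b : Fin n => ∑ i ∈ range l, Y i a * Y i b)⁻¹

/-- `J_l`, complex entries. -/
def jacMatC (A n l : ℕ) (X Y : ℕ → ℕ → ℂ) : Matrix (Fin n) (Fin n) ℂ :=
  (Matrix.of fun a b : Fin n => ∑ i ∈ range A, (starRingEnd ℂ) (X i a) * X i b) *
    ((Matrix.of fun a b : Fin n => ∑ i ∈ range A, (starRingEnd ℂ) (X i a) * X i b) +
      Matrix.of fun a b : Fin n => ∑ i ∈ range l, (starRingEnd ℂ) (Y i a) * Y i b)⁻¹

/-- `λ^l_i` (0-based `i < l`): the `i`-th largest among the `l` smallest eigenvalues of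
`J_l` (real case). -/
def jacEigR (A n l : ℕ) (X Y : ℕ → ℕ → ℝ) (i : ℕ) : ℝ :=
  eigsDesc ((jacMatR A n l X Y).map Complex.ofReal) (n - l + i)

/-- `λ^l_i` (complex case). -/
def jacEigC (A n l : ℕ) (X Y : ℕ → ℕ → ℂ) (i : ℕ) : ℝ :=
  eigsDesc (jacMatC A n l X Y) (n - l + i)

/-! ### q-analysis -/

/-- finite q-Pochhammer `(x; q)_N` -/
def qpoch (x q : ℝ) (N : ℕ) : ℝ := ∏ k ∈ range N, (1 - x * q ^ k)

/-- infinite q-Pochhammer `(x; q)_∞` -/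
def qpochInf (x q : ℝ) : ℝ := ∏' k : ℕ, (1 - x * q ^ k)

/-- `f(u) = (tu; q)_∞/(qu; q)_∞` -/
def macf (q t u : ℝ) : ℝ := qpochInf (t * u) q / qpochInf (q * u) q

/-- Macdonald norm constant `b_ν(q, t)` (1-based parts `ν 1 ≥ ν 2 ≥ ⋯ ≥ ν n`, `ν (n+1) = 0`). -/
def bMac (n : ℕ) (ν : ℕ → ℕ) (q t : ℝ) : ℝ :=
  ∏ l ∈ Icc 1 n, ∏ i ∈ range l,
    qpoch (t ^ (i + 1) * q ^ (ν (l - i) - ν l)) q (ν l - ν (l + 1)) /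
      qpoch (t ^ i * q ^ (ν (l - i) - ν l + 1)) q (ν l - ν (l + 1))

/-- Macdonald branching coefficient `ψ^m_{λ/μ}(q, t)` (0-based index sequences). -/
def psiMac (m : ℕ) (lam mu : ℕ → ℝ) (q t : ℝ) : ℝ :=
  ∏ i ∈ range (m - 1), ∏ j ∈ range (m - 1),
    if i ≤ j then
      macf q t (q ^ (mu i - mu j) * t ^ (j - i)) *
          macf q t (q ^ (lam i - lam (j + 1)) * t ^ (j - i)) /
        (macf q t (q ^ (mu i - lam (j + 1)) * t ^ (j - i)) *
          macf q t (q ^ (lam i - mu j) * t ^ (j - i)))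
    else 1

/-- Truncated Macdonald branching coefficient (0-based index sequences of length `n`). -/
def psiMacT (n : ℕ) (lam mu : ℕ → ℝ) (q t : ℝ) : ℝ :=
  (∏ i ∈ range n, ∏ j ∈ range n,
    if i < j then
      macf q t (q ^ (mu i - mu j) * t ^ (j - i)) *
          macf q t (q ^ (lam i - lam j) * t ^ (j - i - 1)) /
        (macf q t (q ^ (lam i - mu j) * t ^ (j - i)) *
          macf q t (q ^ (mu i - lam j) * t ^ (j - i - 1)))
    else 1) *
  (∏ i ∈ range n, macf q t 1 / macf q t (q ^ (lam i - mu i))) *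
  ∏ i ∈ range n, macf q t (q ^ lam i * t ^ (n - 1 - i)) / macf q t (q ^ mu i * t ^ (n - 1 - i))

/-- Transition kernel density of the β = 1 generalized Wishart eigenvalue chain
(`prev` = level `m-1`, argument = level `m`). -/
def wishKer1 (n : ℕ) (piv pih : ℕ → ℝ) (ν : Measure (Matrix (Fin n) (Fin n) ℝ)) (m : ℕ)
    (prev : ℕ → ℝ) : (ℕ → ℝ) → ℝ :=
  Set.indicator {y | interlaces (min (m - 1) n) (min m n) prev y} fun y =>
    (∏ i ∈ range n, (piv i + pih (m - 1)) ^ ((1 : ℝ) / 2)) /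
        (Real.Gamma (m / 2) * Real.Gamma (1 / 2) ^ m) *
      Real.exp (-(1 / 2) * pih (m - 1) * (asum (min m n) y - asum (min (m - 1) n) prev)) *
      ((∏ i ∈ range (min m n),
          y i ^ (((n : ℝ) - min m n - if m ≤ n then 1 else 0) / 2)) /
        ∏ i ∈ range (min (m - 1) n),
          prev i ^ (((n : ℝ) - min (m - 1) n - if m ≤ n then 1 else 0) / 2)) *
      (hcizR n ν piv n y (min m n) / hcizR n ν piv n prev (min (m - 1) n)) *
      (vand (min m n) y * cross (min m n) (min (m - 1) n) y prev ^ (-(1 : ℝ) / 2))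

/-- Support of the multilevel Jacobi ensemble: interlacing with entries in `[0,1]`. -/
def jacSupp {m n : ℕ} (μ : Arr m n) : Prop :=
  (∀ l, 1 ≤ l → l < m → interlaces (min l n) (min (l + 1) n) (lev μ l) (lev μ (l + 1))) ∧
  ∀ l i, 1 ≤ l → l ≤ m → i < min l n → lev μ l i ∈ Set.Icc (0 : ℝ) 1

/-- Unnormalized density of the first `m` levels of the β = 2 Jacobi ensemble. -/
def jacDens2 (A n m : ℕ) : Arr m n → ℝ :=
  Set.indicator {μ | jacSupp μ} fun μ =>
    vand (min m n) (lev μ m) *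
    (∏ i ∈ range (min m n),
      lev μ m i ^ ((A : ℝ) + m - n - 1) * (1 - lev μ m i) ^ ((n : ℝ) - m)) *
    ∏ l ∈ Ico 1 m, ∏ i ∈ range (min l n), lev μ l i ^ (-2 : ℝ)

/-- Unnormalized density of the first `m` levels of the β = 1 Jacobi ensemble. -/
def jacDens1 (A n m : ℕ) : Arr m n → ℝ :=
  Set.indicator {μ | jacSupp μ} fun μ =>
    vand (min m n) (lev μ m) *
    (∏ i ∈ range (min m n),
      lev μ m i ^ (((A : ℝ) + m - n - 4) / 2) * (1 - lev μ m i) ^ (((n : ℝ) - m + 1) / 2)) *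
    ∏ l ∈ Ico 1 m,
      (∏ i ∈ range (min l n), lev μ l i ^ (-1 : ℝ)) * vand (min l n) (lev μ l) *
        cross (min l n) (min (l + 1) n) (lev μ l) (lev μ (l + 1)) ^ (-(1 : ℝ) / 2)

/-- `(X^{An})^T X^{An}` (real). -/
def SxR (A n : ℕ) (X : ℕ → ℕ → ℝ) : Matrix (Fin n) (Fin n) ℝ :=
  Matrix.of fun a b : Fin n => ∑ i ∈ range A, X i a * X i b

/-- `(X^{An})^* X^{An}` (complex). -/
def SxC (A n : ℕ) (X : ℕ → ℕ → ℂ) : Matrix (Fin n) (Fin n) ℂ :=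
  Matrix.of fun a b : Fin n => ∑ i ∈ range A, (starRingEnd ℂ) (X i a) * X i b

/-- The array `{λ^l_i}_{1 ≤ i ≤ l ≤ m}` of Jacobi eigenvalues (real case). -/
def jacArrR (A n m : ℕ) (X Y : ℕ → ℕ → ℝ) : Arr m n :=
  fun c => jacEigR A n (c.1.1 + 1) X Y c.1.2

/-- The array `{λ^l_i}_{1 ≤ i ≤ l ≤ m}` of Jacobi eigenvalues (complex case). -/
def jacArrC (A n m : ℕ) (X Y : ℕ → ℕ → ℂ) : Arr m n :=
  fun c => jacEigC A n (c.1.1 + 1) X Y c.1.2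

/-- The array `{τ^l_i = (λ^l_{l+1-i})⁻¹ - 1}` (real case). -/
def tauArrR (A n m : ℕ) (X Y : ℕ → ℕ → ℝ) : Arr m n :=
  fun c => (eigsDesc ((jacMatR A n (c.1.1 + 1) X Y).map Complex.ofReal) (n - 1 - c.1.2))⁻¹ - 1

/-- The array `{τ^l_i = (λ^l_{l+1-i})⁻¹ - 1}` (complex case). -/
def tauArrC (A n m : ℕ) (X Y : ℕ → ℕ → ℂ) : Arr m n :=
  fun c => (eigsDesc (jacMatC A n (c.1.1 + 1) X Y) (n - 1 - c.1.2))⁻¹ - 1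

/-! ## Part A : the Jacobian of the secular map -/

/-- absolute value of the Vandermonde determinant -/
def aV {K : ℕ} (x : Fin K → ℝ) : ℝ := |(Matrix.vandermonde x).det|

lemma aV_eq {K : ℕ} (x : Fin K → ℝ) : aV x = ∏ i, ∏ j ∈ Ioi i, |x i - x j| := by
  unfold aV
  rw [Matrix.det_vandermonde, Finset.abs_prod]
  refine Finset.prod_congr rfl fun i _ => ?_
  rw [Finset.abs_prod]
  exact Finset.prod_congr rfl fun j _ => abs_sub_comm _ _

lemma prod_erase_abs {K : ℕ} (x : Fin K → ℝ) :
    ∏ j, ∏ l ∈ univ.erase j, |x j - x l| = aV x ^ 2 := by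
  have h1 : ∀ j : Fin K, ∏ l ∈ univ.erase j, |x j - x l|
      = (∏ l ∈ Ioi j, |x j - x l|) * ∏ l ∈ Iio j, |x j - x l| := by
    intro j
    rw [← Finset.prod_union]
    · refine Finset.prod_congr ?_ fun _ _ => rfl
      ext l; simp [eq_comm, or_comm]
    · rw [Finset.disjoint_left]; intro a ha hb
      simp at ha hb; exact absurd ha (not_lt.mpr hb.le)
  simp_rw [h1]
  rw [Finset.prod_mul_distrib, aV_eq, sq]
  congr 1
  rw [Finset.prod_comm' (t' := univ) (s' := fun y => Ioi y)]
  · refine Finset.prod_congr rfl fun i _ => Finset.prod_congr rfl fun j _ => abs_sub_comm _ _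
  · intro a b; simp

/-- evaluation matrix -/
def Qmat {K : ℕ} (x y : Fin K → ℝ) : Matrix (Fin K) (Fin K) ℝ :=
  Matrix.of fun i j => ∏ l ∈ univ.erase j, (x i - y l)

lemma Qmat_eq {K : ℕ} (y : Fin K → ℝ) : ∃ Cm : Matrix (Fin K) (Fin K) ℝ,
    ∀ x, Qmat x y = Matrix.vandermonde x * Cm := by
  let p : Fin K → Polynomial ℝ := fun j => ∏ l ∈ univ.erase j, (Polynomial.X - Polynomial.C (y l))
  refine ⟨Matrix.of fun k j => (p j).coeff k, fun x => ?_⟩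
  ext i j
  have hd : (p j).natDegree < K := by
    have : (p j).natDegree = (univ.erase j : Finset (Fin K)).card := by
      simp only [p]
      exact Polynomial.natDegree_finsetProd_X_sub_C_eq_card _ _
    rw [this]
    have := Finset.card_erase_lt_of_mem (Finset.mem_univ j)
    simpa using this
  have he : (p j).eval (x i) = ∏ l ∈ univ.erase j, (x i - y l) := by
    simp [p, Polynomial.eval_prod]
  simp only [Qmat, Matrix.of_apply, Matrix.mul_apply, Matrix.vandermonde_apply]
  rw [← he, Polynomial.eval_eq_sum_range' hd, Finset.sum_range]
  exact Finset.sum_congr rfl fun k _ => mul_comm _ _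

lemma abs_det_Qmat {K : ℕ} (x y : Fin K → ℝ) (hy : Function.Injective y) :
    |(Qmat x y).det| = aV x * aV y := by
  obtain ⟨Cm, hC⟩ := Qmat_eq y
  have h1 : (Qmat y y).det = (Matrix.vandermonde y).det * Cm.det := by rw [hC, Matrix.det_mul]
  have h2 : Qmat y y = Matrix.diagonal (fun j => ∏ l ∈ univ.erase j, (y j - y l)) := by
    ext i j
    by_cases h : i = j
    · subst h; simp [Qmat]
    · rw [Matrix.diagonal_apply_ne _ h]
      simp only [Qmat, Matrix.of_apply]
      apply Finset.prod_eq_zero (i := i)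
      · simp [h]
      · simp
  have h3 : |(Qmat y y).det| = aV y ^ 2 := by
    rw [h2, Matrix.det_diagonal, Finset.abs_prod, ← prod_erase_abs]
    exact Finset.prod_congr rfl fun j _ => Finset.abs_prod _ _
  have hy0 : aV y ≠ 0 := by
    unfold aV; rw [abs_ne_zero]
    exact Matrix.det_vandermonde_ne_zero_iff.mpr hy
  rw [h1, abs_mul] at h3
  change aV y * |Cm.det| = _ at h3
  have h4 : |Cm.det| = aV y := by
    rw [sq] at h3
    exact mul_left_cancel₀ hy0 h3
  rw [hC, Matrix.det_mul, abs_mul, h4]; rfl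

/-- the secular map `w_i = -∏_j (x_i - y_j) / ∏_{j ≠ i} (x_i - x_j)` -/
def Wmap {K : ℕ} (x y : Fin K → ℝ) : Fin K → ℝ :=
  fun i => -(∏ j, (x i - y j)) / ∏ j ∈ univ.erase i, (x i - x j)

/-- derivative of the secular map -/
def Wder {K : ℕ} (x y : Fin K → ℝ) : (Fin K → ℝ) →L[ℝ] (Fin K → ℝ) :=
  LinearMap.toContinuousLinearMap (Matrix.toLin'
    (Matrix.diagonal (fun i => (∏ j ∈ univ.erase i, (x i - x j))⁻¹) * Qmat x y))

lemma Wmap_hasFDerivAt {K : ℕ} (x y : Fin K → ℝ) :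
    HasFDerivAt (Wmap x) (Wder x y) y := by
  rw [hasFDerivAt_pi']
  intro i
  have h := HasFDerivAt.finset_prod (𝕜 := ℝ) (u := (univ : Finset (Fin K))) (x := y)
    (g := fun j (y : Fin K → ℝ) => x i - y j)
    (g' := fun j => -(ContinuousLinearMap.proj j : (Fin K → ℝ) →L[ℝ] ℝ))
    (fun j _ => ((ContinuousLinearMap.proj (R := ℝ) (φ := fun _ : Fin K => ℝ) j).hasFDerivAt
      (x := y)).const_sub (x i))
  have h2 := h.neg.mul_const ((∏ j ∈ univ.erase i, (x i - x j))⁻¹)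
  have h3 := h2.congr_fderiv (g' := (ContinuousLinearMap.proj i).comp (Wder x y)) ?_
  · refine h3.congr_of_eventuallyEq (Eventually.of_forall fun z => ?_)
    simp [Wmap, div_eq_mul_inv]
  · ext v
    simp [Wder, Matrix.mulVec, dotProduct, Qmat, Finset.mul_sum]
    try (refine Finset.sum_congr rfl fun j _ => ?_; ring)

lemma abs_det_Wder {K : ℕ} (x y : Fin K → ℝ) (hx : Function.Injective x)
    (hy : Function.Injective y) : |(Wder x y).det| = aV y / aV x := by
  have hx0 : aV x ≠ 0 := by
    unfold aV; rw [abs_ne_zero]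
    exact Matrix.det_vandermonde_ne_zero_iff.mpr hx
  have : (Wder x y).det = (Matrix.diagonal (fun i => (∏ j ∈ univ.erase i, (x i - x j))⁻¹) *
      Qmat x y).det := by
    unfold Wder
    rw [ContinuousLinearMap.det]
    simp
  rw [this, Matrix.det_mul, abs_mul, abs_det_Qmat x y hy, Matrix.det_diagonal, Finset.abs_prod]
  have : ∏ i, |(∏ j ∈ univ.erase i, (x i - x j))⁻¹| = (aV x ^ 2)⁻¹ := by
    rw [← prod_erase_abs, ← Finset.prod_inv_distrib]
    refine Finset.prod_congr rfl fun i _ => ?_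
    rw [abs_inv, Finset.abs_prod]
  rw [this]; field_simp

/-! ## Part B : the secular map is a bijection -/

/-- monic polynomial with prescribed roots -/
def pz {K : ℕ} (y : Fin K → ℝ) : Polynomial ℝ := ∏ j, (Polynomial.X - Polynomial.C (y j))

lemma pz_monic {K : ℕ} (y : Fin K → ℝ) : (pz y).Monic :=
  Polynomial.monic_prod_of_monic _ _ fun _ _ => Polynomial.monic_X_sub_C _

lemma pz_degree {K : ℕ} (y : Fin K → ℝ) : (pz y).degree = K := by
  unfold pz
  rw [Polynomial.degree_prod]; simp

lemma pz_eval {K : ℕ} (y : Fin K → ℝ) (t : ℝ) : (pz y).eval t = ∏ j, (t - y j) := by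
  simp [pz, Polynomial.eval_prod]

lemma pz_roots {K : ℕ} (y : Fin K → ℝ) : (pz y).roots = Multiset.map y univ.val := by
  unfold pz
  have := Polynomial.roots_multiset_prod_X_sub_C (Multiset.map y univ.val)
  rw [← this, Multiset.map_map]
  rfl

lemma antitone_eq_of_map_eq {K : ℕ} {y z : Fin K → ℝ} (hy : Antitone y) (hz : Antitone z)
    (h : Multiset.map y univ.val = Multiset.map z univ.val) : y = z := by
  have h1 : (List.ofFn y).Perm (List.ofFn z) := by
    rw [← Multiset.coe_eq_coe]
    simpa [Fin.univ_val_map] using h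
  have := h1.eq_of_sortedGE hy.sortedGE_ofFn hz.sortedGE_ofFn
  exact List.ofFn_inj.mp this

lemma pz_inj {K : ℕ} {y z : Fin K → ℝ} (hy : Antitone y) (hz : Antitone z)
    (h : pz y = pz z) : y = z := by
  apply antitone_eq_of_map_eq hy hz
  rw [← pz_roots, ← pz_roots, h]

lemma eigsDesc_of_charpoly {n : ℕ} (M : Matrix (Fin n) (Fin n) ℝ) (z : Fin n → ℝ)
    (hz : Antitone z) (h : M.charpoly = pz z) (i : ℕ) :
    eigsDesc (M.map Complex.ofReal) i = extF z i := by
  have h1 : (M.map Complex.ofReal).charpoly = M.charpoly.map Complex.ofRealHom :=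
    Matrix.charpoly_map M Complex.ofRealHom
  have h2 : ((M.map Complex.ofReal).charpoly.roots.map Complex.re) = Multiset.map z univ.val := by
    rw [h1, h]
    unfold pz
    rw [Polynomial.map_prod]
    simp only [Polynomial.map_sub, Polynomial.map_X, Polynomial.map_C]
    have := Polynomial.roots_multiset_prod_X_sub_C
      (Multiset.map (fun j => Complex.ofRealHom (z j)) univ.val)
    rw [Multiset.map_map] at this
    change Multiset.map Complex.re (Polynomial.roots (Multiset.map (fun j => Polynomial.X - Polynomial.C (Complex.ofRealHom (z j))) univ.val).prod) = _
    simp only [Function.comp_def] at this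
    rw [this, Multiset.map_map]
    refine Multiset.map_congr rfl fun j _ => ?_
    simp
  have h3 : ((M.map Complex.ofReal).charpoly.roots.map Complex.re).toList.insertionSort (· ≥ ·)
      = List.ofFn z := by
    refine List.Perm.eq_of_sortedGE List.sortedGE_insertionSort hz.sortedGE_ofFn ?_
    refine (List.perm_insertionSort _ _).trans ?_
    rw [← Multiset.coe_eq_coe, Multiset.coe_toList, h2]
    simp [Fin.univ_val_map]
  unfold eigsDesc
  rw [h3]
  unfold extF
  by_cases hi : i < n
  · simp [hi]
  · simp [hi]

/-- the secular polynomial -/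
def Pw {K : ℕ} (x w : Fin K → ℝ) : Polynomial ℝ :=
  pz x - ∑ i, Polynomial.C (w i) * ∏ j ∈ univ.erase i, (Polynomial.X - Polynomial.C (x j))

lemma Pw_aux_degree {K : ℕ} (x w : Fin K → ℝ) :
    (∑ i, Polynomial.C (w i) * ∏ j ∈ univ.erase i, (Polynomial.X - Polynomial.C (x j))).degree
      < (K : WithBot ℕ) := by
  refine lt_of_le_of_lt (Polynomial.degree_sum_le _ _) ?_
  rw [Finset.sup_lt_iff (by exact WithBot.bot_lt_coe K)]
  intro i _
  refine lt_of_le_of_lt (Polynomial.degree_mul_le _ _) ?_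
  refine lt_of_le_of_lt (add_le_add_left (Polynomial.degree_C_le (a := w i)) _) ?_
  rw [zero_add]
  rw [Polynomial.degree_prod]
  simp only [Polynomial.degree_X_sub_C, Finset.sum_const, nsmul_eq_mul, mul_one]
  have := Finset.card_erase_lt_of_mem (Finset.mem_univ i)
  rw [Finset.card_univ, Fintype.card_fin] at this
  exact_mod_cast this

lemma Pw_monic {K : ℕ} (x w : Fin K → ℝ) : (Pw x w).Monic := by
  apply (pz_monic x).sub_of_left
  rw [pz_degree]; exact Pw_aux_degree x w

lemma Pw_degree {K : ℕ} (x w : Fin K → ℝ) : (Pw x w).degree = K := by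
  unfold Pw
  rw [Polynomial.degree_sub_eq_left_of_degree_lt, pz_degree]
  rw [pz_degree]; exact Pw_aux_degree x w

lemma Pw_eval {K : ℕ} (x w : Fin K → ℝ) (t : ℝ) :
    (Pw x w).eval t = ∏ j, (t - x j) - ∑ i, w i * ∏ j ∈ univ.erase i, (t - x j) := by
  simp [Pw, pz_eval, Polynomial.eval_finset_sum, Polynomial.eval_prod]

lemma Pw_eval_x {K : ℕ} (x w : Fin K → ℝ) (i : Fin K) :
    (Pw x w).eval (x i) = - (w i * ∏ j ∈ univ.erase i, (x i - x j)) := by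
  rw [Pw_eval, Finset.prod_eq_zero (Finset.mem_univ i) (sub_self _), zero_sub]
  congr 1
  refine Finset.sum_eq_single i ?_ (by simp)
  intro b _ hb
  rw [Finset.prod_eq_zero (i := i) (by simp [hb.symm]) (sub_self _), mul_zero]

lemma monic_eq_of_eval {K : ℕ} {p q : Polynomial ℝ} (hp : p.Monic) (hq : q.Monic)
    (hpd : p.degree = K) (hqd : q.degree = K) (t : Fin K → ℝ) (ht : Function.Injective t)
    (h : ∀ i, p.eval (t i) = q.eval (t i)) : p = q := by
  rcases Nat.eq_zero_or_pos K with rfl | hK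
  · rw [Polynomial.eq_one_of_monic_natDegree_zero hp
        (Polynomial.natDegree_eq_of_degree_eq_some hpd),
      Polynomial.eq_one_of_monic_natDegree_zero hq
        (Polynomial.natDegree_eq_of_degree_eq_some hqd)]
  · refine Polynomial.eq_of_degree_sub_lt_of_eval_index_eq (v := t) univ ht.injOn ?_
      (fun i _ => h i)
    rw [Finset.card_univ, Fintype.card_fin, ← hpd]
    apply Polynomial.degree_sub_lt (hpd.trans hqd.symm) hp.ne_zero
    rw [hp.leadingCoeff, hq.leadingCoeff]

lemma prod_erase_ne_zero {K : ℕ} {x : Fin K → ℝ} (hx : Function.Injective x) (i : Fin K) :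
    ∏ j ∈ univ.erase i, (x i - x j) ≠ 0 := by
  rw [Finset.prod_ne_zero_iff]
  intro j hj
  rw [sub_ne_zero]
  exact fun h => (Finset.ne_of_mem_erase hj) (hx h).symm

lemma pz_eq_Pw_iff {K : ℕ} {x : Fin K → ℝ} (hx : Function.Injective x) (y w : Fin K → ℝ) :
    pz y = Pw x w ↔ Wmap x y = w := by
  have key : ∀ i, (pz y).eval (x i) = (Pw x w).eval (x i) ↔ Wmap x y i = w i := by
    intro i
    rw [pz_eval, Pw_eval_x]
    unfold Wmap
    rw [div_eq_iff (prod_erase_ne_zero hx i), neg_eq_iff_eq_neg]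
  constructor
  · intro h
    funext i
    rw [← key, h]
  · intro h
    exact monic_eq_of_eval (pz_monic y) (Pw_monic x w) (pz_degree y) (Pw_degree x w) x hx
      fun i => (key i).mpr (congrFun h i)

/-- strict interlacing `y_0 > x_0 > y_1 > x_1 > ⋯` -/
def Sset {K : ℕ} (x : Fin K → ℝ) : Set (Fin K → ℝ) :=
  {y | (∀ i, x i < y i) ∧ ∀ i j, i < j → y j < x i}

lemma Sset.strictAnti {K : ℕ} {x y : Fin K → ℝ} (h : y ∈ Sset x) : StrictAnti y :=
  fun i j hij => (h.2 i j hij).trans (h.1 i)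

lemma Wmap_eq {K : ℕ} (x y : Fin K → ℝ) (i : Fin K) :
    Wmap x y i = (y i - x i) * ∏ j ∈ univ.erase i, ((x i - y j) / (x i - x j)) := by
  unfold Wmap
  rw [← Finset.mul_prod_erase univ _ (Finset.mem_univ i), Finset.prod_div_distrib]
  ring

lemma Wmap_pos {K : ℕ} {x y : Fin K → ℝ} (hx : StrictAnti x) (h : y ∈ Sset x) (i : Fin K) :
    0 < Wmap x y i := by
  rw [Wmap_eq]
  refine mul_pos (sub_pos.mpr (h.1 i)) (Finset.prod_pos fun j hj => ?_)
  rcases lt_or_gt_of_ne (Finset.ne_of_mem_erase hj) with hji | hij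
  · have := hx hji
    exact div_pos_of_neg_of_neg (by linarith [h.1 j]) (by linarith)
  · have := hx hij
    exact div_pos (by linarith [h.2 i j hij]) (by linarith)

lemma exists_root_Ioo (p : Polynomial ℝ) {a b : ℝ} (hab : a < b)
    (h : p.eval a * p.eval b < 0) : ∃ t, a < t ∧ t < b ∧ p.eval t = 0 := by
  rcases mul_neg_iff.mp h with ⟨h1, h2⟩ | ⟨h1, h2⟩
  · obtain ⟨t, ht, h0⟩ := intermediate_value_Ioo' hab.le p.continuous.continuousOn ⟨h2, h1⟩
    exact ⟨t, ht.1, ht.2, h0⟩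
  · obtain ⟨t, ht, h0⟩ := intermediate_value_Ioo hab.le p.continuous.continuousOn ⟨h1, h2⟩
    exact ⟨t, ht.1, ht.2, h0⟩

lemma Pw_sign {K : ℕ} {x w : Fin K → ℝ} (hx : StrictAnti x) (hw : ∀ i, 0 < w i)
    (i k : Fin K) (hik : i < k) (hn : ∀ j, j ≤ i ∨ k ≤ j) :
    (Pw x w).eval (x k) * (Pw x w).eval (x i) < 0 := by
  rw [Pw_eval_x, Pw_eval_x]
  have hki : i ∈ univ.erase k := by simp [hik.ne]
  have hik' : k ∈ univ.erase i := by simp [hik.ne']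
  rw [← Finset.mul_prod_erase _ _ hki, ← Finset.mul_prod_erase _ _ hik',
    Finset.erase_right_comm (a := i) (b := k)]
  have hpos : 0 < (∏ j ∈ (univ.erase k).erase i, (x k - x j)) *
      ∏ j ∈ (univ.erase k).erase i, (x i - x j) := by
    rw [← Finset.prod_mul_distrib]
    refine Finset.prod_pos fun j hj => ?_
    simp only [Finset.mem_erase, Finset.mem_univ, and_true] at hj
    rcases hn j with h | h
    · have h1 := hx (lt_of_le_of_ne h hj.1)
      have h2 := hx hik
      exact mul_pos_of_neg_of_neg (by linarith) (by linarith)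
    · have h1 := hx (lt_of_le_of_ne h (Ne.symm hj.2))
      have h2 := hx hik
      exact mul_pos (by linarith) (by linarith)
  have h2 := sub_pos.mpr (hx hik)
  have : 0 < w k * w i * (x i - x k) ^ 2 * ((∏ j ∈ (univ.erase k).erase i, (x k - x j)) *
      ∏ j ∈ (univ.erase k).erase i, (x i - x j)) :=
    mul_pos (mul_pos (mul_pos (hw k) (hw i)) (pow_pos h2 2)) hpos
  nlinarith [this]

lemma exists_Sset {K : ℕ} {x w : Fin K → ℝ} (hx : StrictAnti x) (hw : ∀ i, 0 < w i) :
    ∃ y ∈ Sset x, Wmap x y = w := by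
  have hroot : ∀ k : Fin K, ∃ t, x k < t ∧ (∀ i, i < k → t < x i) ∧ (Pw x w).eval t = 0 := by
    intro k
    by_cases hk : (k : ℕ) = 0
    · have hneg : (Pw x w).eval (x k) < 0 := by
        rw [Pw_eval_x, neg_lt_zero]
        refine mul_pos (hw k) (Finset.prod_pos fun j hj => sub_pos.mpr (hx ?_))
        have := Finset.ne_of_mem_erase hj
        rw [Fin.lt_def, hk]
        have h' : (j : ℕ) ≠ k := fun h => this (Fin.ext h)
        omega
      have ht : Tendsto (fun t => (Pw x w).eval t) atTop atTop := by
        apply Polynomial.tendsto_atTop_of_leadingCoeff_nonneg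
        · rw [Pw_degree]; exact_mod_cast k.pos
        · rw [(Pw_monic x w).leadingCoeff]; norm_num
      obtain ⟨b, hb1, hb2⟩ := ((ht.eventually_gt_atTop 0).and (eventually_gt_atTop (x k))).exists
      obtain ⟨t, h1, h2, h3⟩ := exists_root_Ioo (Pw x w) hb2 (mul_neg_of_neg_of_pos hneg hb1)
      exact ⟨t, h1, fun i hi => absurd hi (by rw [Fin.lt_def, hk]; omega), h3⟩
    · let i : Fin K := ⟨k - 1, by omega⟩
      have hik : i < k := by rw [Fin.lt_def]; simp only [i]; omega
      obtain ⟨t, h1, h2, h3⟩ := exists_root_Ioo (Pw x w) (hx hik)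
        (Pw_sign hx hw i k hik fun j => by rw [Fin.le_def, Fin.le_def]; simp only [i]; omega)
      refine ⟨t, h1, fun j hj => lt_of_lt_of_le h2 (hx.antitone ?_), h3⟩
      rw [Fin.le_def]; rw [Fin.lt_def] at hj; simp only [i]; omega
  choose y hy1 hy2 hy3 using hroot
  have hS : y ∈ Sset x := ⟨hy1, fun i j hij => hy2 j i hij⟩
  refine ⟨y, hS, ?_⟩
  rw [← pz_eq_Pw_iff hx.injective]
  refine monic_eq_of_eval (pz_monic y) (Pw_monic x w) (pz_degree y) (Pw_degree x w) y
    (Sset.strictAnti hS).injective fun i => ?_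
  rw [hy3, pz_eval]
  exact Finset.prod_eq_zero (Finset.mem_univ i) (sub_self _)

lemma Wmap_injOn {K : ℕ} {x : Fin K → ℝ} (hx : StrictAnti x) : Set.InjOn (Wmap x) (Sset x) := by
  intro y hy z hz h
  apply pz_inj (Sset.strictAnti hy).antitone (Sset.strictAnti hz).antitone
  rw [(pz_eq_Pw_iff hx.injective y _).mpr rfl, (pz_eq_Pw_iff hx.injective z _).mpr rfl, h]

lemma Wmap_image {K : ℕ} {x : Fin K → ℝ} (hx : StrictAnti x) :
    Wmap x '' Sset x = {w | ∀ i, 0 < w i} := by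
  ext w
  constructor
  · rintro ⟨y, hy, rfl⟩ i
    exact Wmap_pos hx hy i
  · intro hw
    obtain ⟨y, hy, h⟩ := exists_Sset hx hw
    exact ⟨y, hy, h⟩

lemma Sset_measurable {K : ℕ} (x : Fin K → ℝ) : MeasurableSet (Sset x) := by
  unfold Sset
  measurability

/-- change of variables along the secular map -/
lemma Wmap_cov {K : ℕ} {x : Fin K → ℝ} (hx : StrictAnti x) (g : (Fin K → ℝ) → ℝ≥0∞) :
    ∫⁻ w in {w | ∀ i, 0 < w i}, g w =
      ∫⁻ y in Sset x, ENNReal.ofReal (aV y / aV x) * g (Wmap x y) := by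
  rw [← Wmap_image hx, lintegral_image_eq_lintegral_abs_det_fderiv_mul volume (Sset_measurable x)
    (fun y _ => (Wmap_hasFDerivAt x y).hasFDerivWithinAt) (Wmap_injOn hx)]
  refine setLIntegral_congr_fun (Sset_measurable x) fun y hy => ?_
  beta_reduce
  rw [abs_det_Wder x y hx.injective (Sset.strictAnti hy).injective]

/-! ## Part C : product densities and block norms -/

lemma lintegral_fin_prod {n : ℕ} {μ : Fin n → Measure ℝ} [∀ i, SigmaFinite (μ i)]
    {f : Fin n → ℝ → ℝ≥0∞} (hf : ∀ i, Measurable (f i)) :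
    ∫⁻ x, ∏ i, f i (x i) ∂(Measure.pi μ) = ∏ i, ∫⁻ t, f i t ∂(μ i) := by
  induction n with
  | zero => simp
  | succ n ih =>
    have hmp := (measurePreserving_piFinSuccAbove μ 0).symm
    rw [← hmp.lintegral_comp (by fun_prop)]
    have : ∀ z : ℝ × (Fin n → ℝ), ∏ i, f i
        ((MeasurableEquiv.piFinSuccAbove (fun _ : Fin (n+1) => ℝ) 0).symm z i)
        = f 0 z.1 * ∏ i : Fin n, f i.succ (z.2 i) := by
      intro z
      rw [Fin.prod_univ_succ]
      simp [MeasurableEquiv.piFinSuccAbove]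
    simp_rw [this]
    rw [lintegral_prod_mul (g := fun x : Fin n → ℝ => ∏ i : Fin n, f i.succ (x i))
      (hf 0).aemeasurable (Measurable.aemeasurable (by fun_prop)), Fin.prod_univ_succ]
    congr 1
    simpa using ih (μ := fun i => μ i.succ) (fun i => hf i.succ)

lemma lintegral_fintype_prod {ι : Type*} [Fintype ι] {μ : ι → Measure ℝ} [∀ i, SigmaFinite (μ i)]
    {f : ι → ℝ → ℝ≥0∞} (hf : ∀ i, Measurable (f i)) :
    ∫⁻ x, ∏ i, f i (x i) ∂(Measure.pi μ) = ∏ i, ∫⁻ t, f i t ∂(μ i) := by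
  let e := (Fintype.equivFin ι).symm
  rw [← (measurePreserving_piCongrLeft _ e).lintegral_comp (by fun_prop)]
  simp_rw [← e.prod_comp, MeasurableEquiv.coe_piCongrLeft, Equiv.piCongrLeft_apply_apply]
  exact lintegral_fin_prod fun i => hf _

lemma pi_withDensity {ι : Type*} [Fintype ι] {μ : ι → Measure ℝ} [∀ i, SigmaFinite (μ i)]
    {f : ι → ℝ → ℝ≥0∞} (hf : ∀ i, Measurable (f i))
    [∀ i, SigmaFinite ((μ i).withDensity (f i))] :
    Measure.pi (fun i => (μ i).withDensity (f i)) =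
      (Measure.pi μ).withDensity (fun x => ∏ i, f i (x i)) := by
  refine Measure.pi_eq fun s hs => ?_
  rw [withDensity_apply _ (MeasurableSet.univ_pi hs), ← lintegral_indicator (MeasurableSet.univ_pi hs)]
  have : ∀ x : ι → ℝ, (Set.univ.pi s).indicator (fun x => ∏ i, f i (x i)) x
      = ∏ i, (s i).indicator (f i) (x i) := by
    intro x
    by_cases hx : x ∈ Set.univ.pi s
    · rw [Set.indicator_of_mem hx]
      exact Finset.prod_congr rfl fun i _ => (Set.indicator_of_mem (hx i trivial) _).symm
    · rw [Set.indicator_of_notMem hx]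
      simp only [Set.mem_pi, Set.mem_univ, true_implies, not_forall] at hx
      obtain ⟨i, hi⟩ := hx
      exact (Finset.prod_eq_zero (Finset.mem_univ i) (Set.indicator_of_notMem hi _)).symm
  simp_rw [this]
  rw [lintegral_fintype_prod fun i => (hf i).indicator (hs i)]
  refine Finset.prod_congr rfl fun i _ => ?_
  rw [lintegral_indicator (hs i), withDensity_apply _ (hs i)]

/-- one-dimensional density `(e/2) t^{e/2-1}` on `t > 0` -/
def rho (e : ℕ) (t : ℝ) : ℝ := if 0 < t then (e / 2 : ℝ) * t ^ ((e : ℝ) / 2 - 1) else 0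

lemma rho_measurable (e : ℕ) : Measurable (rho e) := by
  unfold rho
  exact Measurable.ite measurableSet_Ioi (by fun_prop) measurable_const

lemma rho_Iic {e : ℕ} (he : 1 ≤ e) (t : ℝ) :
    (volume.withDensity (fun s => ENNReal.ofReal (rho e s))) (Set.Iic t)
      = if 0 < t then ENNReal.ofReal (t ^ ((e : ℝ) / 2)) else 0 := by
  rw [withDensity_apply _ measurableSet_Iic]
  have he' : (0 : ℝ) < (e : ℝ) / 2 := by
    have : (1 : ℝ) ≤ e := by exact_mod_cast he
    linarith
  have h1 : ∀ s, ENNReal.ofReal (rho e s) = (Set.Ioi 0).indicator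
      (fun s => ENNReal.ofReal ((e / 2 : ℝ) * s ^ ((e : ℝ) / 2 - 1))) s := by
    intro s
    unfold rho
    by_cases hs : 0 < s
    · simp [hs]
    · simp [hs]
  simp_rw [h1]
  rw [setLIntegral_indicator measurableSet_Ioi, Set.Ioi_inter_Iic]
  split_ifs with ht
  · have hintv : IntervalIntegrable (fun s : ℝ => (e / 2 : ℝ) * s ^ ((e : ℝ) / 2 - 1)) volume 0 t :=
      (intervalIntegral.intervalIntegrable_rpow' (by linarith)).const_mul _
    rw [← ofReal_integral_eq_lintegral_ofReal]
    · rw [← intervalIntegral.integral_of_le ht.le, intervalIntegral.integral_const_mul,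
        integral_rpow (Or.inl (by linarith))]
      congr 1
      rw [sub_add_cancel, Real.zero_rpow he'.ne']
      field_simp; simp
    · exact (intervalIntegrable_iff_integrableOn_Ioc_of_le ht.le).mp hintv
    · refine (ae_restrict_mem measurableSet_Ioc).mono fun s hs => ?_
      have := hs.1
      positivity
  · rw [Set.Ioc_eq_empty ht]; simp

/-- block squared norms -/
def wblk {D K : ℕ} (b : Fin D → Fin K) (a : Fin D → ℝ) : Fin K → ℝ :=
  fun i => ∑ j with b j = i, a j ^ 2

lemma wblk_measurable {D K : ℕ} (b : Fin D → Fin K) : Measurable (wblk b) := by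
  unfold wblk
  fun_prop

/-- size of a block -/
def bsz {D K : ℕ} (b : Fin D → Fin K) (i : Fin K) : ℕ := #{j | b j = i}

lemma wblk_box {D K : ℕ} (b : Fin D → Fin K) (hb : Function.Surjective b) (t : Fin K → ℝ) :
    volume {a | ∀ i, wblk b a i ≤ t i} =
      (∏ i, if 0 < t i then ENNReal.ofReal (t i ^ ((bsz b i : ℝ) / 2)) else 0) *
        volume {a : Fin D → ℝ | ∀ i, wblk b a i ≤ 1} := by
  by_cases ht : ∀ i, 0 < t i
  · let d : Fin D → ℝ := fun j => Real.sqrt (t (b j))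
    have hd : ∀ j, 0 < d j := fun j => Real.sqrt_pos.mpr (ht _)
    let L : (Fin D → ℝ) →ₗ[ℝ] (Fin D → ℝ) := Matrix.toLin' (Matrix.diagonal d)
    have hL : ∀ a, L a = fun j => d j * a j := by
      intro a; funext j; simp [L, Matrix.mulVec_diagonal]
    have himg : {a | ∀ i, wblk b a i ≤ t i} = L '' {a : Fin D → ℝ | ∀ i, wblk b a i ≤ 1} := by
      have key : ∀ a i, wblk b (L a) i = t i * wblk b a i := by
        intro a i
        rw [hL]
        unfold wblk
        rw [Finset.mul_sum]
        refine Finset.sum_congr rfl fun j hj => ?_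
        rw [(Finset.mem_filter.mp hj).2.symm]
        simp only [d, mul_pow, Real.sq_sqrt (ht _).le]
      ext a
      constructor
      · intro h
        have e : L (fun j => (d j)⁻¹ * a j) = a := by
          rw [hL]; funext j; have := (hd j).ne'; field_simp
        refine ⟨fun j => (d j)⁻¹ * a j, fun i => ?_, e⟩
        have h1 := key (fun j => (d j)⁻¹ * a j) i
        rw [e] at h1
        have h2 := h i
        rw [h1] at h2
        nlinarith [ht i]
      · rintro ⟨a', h, rfl⟩ i
        rw [key]
        nlinarith [ht i, h i]
    rw [himg, Measure.addHaar_image_linearMap]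
    congr 1
    have hdet : LinearMap.det L = ∏ j, d j := by
      simp [L, Matrix.det_diagonal]
    rw [hdet, abs_of_pos (Finset.prod_pos fun j _ => hd j)]
    rw [← Finset.prod_fiberwise (s := univ) (g := b) (f := d), ENNReal.ofReal_prod_of_nonneg]
    · refine Finset.prod_congr rfl fun i _ => ?_
      rw [if_pos (ht i)]
      congr 1
      have : ∀ j ∈ ({j | b j = i} : Finset (Fin D)), d j = Real.sqrt (t i) := by
        intro j hj; simp only [d]; rw [(Finset.mem_filter.mp hj).2]
      rw [Finset.prod_congr rfl this, Finset.prod_const, Real.sqrt_eq_rpow, ← Real.rpow_natCast,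
        ← Real.rpow_mul (ht i).le]
      congr 1
      unfold bsz; ring
    · exact fun i _ => Finset.prod_nonneg fun j _ => (hd j).le
  · push Not at ht
    obtain ⟨i, hi⟩ := ht
    rw [Finset.prod_eq_zero (Finset.mem_univ i) (by rw [if_neg (not_lt.mpr hi)]), zero_mul]
    obtain ⟨j, hj⟩ := hb i
    refine measure_mono_null (t := {a | a j = 0}) ?_ ?_
    · intro a ha
      have h1 : wblk b a i ≤ 0 := (ha i).trans hi
      have h2 : a j ^ 2 ≤ wblk b a i := by
        unfold wblk
        exact Finset.single_le_sum (f := fun j => a j ^ 2) (fun _ _ => sq_nonneg _)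
          (by simp [hj])
      have : a j ^ 2 = 0 := le_antisymm (h2.trans h1) (sq_nonneg _)
      simpa using this
    · have : {a : Fin D → ℝ | a j = 0} = Function.eval j ⁻¹' {0} := rfl
      rw [this, volume_pi]
      exact Measure.pi_eval_preimage_null _ (by simp)

lemma wblk_unit {D K : ℕ} (b : Fin D → Fin K) :
    volume {a : Fin D → ℝ | ∀ i, wblk b a i ≤ 1} ≠ 0 ∧
      volume {a : Fin D → ℝ | ∀ i, wblk b a i ≤ 1} ≠ ∞ := by
  constructor
  · have hc : Continuous (wblk b) := by unfold wblk; fun_prop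
    have ho : IsOpen {a : Fin D → ℝ | ∀ i, wblk b a i < 1} := by
      simp only [Set.ofPred_forall]
      exact isOpen_iInter_of_finite fun i =>
        isOpen_lt ((continuous_apply i).comp hc) continuous_const
    have hne : ({a : Fin D → ℝ | ∀ i, wblk b a i < 1}).Nonempty :=
      ⟨0, fun i => by simp [wblk]⟩
    have := ho.measure_pos volume hne
    refine (this.trans_le (measure_mono fun a ha i => (ha i).le)).ne'
  · refine ((measure_mono (t := Set.Icc (fun _ => -1) (fun _ => 1)) ?_).trans_lt
      (isCompact_Icc.measure_lt_top)).ne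
    intro a ha
    have : ∀ j, a j ^ 2 ≤ 1 := by
      intro j
      refine le_trans ?_ (ha (b j))
      unfold wblk
      exact Finset.single_le_sum (f := fun j => a j ^ 2) (fun _ _ => sq_nonneg _) (by simp)
    exact ⟨fun j => (abs_le.mp (abs_le_one_iff_mul_self_le_one.mpr (by nlinarith [this j]))).1,
      fun j => (abs_le.mp (abs_le_one_iff_mul_self_le_one.mpr (by nlinarith [this j]))).2⟩

lemma wblk_push {D K : ℕ} (b : Fin D → Fin K) (hb : Function.Surjective b) :
    ∃ c : ℝ≥0∞, c ≠ 0 ∧ c ≠ ∞ ∧ ∀ Φ : (Fin K → ℝ) → ℝ≥0∞, Measurable Φ →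
      ∫⁻ a, Φ (wblk b a) = c * ∫⁻ w in {w | ∀ i, 0 < w i},
        ENNReal.ofReal (∏ i, w i ^ ((bsz b i : ℝ) / 2 - 1)) * Φ w := by
  obtain ⟨h0, hT⟩ := wblk_unit b
  set V := volume {a : Fin D → ℝ | ∀ i, wblk b a i ≤ 1} with hV
  have he : ∀ i, 1 ≤ bsz b i := by
    intro i
    obtain ⟨j, hj⟩ := hb i
    exact Finset.card_pos.mpr ⟨j, by simp [hj]⟩
  have hsf : ∀ i, SigmaFinite (volume.withDensity (fun s => ENNReal.ofReal (rho (bsz b i) s))) :=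
    fun i => SigmaFinite.withDensity_ofReal _
  have hpi : Measure.pi (fun i => volume.withDensity (fun s => ENNReal.ofReal (rho (bsz b i) s)))
      = V⁻¹ • Measure.map (wblk b) volume := by
    refine Measure.pi_eq_generateFrom (C := fun _ => Set.range Set.Iic)
      (fun _ => (borel_eq_generateFrom_Iic ℝ).symm.trans (BorelSpace.measurable_eq).symm)
      (fun _ => isPiSystem_Iic) (fun i => ⟨fun k => Set.Iic (k : ℝ), fun k => ⟨k, rfl⟩, ?_, ?_⟩) ?_
    · intro k
      rw [rho_Iic (he i)]
      split_ifs <;> simp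
    · exact Set.iUnion_eq_univ_iff.mpr fun x => exists_nat_ge x
    · intro s hs
      choose t ht using hs
      have hs' : Set.univ.pi s = {w | ∀ i, w i ≤ t i} := by
        ext w; simp [← ht]
      rw [hs', Measure.smul_apply, Measure.map_apply (wblk_measurable b) (by measurability)]
      change V⁻¹ * volume {a | ∀ i, wblk b a i ≤ t i} = _
      rw [wblk_box b hb t, mul_comm _ V, ← mul_assoc, ENNReal.inv_mul_cancel h0 hT, one_mul]
      refine Finset.prod_congr rfl fun i _ => ?_
      rw [← ht i, rho_Iic (he i)]
  have hmap : Measure.map (wblk b) volume = V • Measure.pi (fun i =>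
      volume.withDensity (fun s => ENNReal.ofReal (rho (bsz b i) s))) := by
    rw [hpi, smul_smul, ENNReal.mul_inv_cancel h0 hT, one_smul]
  rw [pi_withDensity (fun i => (rho_measurable _).ennreal_ofReal), ← volume_pi] at hmap
  have hc0 : (0 : ℝ) < ∏ i, ((bsz b i : ℝ) / 2) := Finset.prod_pos fun i _ => by
    have : (1 : ℝ) ≤ bsz b i := by exact_mod_cast he i
    linarith
  refine ⟨V * ENNReal.ofReal (∏ i, ((bsz b i : ℝ) / 2)),
    mul_ne_zero h0 (by simpa using hc0), ENNReal.mul_ne_top hT ENNReal.ofReal_ne_top, ?_⟩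
  intro Φ hΦ
  rw [← lintegral_map hΦ (wblk_measurable b), hmap, lintegral_smul_measure, smul_eq_mul,
    lintegral_withDensity_eq_lintegral_mul _ (by
      refine Finset.measurable_prod _ fun i _ => ?_
      exact ((rho_measurable _).comp (measurable_pi_apply i)).ennreal_ofReal) hΦ, mul_assoc]
  congr 1
  have hmeas : MeasurableSet {w : Fin K → ℝ | ∀ i, 0 < w i} := by measurability
  rw [← lintegral_const_mul' _ _ ENNReal.ofReal_ne_top, ← lintegral_indicator hmeas]
  refine lintegral_congr fun w => ?_
  by_cases hw : ∀ i, 0 < w i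
  · rw [Set.indicator_of_mem (by exact hw), Pi.mul_apply, ← mul_assoc, ← ENNReal.ofReal_mul hc0.le,
      ← Finset.prod_mul_distrib, ← ENNReal.ofReal_prod_of_nonneg]
    · simp [rho, hw]
    · intro i _
      unfold rho; have := hw i; split_ifs; positivity
  · rw [Set.indicator_of_notMem (by exact hw), Pi.mul_apply]
    push Not at hw
    obtain ⟨i, hi⟩ := hw
    rw [Finset.prod_eq_zero (Finset.mem_univ i), zero_mul]
    simp [rho, not_lt.mpr hi]

/-! ## Part D : eigenvalues, rank one perturbations -/

/-- decreasing eigenvalues of a real matrix -/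
def eigR {n : ℕ} (M : Matrix (Fin n) (Fin n) ℝ) : Fin n → ℝ :=
  fun i => eigsDesc (M.map Complex.ofReal) i

lemma eigR_eq {n : ℕ} {M : Matrix (Fin n) (Fin n) ℝ} {z : Fin n → ℝ}
    (hz : Antitone z) (h : M.charpoly = pz z) : eigR M = z := by
  funext i
  unfold eigR
  rw [eigsDesc_of_charpoly M z hz h]
  simp [extF]

lemma exists_spec {n : ℕ} {M : Matrix (Fin n) (Fin n) ℝ} (hM : M.transpose = M) :
    ∃ (U : Matrix (Fin n) (Fin n) ℝ) (z : Fin n → ℝ), Antitone z ∧ U.transpose * U = 1 ∧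
      U * U.transpose = 1 ∧ M = U * Matrix.diagonal z * U.transpose := by
  have hH : M.IsHermitian := by
    unfold Matrix.IsHermitian
    rw [Matrix.conjTranspose_eq_transpose_of_trivial]; exact hM
  have hs := hH.spectral_theorem
  set V : Matrix (Fin n) (Fin n) ℝ := (hH.eigenvectorUnitary : Matrix (Fin n) (Fin n) ℝ) with hV
  have hs' : M = V * Matrix.diagonal hH.eigenvalues * V.transpose := by
    conv_lhs => rw [hs]
    rw [Unitary.conjStarAlgAut_apply]
    simp [hV, Function.comp_def, Matrix.star_eq_conjTranspose]
  have hV1 : V.transpose * V = 1 := by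
    have := Unitary.coe_star_mul_self hH.eigenvectorUnitary
    rw [Matrix.star_eq_conjTranspose, Matrix.conjTranspose_eq_transpose_of_trivial] at this
    exact this
  let σ := Tuple.sort (fun i => - hH.eigenvalues i)
  have hσ : Antitone (hH.eigenvalues ∘ σ) := by
    have := Tuple.monotone_sort (fun i => - hH.eigenvalues i)
    intro i j hij
    have := this hij
    simpa using this
  have hU : (V.submatrix id σ).transpose * V.submatrix id σ = 1 := by
    rw [Matrix.transpose_submatrix, ← Matrix.submatrix_mul _ _ _ _ _ Function.bijective_id, hV1]
    exact Matrix.submatrix_one_equiv σ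
  refine ⟨V.submatrix id σ, hH.eigenvalues ∘ σ, hσ, hU, mul_eq_one_comm.mp hU, ?_⟩
  rw [← Matrix.submatrix_diagonal_equiv, Matrix.transpose_submatrix,
    ← Matrix.submatrix_mul _ _ _ _ _ σ.bijective, ← Matrix.submatrix_mul _ _ _ _ _ σ.bijective]
  simpa using hs'

lemma charpoly_conj {n : ℕ} (U M : Matrix (Fin n) (Fin n) ℝ) (h : U.transpose * U = 1) :
    (U * M * U.transpose).charpoly = M.charpoly := by
  rw [Matrix.mul_assoc, Matrix.charpoly_mul_comm, Matrix.mul_assoc, h, Matrix.mul_one]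

lemma charpoly_diag {n : ℕ} (z : Fin n → ℝ) : (Matrix.diagonal z).charpoly = pz z := by
  rw [Matrix.charpoly_diagonal]; rfl

lemma eigR_spec {n : ℕ} {M : Matrix (Fin n) (Fin n) ℝ} (hM : M.transpose = M) :
    Antitone (eigR M) ∧ M.charpoly = pz (eigR M) ∧
    ∃ U : Matrix (Fin n) (Fin n) ℝ, U.transpose * U = 1 ∧
      U * U.transpose = 1 ∧ M = U * Matrix.diagonal (eigR M) * U.transpose := by
  obtain ⟨U, z, hz, h1, h2, h3⟩ := exists_spec hM
  have hc : M.charpoly = pz z := by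
    rw [h3, charpoly_conj _ _ h1, charpoly_diag]
  have := eigR_eq hz hc
  rw [this]
  exact ⟨hz, hc, U, h1, h2, h3⟩

/-- evaluation vector used to recover the roots -/
def evK {K : ℕ} (y : Fin K → ℝ) : Fin K → ℝ := fun i => ∏ j, ((i : ℕ) - y j)

lemma evK_injOn {K : ℕ} : Set.InjOn (evK (K := K)) {y | Antitone y} := by
  intro y hy z hz h
  apply pz_inj hy hz
  refine monic_eq_of_eval (pz_monic _) (pz_monic _) (pz_degree _) (pz_degree _)
    (fun i : Fin K => ((i : ℕ) : ℝ)) (fun i j hij => Fin.ext (Nat.cast_injective (R := ℝ) hij)) fun i => ?_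
  rw [pz_eval, pz_eval]
  exact congrFun h i

lemma antitone_measurable {K : ℕ} : MeasurableSet {y : Fin K → ℝ | Antitone y} := by
  unfold Antitone
  measurability

lemma evK_embedding {K : ℕ} :
    MeasurableEmbedding (({y | Antitone y} : Set (Fin K → ℝ)).domRestrict evK) :=
  ContinuousOn.measurableEmbedding antitone_measurable
    (by unfold evK; fun_prop) evK_injOn

/-- measurable version of the eigenvalue map -/
def eigM {K : ℕ} (M : Matrix (Fin K) (Fin K) ℝ) : Fin K → ℝ :=
  Function.extend (({y | Antitone y} : Set (Fin K → ℝ)).domRestrict evK) Subtype.val (fun _ => 0)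
    (fun i => (((i : ℕ) : ℝ) • (1 : Matrix (Fin K) (Fin K) ℝ) - M).det)

lemma eigM_measurable {K : ℕ} : Measurable (eigM (K := K)) := by
  unfold eigM
  refine (evK_embedding.measurable_extend measurable_subtype_coe measurable_const).comp ?_
  refine measurable_pi_lambda _ fun i => ?_
  have hc : Continuous (fun M : Matrix (Fin K) (Fin K) ℝ =>
    (((i : ℕ) : ℝ) • (1 : Matrix (Fin K) (Fin K) ℝ) - M).det) := by
    apply Continuous.matrix_det
    exact continuous_const.sub continuous_id
  exact Continuous.measurable (α := Fin K → Fin K → ℝ) hc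

lemma eigM_eq {K : ℕ} {M : Matrix (Fin K) (Fin K) ℝ} (hM : M.transpose = M) : eigM M = eigR M := by
  obtain ⟨h1, h2, -⟩ := eigR_spec hM
  have : (fun i : Fin K => (((i : ℕ) : ℝ) • (1 : Matrix (Fin K) (Fin K) ℝ) - M).det)
      = ({y | Antitone y} : Set (Fin K → ℝ)).domRestrict evK ⟨eigR M, h1⟩ := by
    funext i
    rw [Set.domRestrict_apply]
    unfold evK
    rw [← pz_eval, ← h2, Matrix.eval_charpoly, Matrix.scalar_apply, Matrix.smul_one_eq_diagonal]
  unfold eigM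
  rw [this, evK_embedding.injective.extend_apply]

lemma Pw_eval' {K : ℕ} (x w : Fin K → ℝ) (t : ℝ) (ht : ∀ i, t ≠ x i) :
    (Pw x w).eval t = (∏ j, (t - x j)) * (1 - ∑ i, w i / (t - x i)) := by
  rw [Pw_eval, mul_sub, mul_one, Finset.mul_sum]
  congr 1
  refine Finset.sum_congr rfl fun i _ => ?_
  have : t - x i ≠ 0 := sub_ne_zero.mpr (ht i)
  rw [← Finset.mul_prod_erase univ _ (Finset.mem_univ i)]
  field_simp

lemma poly_eq_of_eval {K : ℕ} {p q : Polynomial ℝ} (x : Fin K → ℝ)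
    (h : ∀ t, (∀ i, t ≠ x i) → p.eval t = q.eval t) : p = q := by
  apply Polynomial.eq_of_infinite_eval_eq
  refine ((Set.finite_range x).infinite_compl).mono ?_
  intro t ht
  exact h t fun i hi => ht ⟨i, hi.symm⟩

lemma charpoly_rank_one {K : ℕ} (z a : Fin K → ℝ) :
    (Matrix.diagonal z + Matrix.vecMulVec a a).charpoly = Pw z (fun j => a j ^ 2) := by
  refine poly_eq_of_eval z fun t ht => ?_
  rw [Matrix.eval_charpoly, Pw_eval' _ _ _ ht]
  have hd : (Matrix.diagonal (fun i => t - z i)).det = ∏ j, (t - z j) := Matrix.det_diagonal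
  have h0 : ∀ i, t - z i ≠ 0 := fun i => sub_ne_zero.mpr (ht i)
  have hu : IsUnit (Matrix.diagonal (fun i => t - z i)).det := by
    rw [hd, isUnit_iff_ne_zero]
    exact Finset.prod_ne_zero_iff.mpr fun i _ => h0 i
  have e : Matrix.scalar (Fin K) t - (Matrix.diagonal z + Matrix.vecMulVec a a)
      = Matrix.diagonal (fun i => t - z i) +
        Matrix.replicateCol Unit (-a) * Matrix.replicateRow Unit a := by
    ext i j
    by_cases hij : i = j
    · subst hij
      simp [Matrix.vecMulVec_apply, Matrix.mul_apply]
      ring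
    · simp [Matrix.vecMulVec_apply, Matrix.mul_apply, hij]
  rw [e, Matrix.det_add_replicateCol_mul_replicateRow hu, hd]
  congr 1
  have hinv : (Matrix.diagonal (fun i => t - z i))⁻¹ = Matrix.diagonal (fun i => (t - z i)⁻¹) := by
    apply Matrix.inv_eq_right_inv
    rw [Matrix.diagonal_mul_diagonal]
    simp [h0]
  rw [hinv, Matrix.det_unique, Matrix.add_apply, Matrix.mul_apply]
  simp only [Matrix.one_apply_eq, Matrix.mul_diagonal,
    Matrix.replicateRow_apply, Matrix.replicateCol_apply, Pi.neg_apply]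
  rw [sub_eq_add_neg, ← Finset.sum_neg_distrib]
  congr 1
  refine Finset.sum_congr rfl fun i _ => ?_
  rw [div_eq_mul_inv]; ring

/-- block map : `j ↦ min j (K-1)` -/
def bmap (D K : ℕ) (hK : 1 ≤ K) : Fin D → Fin K := fun j => ⟨min j (K - 1), by omega⟩

lemma bmap_surj {D K : ℕ} (hK : 1 ≤ K) (hKD : K ≤ D) : Function.Surjective (bmap D K hK) := by
  intro i
  refine ⟨⟨i, by omega⟩, ?_⟩
  ext; simp only [bmap]; omega

lemma bsz_bmap {D K : ℕ} (hK : 1 ≤ K) (hKD : K ≤ D) (i : Fin K) :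
    bsz (bmap D K hK) i = if (i : ℕ) = K - 1 then D - K + 1 else 1 := by
  unfold bsz
  split_ifs with h
  · have : ({j | bmap D K hK j = i} : Finset (Fin D)) = Finset.Ici ⟨K - 1, by omega⟩ := by
      ext j
      simp only [Finset.mem_filter, Finset.mem_univ, true_and, Finset.mem_Ici, Fin.ext_iff, bmap,
        Fin.le_def]
      omega
    rw [this, Fin.card_Ici]; simp only; omega
  · have : ({j | bmap D K hK j = i} : Finset (Fin D)) = {⟨i, by omega⟩} := by
      ext j
      simp only [Finset.mem_filter, Finset.mem_univ, true_and, Finset.mem_singleton, Fin.ext_iff,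
        bmap]
      omega
    rw [this, Finset.card_singleton]

lemma prod_bmap {D K : ℕ} (hK : 1 ≤ K) (hKD : K ≤ D) (f : Fin D → ℝ) :
    ∏ j, f j = (∏ i : Fin K, f ⟨i, by omega⟩) * ∏ j : Fin (D - K), f ⟨K + j, by omega⟩ := by
  obtain ⟨e, rfl⟩ := Nat.exists_eq_add_of_le hKD
  rw [Fin.prod_univ_add]
  congr 1
  refine Fintype.prod_equiv (finCongr (by omega)) _ _ fun j => ?_
  congr 1

/-- the eigenvalues after the rank one perturbation -/
def zext {D K : ℕ} (hK : 1 ≤ K) (x y : Fin K → ℝ) : Fin D → ℝ :=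
  fun j => if h : (j : ℕ) < K then y ⟨j, h⟩ else x (bmap D K hK j)

lemma pz_zext {D K : ℕ} (hK : 1 ≤ K) (hKD : K ≤ D) {x y w : Fin K → ℝ}
    (a : Fin D → ℝ) (hw : wblk (bmap D K hK) a = w) (hy : pz y = Pw x w) :
    Pw (x ∘ bmap D K hK) (fun j => a j ^ 2) = pz (zext hK x y : Fin D → ℝ) := by
  refine poly_eq_of_eval x fun t ht => ?_
  rw [Pw_eval' (x ∘ bmap D K hK) _ _ (fun i => ht _), pz_eval, prod_bmap hK hKD (fun j => t - (zext hK x y : Fin D → ℝ) j),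
    prod_bmap hK hKD (fun j => t - (x ∘ bmap D K hK) j)]
  have h1 : ∏ i : Fin K, (t - zext hK x y (⟨i, by omega⟩ : Fin D)) = (Pw x w).eval t := by
    rw [← hy, pz_eval]
    refine Finset.prod_congr rfl fun i _ => ?_
    simp [zext]
  have h2 : ∏ i : Fin K, (t - (x ∘ bmap D K hK) (⟨i, by omega⟩ : Fin D)) = ∏ i, (t - x i) := by
    refine Finset.prod_congr rfl fun i _ => ?_
    have : bmap D K hK (⟨i, by omega⟩ : Fin D) = i := by
      ext; simp only [bmap]; omega
    simp [this]
  have h3 : ∏ j : Fin (D - K), (t - zext hK x y (⟨K + j, by omega⟩ : Fin D))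
      = ∏ j : Fin (D - K), (t - (x ∘ bmap D K hK) (⟨K + j, by omega⟩ : Fin D)) := by
    refine Finset.prod_congr rfl fun i _ => ?_
    simp [zext]
  rw [h1, h2, h3, Pw_eval' _ _ _ ht]
  have h4 : ∑ j, a j ^ 2 / (t - (x ∘ bmap D K hK) j) = ∑ i, w i / (t - x i) := by
    rw [← Finset.sum_fiberwise (s := univ) (g := bmap D K hK)]
    refine Finset.sum_congr rfl fun i _ => ?_
    rw [← hw]
    unfold wblk
    rw [Finset.sum_div]
    refine Finset.sum_congr rfl fun j hj => ?_
    rw [Function.comp_apply, (Finset.mem_filter.mp hj).2]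
  rw [h4]; ring

lemma zext_antitone {D K : ℕ} (hK : 1 ≤ K) {x y : Fin K → ℝ} (hx : StrictAnti x)
    (hy : y ∈ Sset x) : Antitone (zext hK x y : Fin D → ℝ) := by
  intro i j hij
  rw [Fin.le_def] at hij
  unfold zext
  split_ifs with h1 h2 h2
  · exact (Sset.strictAnti hy).antitone hij
  · omega
  · refine le_trans (hx.antitone ?_) (hy.1 _).le
    rw [Fin.le_def]; simp only [bmap]; omega
  · refine hx.antitone ?_
    rw [Fin.le_def]; simp only [bmap]; omega

/-- measurable inverse of the secular map -/
def Yinv {K : ℕ} (x w : Fin K → ℝ) : Fin K → ℝ :=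
  eigM (Matrix.diagonal x + Matrix.vecMulVec (fun i => Real.sqrt (w i)) (fun i => Real.sqrt (w i)))

lemma Yinv_measurable {K : ℕ} (x : Fin K → ℝ) : Measurable (Yinv x) := by
  unfold Yinv
  refine eigM_measurable.comp ?_
  refine measurable_pi_lambda _ fun i => measurable_pi_lambda _ fun j => ?_
  simp only [Matrix.add_apply, Matrix.vecMulVec_apply]
  fun_prop

lemma sym_rank_one {K : ℕ} {M : Matrix (Fin K) (Fin K) ℝ} (hM : M.transpose = M)
    (a : Fin K → ℝ) : (M + Matrix.vecMulVec a a).transpose = M + Matrix.vecMulVec a a := by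
  rw [Matrix.transpose_add, hM, Matrix.transpose_vecMulVec]

lemma Yinv_Wmap {K : ℕ} {x y : Fin K → ℝ} (hx : StrictAnti x) (hy : y ∈ Sset x) :
    Yinv x (Wmap x y) = y := by
  unfold Yinv
  rw [eigM_eq (sym_rank_one (Matrix.diagonal_transpose x) _)]
  refine eigR_eq (Sset.strictAnti hy).antitone ?_
  rw [charpoly_rank_one, (pz_eq_Pw_iff hx.injective y _).mpr rfl]
  congr 1
  funext i
  rw [Real.sq_sqrt (Wmap_pos hx hy i).le]

lemma eig_perturb {D K : ℕ} (hK : 1 ≤ K) (hKD : K ≤ D) {x : Fin K → ℝ} (hx : StrictAnti x)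
    (a : Fin D → ℝ) (hw : ∀ i, 0 < wblk (bmap D K hK) a i) (i : Fin K) :
    eigR (Matrix.diagonal (x ∘ bmap D K hK) + Matrix.vecMulVec a a) ⟨i, by omega⟩
      = Yinv x (wblk (bmap D K hK) a) i := by
  obtain ⟨y, hy, h⟩ := exists_Sset hx hw
  rw [eigR_eq (zext_antitone hK hx hy)
    ((charpoly_rank_one _ _).trans (pz_zext hK hKD a rfl ((pz_eq_Pw_iff hx.injective y _).mpr h))),
    ← h, Yinv_Wmap hx hy]
  simp [zext]

lemma wblk_pos_ae {D K : ℕ} (b : Fin D → Fin K) (hb : Function.Surjective b) :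
    ∀ᵐ a : Fin D → ℝ, ∀ i, 0 < wblk b a i := by
  rw [ae_all_iff]
  intro i
  obtain ⟨j, hj⟩ := hb i
  have : ∀ᵐ a : Fin D → ℝ, a j ≠ 0 := by
    rw [ae_iff]
    have : {a : Fin D → ℝ | ¬ a j ≠ 0} = Function.eval j ⁻¹' {0} := by ext; simp
    rw [this, volume_pi]
    exact Measure.pi_eval_preimage_null _ (by simp)
  filter_upwards [this] with a ha
  unfold wblk
  exact lt_of_lt_of_le (by positivity : 0 < a j ^ 2)
    (Finset.single_le_sum (f := fun j => a j ^ 2) (fun _ _ => sq_nonneg _) (by simp [hj]))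

/-- rotation invariance of Lebesgue measure -/
lemma lintegral_mulVec {D : ℕ} (U : Matrix (Fin D) (Fin D) ℝ) (hU : U.transpose * U = 1)
    (f : (Fin D → ℝ) → ℝ≥0∞) (hf : Measurable f) :
    ∫⁻ a, f (U.mulVec a) = ∫⁻ a, f a := by
  have hdet : |LinearMap.det (Matrix.toLin' U)| = 1 := by
    rw [LinearMap.det_toLin']
    have := congrArg Matrix.det hU
    rw [Matrix.det_mul, Matrix.det_transpose, Matrix.det_one] at this
    have h2 : |U.det| * |U.det| = 1 := by rw [← abs_mul, this, abs_one]
    nlinarith [abs_nonneg U.det]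
  have h0 : LinearMap.det (Matrix.toLin' U) ≠ 0 := by
    intro h; rw [h] at hdet; simp at hdet
  have := Real.map_linearMap_volume_pi_eq_smul_volume_pi h0
  rw [abs_inv, hdet] at this
  simp only [inv_one, ENNReal.ofReal_one, one_smul] at this
  conv_rhs => rw [← this]
  rw [lintegral_map hf (by fun_prop)]
  rfl

/-- the transition weight -/
def Tker (D K : ℕ) (hK : 1 ≤ K) (x y : Fin K → ℝ) : ℝ :=
  aV y / aV x * ∏ i, Wmap x y i ^ ((bsz (bmap D K hK) i : ℝ) / 2 - 1)

lemma aV_nonneg {K : ℕ} (x : Fin K → ℝ) : 0 ≤ aV x := abs_nonneg _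

lemma step_kernel (D K : ℕ) (hK : 1 ≤ K) (hKD : K ≤ D) :
    ∃ c : ℝ≥0∞, c ≠ 0 ∧ c ≠ ∞ ∧ ∀ (M : Matrix (Fin D) (Fin D) ℝ) (x : Fin K → ℝ)
      (_ : M.transpose = M) (_ : StrictAnti x) (_ : eigR M = x ∘ bmap D K hK)
      (F : (Fin K → ℝ) → ℝ≥0∞), Measurable F →
      ∫⁻ a, F (fun i => eigR (M + Matrix.vecMulVec a a) ⟨i, by omega⟩)
        = c * ∫⁻ y in Sset x, ENNReal.ofReal (Tker D K hK x y) * F y := by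
  obtain ⟨c, h0, hT, hc⟩ := wblk_push (bmap D K hK) (bmap_surj hK hKD)
  refine ⟨c, h0, hT, fun M x hM hx hz F hF => ?_⟩
  obtain ⟨-, -, U, hU1, hU2, hMU⟩ := eigR_spec hM
  rw [hz] at hMU
  have hUt : U.transpose.transpose * U.transpose = 1 := by rw [Matrix.transpose_transpose, hU2]
  have e1 : ∀ a : Fin D → ℝ, eigR (M + Matrix.vecMulVec a a) =
      eigM (Matrix.diagonal (x ∘ bmap D K hK) +
        Matrix.vecMulVec (U.transpose.mulVec a) (U.transpose.mulVec a)) := by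
    intro a
    rw [eigM_eq (sym_rank_one (Matrix.diagonal_transpose _) _)]
    refine eigR_eq (eigR_spec (sym_rank_one (Matrix.diagonal_transpose _) _)).1 ?_
    rw [← (eigR_spec (sym_rank_one (Matrix.diagonal_transpose _) _)).2.1]
    refine Eq.trans (congrArg Matrix.charpoly ?_) (charpoly_conj U _ hU1)
    rw [Matrix.mul_add, Matrix.add_mul, ← hMU, Matrix.mul_vecMulVec, Matrix.vecMulVec_mul]
    congr 1
    rw [Matrix.mulVec_mulVec, hU2, Matrix.one_mulVec, Matrix.vecMul_transpose, Matrix.mulVec_mulVec,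
      hU2, Matrix.one_mulVec]
  simp_rw [e1]
  have hmeas : Measurable fun a : Fin D → ℝ => F (fun i : Fin K =>
      eigM (Matrix.diagonal (x ∘ bmap D K hK) + Matrix.vecMulVec a a) ⟨i, by omega⟩) := by
    refine hF.comp (measurable_pi_lambda _ fun i => (measurable_pi_apply _).comp
      (eigM_measurable.comp ?_))
    refine measurable_pi_lambda _ fun i => measurable_pi_lambda _ fun j => ?_
    simp only [Matrix.add_apply, Matrix.vecMulVec_apply]
    fun_prop
  rw [lintegral_mulVec U.transpose hUt _ hmeas]
  have e2 : ∫⁻ a : Fin D → ℝ, F (fun i : Fin K =>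
      eigM (Matrix.diagonal (x ∘ bmap D K hK) + Matrix.vecMulVec a a) ⟨i, by omega⟩)
      = ∫⁻ a, F (Yinv x (wblk (bmap D K hK) a)) := by
    refine lintegral_congr_ae ?_
    filter_upwards [wblk_pos_ae _ (bmap_surj hK hKD)] with a ha
    congr 1
    funext i
    rw [eigM_eq (sym_rank_one (Matrix.diagonal_transpose _) _), eig_perturb hK hKD hx a ha i]
  rw [e2, hc (fun w => F (Yinv x w)) (hF.comp (Yinv_measurable x)), Wmap_cov hx]
  congr 1
  refine setLIntegral_congr_fun (Sset_measurable x) fun y hy => ?_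
  beta_reduce
  rw [Yinv_Wmap hx hy, ← mul_assoc, ← ENNReal.ofReal_mul (div_nonneg (aV_nonneg _) (aV_nonneg _))]
  rfl

/-! ## Part E : explicit form of the transition weight -/

lemma vand_eq {K : ℕ} {y : Fin K → ℝ} (hy : StrictAnti y) (Y : ℕ → ℝ) (h : ∀ i : Fin K, Y i = y i) :
    vand K Y = aV y := by
  rw [aV_eq]
  unfold vand
  rw [Finset.prod_range]
  refine Finset.prod_congr rfl fun i _ => ?_
  rw [Finset.prod_range, ← Finset.prod_filter]
  have : ({a | (i : ℕ) < (a : ℕ)} : Finset (Fin K)) = Ioi i := by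
    ext j; simp
  rw [this]
  refine Finset.prod_congr rfl fun j hj => ?_
  rw [h, h, abs_of_pos (sub_pos.mpr (hy (Finset.mem_Ioi.mp hj)))]

lemma cross_eq {a b : ℕ} (X Y : ℕ → ℝ) :
    cross a b X Y = ∏ i : Fin a, ∏ j : Fin b, |X i - Y j| := by
  unfold cross
  rw [Finset.prod_range]
  refine Finset.prod_congr rfl fun i _ => ?_
  rw [Finset.prod_range]

lemma aV_pos {K : ℕ} {x : Fin K → ℝ} (hx : StrictAnti x) : 0 < aV x := by
  rw [aV_eq]
  refine Finset.prod_pos fun i _ => Finset.prod_pos fun j hj => ?_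
  exact abs_pos.mpr (sub_pos.mpr (hx (Finset.mem_Ioi.mp hj))).ne'

lemma Wmap_abs {K : ℕ} {x y : Fin K → ℝ} (hx : StrictAnti x) (hy : y ∈ Sset x) (i : Fin K) :
    Wmap x y i = (∏ j, |x i - y j|) / ∏ j ∈ univ.erase i, |x i - x j| := by
  rw [← abs_of_pos (Wmap_pos hx hy i)]
  unfold Wmap
  rw [abs_div, abs_neg, Finset.abs_prod, Finset.abs_prod]

lemma prod_Wmap {K : ℕ} {x y : Fin K → ℝ} (hx : StrictAnti x) (hy : y ∈ Sset x) :
    ∏ i, Wmap x y i = (∏ i, ∏ j, |x i - y j|) / aV x ^ 2 := by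
  rw [← prod_erase_abs, ← Finset.prod_div_distrib]
  exact Finset.prod_congr rfl fun i _ => Wmap_abs hx hy i

lemma Tker_eq {D K : ℕ} (hK : 1 ≤ K) (hKD : K ≤ D) {x y : Fin K → ℝ} (hx : StrictAnti x)
    (hy : y ∈ Sset x) :
    Tker D K hK x y = aV y * (∏ i, ∏ j, |x i - y j|) ^ (-(1 / 2) : ℝ) *
      Wmap x y ⟨K - 1, by omega⟩ ^ (((D : ℝ) - K) / 2) := by
  unfold Tker
  have h1 : ∀ i : Fin K, Wmap x y i ^ ((bsz (bmap D K hK) i : ℝ) / 2 - 1)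
      = Wmap x y i ^ (-(1 / 2) : ℝ) *
        (if i = ⟨K - 1, by omega⟩ then Wmap x y i ^ (((D : ℝ) - K) / 2) else 1) := by
    intro i
    rw [bsz_bmap hK hKD]
    by_cases hi : (i : ℕ) = K - 1
    · rw [if_pos hi, if_pos (Fin.ext hi), ← Real.rpow_add (Wmap_pos hx hy i)]
      congr 1
      push_cast [Nat.cast_sub hKD]; ring
    · rw [if_neg hi, if_neg (fun h => hi (by rw [h])), mul_one]
      congr 1; norm_num
  simp_rw [h1]
  rw [Finset.prod_mul_distrib, Finset.prod_ite_eq' univ]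
  simp only [Finset.mem_univ, if_true]
  rw [Real.finsetProd_rpow univ _ (fun i _ => (Wmap_pos hx hy i).le), prod_Wmap hx hy]
  have hc : 0 ≤ ∏ i, ∏ j, |x i - y j| :=
    Finset.prod_nonneg fun i _ => Finset.prod_nonneg fun j _ => abs_nonneg _
  have ha := aV_pos hx
  rw [Real.div_rpow hc (by positivity)]
  have : (aV x ^ 2) ^ (-(1 / 2) : ℝ) = (aV x)⁻¹ := by
    rw [← Real.rpow_natCast, ← Real.rpow_mul ha.le, ← Real.rpow_neg_one]
    norm_num
  rw [this]
  field_simp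

/-- strict chain conditions -/
def SC (R N : ℕ) (L : ℕ → ℕ → ℝ) : Prop :=
  ∀ l, l < N → (fun i : Fin (min (l + 1) R) => L (l + 1) i) ∈
    Sset (fun i : Fin (min (l + 1) R) => L l i)

/-- levels vanish beyond their width -/
def Zb (R N : ℕ) (L : ℕ → ℕ → ℝ) : Prop := ∀ l, l ≤ N → ∀ i, min l R ≤ i → L l i = 0

/-- density of the process of eigenvalues -/
def Pden (D R N : ℕ) (L : ℕ → ℕ → ℝ) : ℝ :=
  (∏ l ∈ Icc 1 N, vand (min l R) (L l)) *
  (∏ l ∈ Ico 1 N, cross (min l R) (min (l + 1) R) (L l) (L (l + 1)) ^ (-(1 / 2) : ℝ)) *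
  ∏ i ∈ range (min N R), L (min N R) i ^ (((D : ℝ) - (min N R : ℕ) - 1) / 2)

lemma SC.mono {R N N' : ℕ} {L : ℕ → ℕ → ℝ} (h : SC R N L) (hN : N' ≤ N) : SC R N' L :=
  fun l hl => h l (by omega)

lemma SC.pos {R N : ℕ} {L : ℕ → ℕ → ℝ} (h : SC R N L) (hz : Zb R N L) :
    ∀ l, l ≤ N → ∀ i, i < min l R → 0 < L l i := by
  intro l
  induction l with
  | zero => intro _ i hi; simp at hi
  | succ l ih =>
    intro hl i hi
    have h1 := (h l (by omega)).1 ⟨i, hi⟩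
    simp only at h1
    refine lt_of_le_of_lt ?_ h1
    by_cases hi' : i < min l R
    · exact (ih (by omega) i hi').le
    · exact (hz l (by omega) i (by omega)).ge

lemma SC.anti {R N : ℕ} {L : ℕ → ℕ → ℝ} (h : SC R N L) (hz : Zb R N L) (l : ℕ) (hl : l ≤ N)
    (i j : ℕ) (hij : i < j) (hj : j < min l R) : L l j < L l i := by
  obtain ⟨l', rfl⟩ : ∃ l', l = l' + 1 := ⟨l - 1, by omega⟩
  exact (Sset.strictAnti (h l' (by omega))) (a := ⟨i, by omega⟩) (b := ⟨j, hj⟩) hij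

lemma SC.strictAnti {R N : ℕ} {L : ℕ → ℕ → ℝ} (h : SC R N L) (hz : Zb R N L) :
    StrictAnti (fun i : Fin (min (N + 1) R) => L N i) := by
  intro i j hij
  rw [Fin.lt_def] at hij
  by_cases hj : (j : ℕ) < min N R
  · exact h.anti hz N le_rfl _ _ hij hj
  · change L N j < L N i
    rw [hz N le_rfl j (by omega)]
    exact h.pos hz N le_rfl _ (by omega)

lemma Tker_explicit {D R N : ℕ} {L : ℕ → ℕ → ℝ} (hD : 1 ≤ D)
    (hR : ∀ l, l ≤ N + 1 → min l R = min l D) (hK : 1 ≤ min (N + 1) R)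
    (h : SC R (N + 1) L) (hz : Zb R (N + 1) L) :
    Tker D (min (N + 1) R) hK (fun i => L N i) (fun i => L (N + 1) i) =
      vand (min (N + 1) R) (L (N + 1)) *
      cross (min N R) (min (N + 1) R) (L N) (L (N + 1)) ^ (-(1 / 2) : ℝ) *
      ((∏ i ∈ range (min (N + 1) R), L (min (N + 1) R) i ^
          (((D : ℝ) - (min (N + 1) R : ℕ) - 1) / 2)) /
        ∏ i ∈ range (min N R), L (min N R) i ^ (((D : ℝ) - (min N R : ℕ) - 1) / 2)) := by
  have hzN : Zb R N L := fun l hl => hz l (by omega)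
  have hN := h.mono (Nat.le_succ N)
  have hx := hN.strictAnti hzN
  have hy := h N (by omega)
  have hpos := h.pos hz
  have hKD : min (N + 1) R ≤ D := by have := hR (N + 1) le_rfl; omega
  rw [Tker_eq hK hKD hx hy, ← vand_eq (Sset.strictAnti hy) (L (N + 1)) fun _ => rfl, mul_assoc,
    mul_assoc]
  congr 1
  have hr := hR (N + 1) le_rfl
  rcases Nat.lt_or_ge N R with hlt | hge
  · -- ramp
    have e1 : min (N + 1) R = N + 1 := by omega
    have e2 : min N R = N := by omega
    generalize hK' : min (N + 1) R = K at *
    subst e1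
    rw [e2]
    have hW := Wmap_abs hx hy (Fin.last N)
    have hlast : L N N = 0 := hzN N le_rfl N (by omega)
    have hpy : ∀ j : Fin (N + 1), 0 < L (N + 1) j := fun j => hpos (N + 1) le_rfl j (by omega)
    have hpx : ∀ j : Fin N, 0 < L N j := fun j => hpos N (by omega) j (by omega)
    have hA : ∏ j : Fin (N + 1), |L N (Fin.last N : Fin (N + 1)) - L (N + 1) j|
        = ∏ j : Fin (N + 1), L (N + 1) j := by
      refine Finset.prod_congr rfl fun j _ => ?_
      rw [Fin.val_last, hlast, zero_sub, abs_neg, abs_of_pos (hpy j)]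
    have hB : ∏ j ∈ univ.erase (Fin.last N), |L N (Fin.last N : Fin (N + 1)) - L N j|
        = ∏ j : Fin N, L N j := by
      have : univ.erase (Fin.last N) = Finset.map Fin.castSuccEmb univ := by
        ext j
        simp only [Finset.mem_erase, Finset.mem_univ, and_true, Finset.mem_map, true_and]
        constructor
        · intro hj
          exact ⟨j.castPred hj, Fin.castSucc_castPred j hj⟩
        · rintro ⟨k, rfl⟩
          exact (Fin.castSucc_lt_last k).ne
      rw [this, Finset.prod_map]
      refine Finset.prod_congr rfl fun j _ => ?_
      simp only [Fin.val_last, Fin.castSuccEmb_apply, Fin.val_castSucc]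
      rw [hlast, zero_sub, abs_neg, abs_of_pos (hpx j)]
    have hidx : (⟨N + 1 - 1, by omega⟩ : Fin (N + 1)) = Fin.last N := rfl
    rw [hidx, hW, hA, hB]
    have hC : ∏ i : Fin (N + 1), ∏ j : Fin (N + 1), |L N i - L (N + 1) j|
        = cross N (N + 1) (L N) (L (N + 1)) * ∏ j : Fin (N + 1), L (N + 1) j := by
      rw [Fin.prod_univ_castSucc, cross_eq, hA]
      rfl
    rw [hC]
    set Y := ∏ j : Fin (N + 1), L (N + 1) j with hY
    set X := ∏ j : Fin N, L N j with hX
    have hYp : 0 < Y := Finset.prod_pos fun j _ => hpy j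
    have hXp : 0 < X := Finset.prod_pos fun j _ => hpx j
    have hCn : 0 ≤ cross N (N + 1) (L N) (L (N + 1)) := by
      rw [cross_eq]
      exact Finset.prod_nonneg fun i _ => Finset.prod_nonneg fun j _ => abs_nonneg _
    rw [Real.mul_rpow hCn hYp.le, Real.div_rpow hYp.le hXp.le, Finset.prod_range,
      Finset.prod_range, Real.finsetProd_rpow univ _ (fun i _ => (hpy i).le),
      Real.finsetProd_rpow univ _ (fun i _ => (hpx i).le), ← hY, ← hX, mul_assoc]
    congr 1
    rw [← mul_div_assoc, ← Real.rpow_add hYp]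
    push_cast
    congr 2 <;> ring
  · have e1 : min (N + 1) R = R := by omega
    have e2 : min N R = R := by omega
    have e3 : D = R := by omega
    have hR1 : 0 < R := by omega
    have hne : (∏ i ∈ range R, L R i ^ (((D : ℝ) - (R : ℕ) - 1) / 2)) ≠ 0 := by
      refine (Finset.prod_pos fun i hi => Real.rpow_pos_of_pos ?_ _).ne'
      exact hpos R (by omega) i (by simpa using hi)
    have hex : ((D : ℝ) - (min (N + 1) R : ℕ)) / 2 = 0 := by rw [e1, e3]; simp
    rw [hex, Real.rpow_zero, mul_one, e2, cross_eq]
    generalize hK' : min (N + 1) R = K at *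
    subst e1
    rw [div_self hne, mul_one]

lemma Pden_succ {D R N : ℕ} {L : ℕ → ℕ → ℝ} (hD : 1 ≤ D)
    (hR : ∀ l, l ≤ N + 1 → min l R = min l D) (hK : 1 ≤ min (N + 1) R)
    (h : SC R (N + 1) L) (hz : Zb R (N + 1) L) :
    Pden D R (N + 1) L = Pden D R N L *
      Tker D (min (N + 1) R) hK (fun i => L N i) (fun i => L (N + 1) i) := by
  rw [Tker_explicit hD hR hK h hz]
  unfold Pden
  have hne : (∏ i ∈ range (min N R), L (min N R) i ^ (((D : ℝ) - (min N R : ℕ) - 1) / 2)) ≠ 0 := by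
    refine (Finset.prod_pos fun i hi => Real.rpow_pos_of_pos ?_ _).ne'
    exact h.pos hz (min N R) (by omega) i (by simpa using hi)
  rw [Finset.prod_Icc_succ_top (by omega)]
  rcases Nat.eq_zero_or_pos N with rfl | hN
  · simp [cross]
  · rw [Finset.prod_Ico_succ_top (by omega)]
    field_simp

/-! ## Part F : arrays, appending one level -/

lemma mem_coords {k n : ℕ} {p : ℕ × ℕ} : p ∈ coords k n ↔ p.1 < k ∧ p.2 < min (p.1 + 1) n := by
  unfold coords
  rw [Finset.mem_filter, Finset.mem_product, Finset.mem_range, Finset.mem_range]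
  constructor
  · rintro ⟨⟨h1, h2⟩, h3⟩; exact ⟨h1, h3⟩
  · rintro ⟨h1, h3⟩; exact ⟨⟨h1, by omega⟩, h3⟩

/-- append a level to an array -/
def snocA {N R : ℕ} (μ : Arr N R) (y : Fin (min (N + 1) R) → ℝ) : Arr (N + 1) R :=
  fun p => if h : p.1 ∈ coords N R then μ ⟨p.1, h⟩ else extF y p.1.2

/-- index equivalence behind `snocA` -/
def snocE (N R : ℕ) : {p // p ∈ coords N R} ⊕ Fin (min (N + 1) R) ≃ {p // p ∈ coords (N + 1) R} where
  toFun := Sum.elim (fun p : {p // p ∈ coords N R} => ⟨p.1, by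
      have := mem_coords.mp p.2
      exact mem_coords.mpr ⟨by omega, this.2⟩⟩) (fun i : Fin (min (N + 1) R) => ⟨(N, (i : ℕ)), by
      exact mem_coords.mpr ⟨by simp, i.2⟩⟩)
  invFun p := if h : p.1.1 < N then Sum.inl ⟨p.1, mem_coords.mpr ⟨h, (mem_coords.mp p.2).2⟩⟩
    else Sum.inr ⟨p.1.2, by
      have := mem_coords.mp p.2
      have h2 : p.1.1 = N := by omega
      rw [h2] at this; exact this.2⟩
  left_inv s := by
    rcases s with p | i
    · have := mem_coords.mp p.2
      simp [this.1]
    · simp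
  right_inv p := by
    by_cases h : p.1.1 < N
    · simp [h]
    · have := mem_coords.mp p.2
      have h2 : p.1.1 = N := by omega
      simp only [h, dite_false, Sum.elim_inr]
      ext1
      exact Prod.ext h2.symm rfl

lemma snocA_eq (N R : ℕ) : (fun q : Arr N R × (Fin (min (N + 1) R) → ℝ) => snocA q.1 q.2) =
    ⇑(MeasurableEquiv.piCongrLeft (fun _ : {p // p ∈ coords (N + 1) R} => ℝ) (snocE N R)) ∘
    ⇑(MeasurableEquiv.sumPiEquivProdPi
      (fun _ : {p // p ∈ coords N R} ⊕ Fin (min (N + 1) R) => ℝ)).symm := by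
  funext q p
  obtain ⟨s, rfl⟩ := (snocE N R).surjective p
  rw [Function.comp_apply, MeasurableEquiv.coe_piCongrLeft, Equiv.piCongrLeft_apply_apply]
  rcases s with p | i
  · have : ((snocE N R) (Sum.inl p)).1 = p.1 := rfl
    simp only [snocA, this, p.2, dite_true]
    rfl
  · have : ((snocE N R) (Sum.inr i)).1 = (N, (i : ℕ)) := rfl
    have h : ¬ ((N, (i : ℕ)) ∈ coords N R) := fun h => by simpa using (mem_coords.mp h).1
    simp only [snocA, this, h, dite_false]
    simp only [extF, i.2, dite_true]
    rfl

lemma snocA_mp (N R : ℕ) : MeasurePreserving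
    (fun q : Arr N R × (Fin (min (N + 1) R) → ℝ) => snocA q.1 q.2)
    (volume.prod volume) volume := by
  have h1 := (volume_measurePreserving_sumPiEquivProdPi
    (fun _ : {p // p ∈ coords N R} ⊕ Fin (min (N + 1) R) => ℝ)).symm
  have h2 := volume_measurePreserving_piCongrLeft (fun _ : {p // p ∈ coords (N + 1) R} => ℝ)
    (snocE N R)
  rw [snocA_eq]
  exact h2.comp h1

lemma snocA_measurable (N R : ℕ) : Measurable
    (fun q : Arr N R × (Fin (min (N + 1) R) → ℝ) => snocA q.1 q.2) := (snocA_mp N R).measurable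

lemma lintegral_snocA {N R : ℕ} (G : Arr (N + 1) R → ℝ≥0∞) (hG : Measurable G) :
    ∫⁻ μ, G μ = ∫⁻ μ : Arr N R, ∫⁻ y : Fin (min (N + 1) R) → ℝ, G (snocA μ y) := by
  rw [← (snocA_mp N R).lintegral_comp hG]
  exact lintegral_prod (fun q : Arr N R × (Fin (min (N + 1) R) → ℝ) => G (snocA q.1 q.2))
    (hG.comp (snocA_mp N R).measurable).aemeasurable

lemma lintegral_snocA' {N R k : ℕ} (hk : k = min (N + 1) R) (G : Arr (N + 1) R → ℝ≥0∞)
    (hG : Measurable G) :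
    ∫⁻ μ, G μ = ∫⁻ y : Fin k → ℝ, ∫⁻ μ : Arr N R, G (snocA μ (fun i => y (Fin.cast hk.symm i))) := by
  subst hk
  rw [← (snocA_mp N R).lintegral_comp hG]
  exact lintegral_prod_symm (fun q : Arr N R × (Fin (min (N + 1) R) → ℝ) => G (snocA q.1 q.2))
    (hG.comp (snocA_mp N R).measurable).aemeasurable

lemma lev_zero {N R : ℕ} (μ : Arr N R) : lev μ 0 = 0 := by
  funext i; simp [lev]

lemma lev_Zb {N R : ℕ} (μ : Arr N R) : Zb R N (lev μ) := by
  intro l hl i hi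
  unfold lev ent
  split_ifs with h1 h2
  · rfl
  · have := mem_coords.mp h2
    simp only at this; omega
  · rfl

lemma lev_snocA_le {N R : ℕ} (μ : Arr N R) (y : Fin (min (N + 1) R) → ℝ) {l : ℕ} (hl : l ≤ N) :
    lev (snocA μ y) l = lev μ l := by
  funext i
  unfold lev
  by_cases h0 : l = 0
  · simp [h0]
  · simp only [h0, if_false]
    unfold ent
    by_cases h : (l - 1, i) ∈ coords N R
    · have h' : (l - 1, i) ∈ coords (N + 1) R := by
        have := mem_coords.mp h
        exact mem_coords.mpr ⟨by simp only at *; omega, this.2⟩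
      simp [h, h', snocA]
    · have h' : (l - 1, i) ∉ coords (N + 1) R := by
        intro h'
        have := mem_coords.mp h'
        exact h (mem_coords.mpr ⟨by simp only at *; omega, this.2⟩)
      simp [h, h']

lemma lev_snocA_top {N R : ℕ} (μ : Arr N R) (y : Fin (min (N + 1) R) → ℝ) :
    lev (snocA μ y) (N + 1) = extF y := by
  funext i
  unfold lev ent
  simp only [Nat.succ_ne_zero, if_false, Nat.add_sub_cancel]
  by_cases h : i < min (N + 1) R
  · have h' : (N, i) ∈ coords (N + 1) R := mem_coords.mpr ⟨by simp, h⟩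
    have h2 : ¬ ((N, i) ∈ coords N R) := fun h => by simpa using (mem_coords.mp h).1
    simp [h', snocA, h2]
  · have h' : (N, i) ∉ coords (N + 1) R := fun h' => h (mem_coords.mp h').2
    simp [h', extF, h]

lemma extF_fin {k : ℕ} (y : Fin k → ℝ) (i : Fin k) : extF y i = y i := by simp [extF]

lemma arr_ext {N R : ℕ} {μ ν : Arr N R}
    (h : ∀ l i, l < N → i < min (l + 1) R → lev μ (l + 1) i = lev ν (l + 1) i) : μ = ν := by
  funext p
  have hp := mem_coords.mp p.2
  have := h p.1.1 p.1.2 hp.1 hp.2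
  have h2 : (p.1.1, p.1.2) ∈ coords N R := p.2
  simpa [lev, ent, h2] using this

lemma lev_measurable {N R : ℕ} (l i : ℕ) : Measurable fun μ : Arr N R => lev μ l i := by
  unfold lev ent
  split_ifs
  · exact measurable_const
  · exact measurable_pi_apply _
  · exact measurable_const

lemma SC_congr {R N : ℕ} {L L' : ℕ → ℕ → ℝ} (h : ∀ l, l ≤ N → L l = L' l) :
    SC R N L ↔ SC R N L' := by
  unfold SC
  refine forall_congr' fun l => forall_congr' fun hl => ?_
  rw [h l (by omega), h (l + 1) (by omega)]

lemma Pden_congr {D R N : ℕ} {L L' : ℕ → ℕ → ℝ} (h : ∀ l, l ≤ N → L l = L' l) :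
    Pden D R N L = Pden D R N L' := by
  unfold Pden
  congr 1
  · congr 1
    · refine Finset.prod_congr rfl fun l hl => ?_
      rw [h l (Finset.mem_Icc.mp hl).2]
    · refine Finset.prod_congr rfl fun l hl => ?_
      have := (Finset.mem_Ico.mp hl).2
      rw [h l (by omega), h (l + 1) (by omega)]
  · rw [h (min N R) (by omega)]

lemma SC_snocA {N R : ℕ} (μ : Arr N R) (y : Fin (min (N + 1) R) → ℝ) :
    SC R (N + 1) (lev (snocA μ y)) ↔
      SC R N (lev μ) ∧ y ∈ Sset (fun i : Fin (min (N + 1) R) => lev μ N i) := by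
  have e : (fun i : Fin (min (N + 1) R) => extF y i) = y := by funext i; exact extF_fin y i
  constructor
  · intro h
    refine ⟨(SC_congr fun l hl => lev_snocA_le μ y hl).mp (h.mono (Nat.le_succ N)), ?_⟩
    have := h N (by omega)
    rw [lev_snocA_top, lev_snocA_le μ y le_rfl, e] at this
    exact this
  · rintro ⟨h1, h2⟩ l hl
    by_cases hl' : l < N
    · have := h1 l hl'
      rwa [lev_snocA_le μ y (by omega), lev_snocA_le μ y (by omega)]
    · obtain rfl : l = N := by omega
      rw [lev_snocA_top, lev_snocA_le μ y le_rfl, e]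
      exact h2

lemma SC_measurable (R N : ℕ) {X : Type*} [MeasurableSpace X] {L : X → ℕ → ℕ → ℝ}
    (hL : ∀ l i, Measurable fun x => L x l i) : MeasurableSet {x | SC R N (L x)} := by
  have e : {x | SC R N (L x)} = ⋂ (l : ℕ) (_ : l < N),
      ((⋂ i : Fin (min (l + 1) R), {x | L x l i < L x (l + 1) i}) ∩
      (⋂ (i : Fin (min (l + 1) R)) (j : Fin (min (l + 1) R)) (_ : i < j),
        {x | L x (l + 1) j < L x l i})) := by
    ext x
    simp only [Set.mem_iInter, Set.mem_inter_iff]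
    rfl
  rw [e]
  refine MeasurableSet.iInter fun l => MeasurableSet.iInter fun _ => MeasurableSet.inter
    (MeasurableSet.iInter fun i => ?_) (MeasurableSet.iInter fun i => MeasurableSet.iInter fun j =>
      MeasurableSet.iInter fun _ => ?_)
  · exact measurableSet_lt (hL _ _) (hL _ _)
  · exact measurableSet_lt (hL _ _) (hL _ _)

lemma vand_measurable {X : Type*} [MeasurableSpace X] {L : X → ℕ → ℝ}
    (hL : ∀ i, Measurable fun x => L x i) (k : ℕ) : Measurable fun x => vand k (L x) := by
  unfold vand
  refine Finset.measurable_fun_prod _ fun i _ => Finset.measurable_fun_prod _ fun j _ => ?_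
  split_ifs
  · exact (hL i).sub (hL j)
  · exact measurable_const

lemma cross_measurable {X : Type*} [MeasurableSpace X] {L L' : X → ℕ → ℝ}
    (hL : ∀ i, Measurable fun x => L x i) (hL' : ∀ i, Measurable fun x => L' x i) (a b : ℕ) :
    Measurable fun x => cross a b (L x) (L' x) := by
  unfold cross
  refine Finset.measurable_fun_prod _ fun i _ => Finset.measurable_fun_prod _ fun j _ => ?_
  exact ((hL i).sub (hL' j)).abs

lemma Pden_measurable (D R N : ℕ) {X : Type*} [MeasurableSpace X] {L : X → ℕ → ℕ → ℝ}
    (hL : ∀ l i, Measurable fun x => L x l i) : Measurable fun x => Pden D R N (L x) := by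
  unfold Pden
  refine (Measurable.mul (Finset.measurable_fun_prod _ fun l _ => vand_measurable (hL l) _)
    (Finset.measurable_fun_prod _ fun l _ =>
      (cross_measurable (hL l) (hL (l + 1)) _ _).pow_const _)).mul
    (Finset.measurable_fun_prod _ fun l _ => (hL _ l).pow_const _)

/-! ## Part G : Gram matrices -/

lemma eigsDesc_eq_extF {n : ℕ} {M : Matrix (Fin n) (Fin n) ℝ} (hM : M.transpose = M) :
    eigsDesc (M.map Complex.ofReal) = extF (eigR M) := by
  funext i
  exact eigsDesc_of_charpoly M _ (eigR_spec hM).1 (eigR_spec hM).2.1 i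

lemma gram_sym {N D : ℕ} (C : Matrix (Fin N) (Fin D) ℝ) :
    (C.transpose * C).transpose = C.transpose * C := by
  rw [Matrix.transpose_mul, Matrix.transpose_transpose]

lemma eigR_gram_nonneg {N D : ℕ} (C : Matrix (Fin N) (Fin D) ℝ) (i : Fin D) :
    0 ≤ eigR (C.transpose * C) i := by
  obtain ⟨-, -, U, h1, h2, h3⟩ := eigR_spec (gram_sym C)
  have h4 : (C * U).transpose * (C * U) = Matrix.diagonal (eigR (C.transpose * C)) := by
    calc (C * U).transpose * (C * U) = U.transpose * (C.transpose * C) * U := by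
          rw [Matrix.transpose_mul]; simp only [Matrix.mul_assoc]
      _ = U.transpose * (U * Matrix.diagonal (eigR (C.transpose * C)) * U.transpose) * U := by
          rw [← h3]
      _ = (U.transpose * U) * Matrix.diagonal (eigR (C.transpose * C)) * (U.transpose * U) := by
          simp only [Matrix.mul_assoc]
      _ = _ := by rw [h1, Matrix.one_mul, Matrix.mul_one]
  have h5 := congrFun (congrFun h4 i) i
  rw [Matrix.diagonal_apply_eq, Matrix.mul_apply] at h5
  rw [← h5]
  exact Finset.sum_nonneg fun k _ => mul_self_nonneg _

lemma eigs_gram_swap_le {N D : ℕ} (h : N ≤ D) (C : Matrix (Fin N) (Fin D) ℝ) :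
    eigsDesc ((C.transpose * C).map Complex.ofReal) =
      eigsDesc ((C * C.transpose).map Complex.ofReal) := by
  have hs : (C * C.transpose).transpose = C * C.transpose := by
    rw [Matrix.transpose_mul, Matrix.transpose_transpose]
  obtain ⟨ha, hc, -⟩ := eigR_spec hs
  have hnn : ∀ i, 0 ≤ eigR (C * C.transpose) i := by
    have := eigR_gram_nonneg C.transpose
    rwa [Matrix.transpose_transpose] at this
  rw [eigsDesc_eq_extF hs]
  have hx : extF (fun i : Fin D => extF (eigR (C * C.transpose)) i) = extF (eigR (C * C.transpose)) := by
    funext i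
    unfold extF
    by_cases hi : i < N
    · have : i < D := by omega
      simp [hi, this]
    · simp [hi]
  rw [← hx]
  funext i
  refine eigsDesc_of_charpoly _ _ ?_ ?_ i
  · intro i j hij
    unfold extF
    rw [Fin.le_def] at hij
    beta_reduce
    split_ifs with h1 h2 h2
    · exact ha hij
    · omega
    · exact hnn _
    · exact le_rfl
  · have h1 := Matrix.charpoly_mul_comm_of_le C.transpose C (by simpa using h)
    rw [h1, hc]
    unfold pz
    obtain ⟨e, rfl⟩ := Nat.exists_eq_add_of_le h
    rw [Fin.prod_univ_add]
    simp [extF, mul_comm]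

lemma eigs_gram_swap {N D : ℕ} (C : Matrix (Fin N) (Fin D) ℝ) :
    eigsDesc ((C.transpose * C).map Complex.ofReal) =
      eigsDesc ((C * C.transpose).map Complex.ofReal) := by
  rcases le_total N D with h | h
  · exact eigs_gram_swap_le h C
  · have := eigs_gram_swap_le h C.transpose
    rw [Matrix.transpose_transpose] at this
    exact this.symm

/-- the first `k` rows -/
def rowsM {D : ℕ} (k : ℕ) (B : ℕ → Fin D → ℝ) : Matrix (Fin k) (Fin D) ℝ :=
  Matrix.of fun i j => B i j

lemma gramR_eq {D : ℕ} (k : ℕ) (B : ℕ → Fin D → ℝ) :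
    gramR k B = (rowsM k B).transpose * rowsM k B := by
  ext a b
  rw [Matrix.mul_apply]
  unfold gramR rowsM
  simp [Finset.sum_range]

lemma gramR_sym {D : ℕ} (k : ℕ) (B : ℕ → Fin D → ℝ) : (gramR k B).transpose = gramR k B := by
  rw [gramR_eq]; exact gram_sym _

lemma wishEigR_eq {D : ℕ} (k : ℕ) (B : ℕ → Fin D → ℝ) :
    wishEigR k B = extF (eigR (gramR k B)) := eigsDesc_eq_extF (gramR_sym k B)

lemma wishEigR_zero {D : ℕ} (k : ℕ) (B : ℕ → Fin D → ℝ) (i : ℕ) (hi : min k D ≤ i) :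
    wishEigR k B i = 0 := by
  by_cases h : D ≤ i
  · rw [wishEigR_eq]; simp [extF]; omega
  · have hk : k ≤ i := by omega
    unfold wishEigR
    rw [gramR_eq, eigs_gram_swap, eigsDesc_eq_extF]
    · simp [extF]; omega
    · rw [Matrix.transpose_mul, Matrix.transpose_transpose]

lemma wishEigR_fin {D : ℕ} (k : ℕ) (B : ℕ → Fin D → ℝ) (i : Fin D) :
    wishEigR k B i = eigR (gramR k B) i := by
  rw [wishEigR_eq]; exact extF_fin _ _

lemma wishEigR_congr {D : ℕ} {k : ℕ} {B B' : ℕ → Fin D → ℝ} (h : ∀ i, i < k → B i = B' i) :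
    wishEigR k B = wishEigR k B' := by
  have : gramR k B = gramR k B' := by
    ext a b
    simp only [gramR, Matrix.of_apply]
    refine Finset.sum_congr rfl fun i hi => ?_
    rw [h i (Finset.mem_range.mp hi)]
  unfold wishEigR; rw [this]

lemma wishEigR_measurable {D : ℕ} (k : ℕ) {X : Type*} [MeasurableSpace X] {B : X → ℕ → Fin D → ℝ}
    (hB : ∀ i j, Measurable fun x => B x i j) (i : ℕ) : Measurable fun x => wishEigR k (B x) i := by
  have : (fun x => wishEigR k (B x) i) = fun x => extF (eigM (gramR k (B x))) i := by
    funext x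
    rw [wishEigR_eq, eigM_eq (gramR_sym _ _)]
  rw [this]
  unfold extF
  split_ifs with h
  · refine (measurable_pi_apply _).comp (eigM_measurable.comp ?_)
    refine measurable_pi_lambda _ fun a => measurable_pi_lambda _ fun b => ?_
    unfold gramR
    simp only [Matrix.of_apply]
    exact Finset.measurable_fun_sum _ fun i _ => (hB i a).mul (hB i b)
  · exact measurable_const

/-- extend a finite family of rows by zero -/
def extB {N D : ℕ} (B : Fin N → Fin D → ℝ) : ℕ → Fin D → ℝ :=
  fun i j => if h : i < N then B ⟨i, h⟩ j else 0

lemma extB_measurable {N D : ℕ} (i : ℕ) (j : Fin D) :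
    Measurable fun B : Fin N → Fin D → ℝ => extB B i j := by
  unfold extB
  split_ifs
  · fun_prop
  · exact measurable_const

/-- eigenvalue array of the row process -/
def arrB (N R D : ℕ) (B : Fin N → Fin D → ℝ) : Arr N R :=
  fun p => wishEigR (p.1.1 + 1) (extB B) p.1.2

lemma arrB_measurable (N R D : ℕ) : Measurable (arrB N R D) :=
  measurable_pi_lambda _ fun _ => wishEigR_measurable _ (fun i j => extB_measurable i j) _

lemma lev_arrB {N R D : ℕ} (hR : ∀ l, l ≤ N → min l R = min l D) (B : Fin N → Fin D → ℝ) {l : ℕ}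
    (hl : l ≤ N) : lev (arrB N R D B) l = wishEigR l (extB B) := by
  funext i
  by_cases hi : min l R ≤ i
  · rw [lev_Zb _ l hl i hi, wishEigR_zero _ _ _ (by rw [← hR l hl]; exact hi)]
  · have hl0 : l ≠ 0 := by rintro rfl; simp at hi
    obtain ⟨k, rfl⟩ := Nat.exists_eq_succ_of_ne_zero hl0
    have : (k, i) ∈ coords N R := mem_coords.mpr ⟨by simp; omega, by simp only; omega⟩
    simp [lev, ent, this, arrB]

lemma extB_snoc {N D : ℕ} (B : Fin N → Fin D → ℝ) (a : Fin D → ℝ) (i : ℕ) (hi : i < N) :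
    extB (Fin.snoc B a : Fin (N + 1) → Fin D → ℝ) i = extB B i := by
  funext j
  unfold extB
  have h : (⟨i, by omega⟩ : Fin (N + 1)) = Fin.castSucc ⟨i, hi⟩ := rfl
  simp only [hi, dite_true, show i < N + 1 by omega, h]
  rw [Fin.snoc_castSucc (α := fun _ => Fin D → ℝ)]

lemma extB_snoc_last {N D : ℕ} (B : Fin N → Fin D → ℝ) (a : Fin D → ℝ) :
    extB (Fin.snoc B a : Fin (N + 1) → Fin D → ℝ) N = a := by
  funext j
  unfold extB
  have h : (⟨N, by omega⟩ : Fin (N + 1)) = Fin.last N := rfl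
  simp only [show N < N + 1 by omega, dite_true, h]
  rw [Fin.snoc_last (α := fun _ => Fin D → ℝ)]

lemma gramR_snoc {N D : ℕ} (B : Fin N → Fin D → ℝ) (a : Fin D → ℝ) :
    gramR (N + 1) (extB (Fin.snoc B a : Fin (N + 1) → Fin D → ℝ)) =
      gramR N (extB B) + Matrix.vecMulVec a a := by
  ext x y
  simp only [gramR, Matrix.of_apply, Matrix.add_apply, Matrix.vecMulVec_apply,
    Finset.sum_range_succ, extB_snoc_last]
  congr 1
  refine Finset.sum_congr rfl fun i hi => ?_
  rw [extB_snoc _ _ _ (Finset.mem_range.mp hi)]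

lemma lintegral_snocB {N D : ℕ} (G : (Fin (N + 1) → Fin D → ℝ) → ℝ≥0∞) (hG : Measurable G) :
    ∫⁻ B, G B = ∫⁻ B : Fin N → Fin D → ℝ, ∫⁻ a : Fin D → ℝ,
      G (Fin.snoc B a : Fin (N + 1) → Fin D → ℝ) := by
  have h := (volume_preserving_piFinSuccAbove (fun _ : Fin (N + 1) => Fin D → ℝ) (Fin.last N)).symm
  rw [← h.lintegral_comp hG, Measure.volume_eq_prod]
  refine (lintegral_prod_symm _ (hG.comp h.measurable).aemeasurable).trans ?_
  refine lintegral_congr fun B => lintegral_congr fun a => ?_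
  change G (Fin.insertNth (α := fun _ => Fin D → ℝ) (Fin.last N) a B) = _
  rw [Fin.insertNth_last']

lemma arrB_snoc {N R D : ℕ} (hR : ∀ l, l ≤ N + 1 → min l R = min l D) (B : Fin N → Fin D → ℝ)
    (a : Fin D → ℝ) :
    arrB (N + 1) R D (Fin.snoc B a) = snocA (arrB N R D B)
      (fun i => eigR (gramR N (extB B) + Matrix.vecMulVec a a)
        ⟨i, by have := hR (N + 1) le_rfl; have := i.2; omega⟩) := by
  refine arr_ext fun l i hl hi => ?_
  rw [lev_arrB hR _ (by omega)]
  by_cases hlN : l + 1 ≤ N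
  · rw [lev_snocA_le _ _ hlN, lev_arrB (fun l hl => hR l (by omega)) _ hlN]
    exact congrFun (wishEigR_congr fun i hi => extB_snoc _ _ _ (by omega)) i
  · obtain rfl : l = N := by omega
    have hiD : i < D := by have := hR (l + 1) le_rfl; omega
    rw [lev_snocA_top, wishEigR_eq, gramR_snoc]
    simp [extF, hiD, hi]

/-! ## Part H : law of the row process -/

/-- weight of an array under the row process -/
def dW (D R N : ℕ) (μ : Arr N R) : ℝ≥0∞ :=
  if SC R N (lev μ) then ENNReal.ofReal (Pden D R N (lev μ)) else 0

lemma dW_measurable (D R N : ℕ) : Measurable (dW D R N) := by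
  unfold dW
  refine Measurable.ite (SC_measurable R N fun l i => lev_measurable l i) ?_ measurable_const
  exact (Pden_measurable D R N fun l i => lev_measurable l i).ennreal_ofReal

lemma dW_ne_top (D R N : ℕ) (μ : Arr N R) : dW D R N μ ≠ ∞ := by
  unfold dW
  split_ifs <;> simp

lemma vand_nonneg_of_SC {R N : ℕ} {L : ℕ → ℕ → ℝ} (h : SC R N L) (hz : Zb R N L) {l : ℕ} (hl : l ≤ N) :
    0 < vand (min l R) (L l) := by
  unfold vand
  refine Finset.prod_pos fun i _ => Finset.prod_pos fun j hj => ?_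
  split_ifs with hij
  · exact sub_pos.mpr (h.anti hz l hl i j hij (Finset.mem_range.mp hj))
  · exact one_pos

lemma cross_nonneg (a b : ℕ) (x y : ℕ → ℝ) : 0 ≤ cross a b x y :=
  Finset.prod_nonneg fun _ _ => Finset.prod_nonneg fun _ _ => abs_nonneg _

lemma Pden_nonneg {D R N : ℕ} {L : ℕ → ℕ → ℝ} (h : SC R N L) (hz : Zb R N L) : 0 ≤ Pden D R N L := by
  unfold Pden
  refine mul_nonneg (mul_nonneg (Finset.prod_nonneg fun l hl => ?_) (Finset.prod_nonneg fun l hl => ?_))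
    (Finset.prod_nonneg fun i hi => ?_)
  · exact (vand_nonneg_of_SC h hz (Finset.mem_Icc.mp hl).2).le
  · exact Real.rpow_nonneg (cross_nonneg _ _ _ _) _
  · exact Real.rpow_nonneg (h.pos hz (min N R) (by omega) i (by have := Finset.mem_range.mp hi; omega)).le _

lemma Wmap_measurable2 {K : ℕ} {X : Type*} [MeasurableSpace X] {x y : X → Fin K → ℝ}
    (hx : Measurable x) (hy : Measurable y) (i : Fin K) : Measurable fun t => Wmap (x t) (y t) i := by
  unfold Wmap
  have h1 : ∀ i, Measurable fun t => x t i := fun i => (measurable_pi_apply i).comp hx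
  have h2 : ∀ i, Measurable fun t => y t i := fun i => (measurable_pi_apply i).comp hy
  refine Measurable.div (Measurable.neg (Finset.measurable_fun_prod _ fun j _ => (h1 i).sub (h2 j)))
    (Finset.measurable_fun_prod _ fun j _ => (h1 i).sub (h1 j))

lemma aV_measurable {K : ℕ} {X : Type*} [MeasurableSpace X] {x : X → Fin K → ℝ}
    (hx : Measurable x) : Measurable fun t => aV (x t) := by
  have h1 : ∀ i, Measurable fun t => x t i := fun i => (measurable_pi_apply i).comp hx
  simp only [aV_eq]
  refine Finset.measurable_fun_prod _ fun j _ => Finset.measurable_fun_prod _ fun i _ => ?_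
  exact ((h1 j).sub (h1 i)).abs

lemma Tker_measurable {D K : ℕ} (hK : 1 ≤ K) {X : Type*} [MeasurableSpace X] {x y : X → Fin K → ℝ}
    (hx : Measurable x) (hy : Measurable y) : Measurable fun t => Tker D K hK (x t) (y t) := by
  unfold Tker
  exact ((aV_measurable hy).div (aV_measurable hx)).mul
    (Finset.measurable_fun_prod _ fun i _ => (Wmap_measurable2 hx hy i).pow_const _)

lemma Sset_measurable2 {K : ℕ} {X : Type*} [MeasurableSpace X] {x y : X → Fin K → ℝ}
    (hx : Measurable x) (hy : Measurable y) : MeasurableSet {t | y t ∈ Sset (x t)} := by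
  have h1 : ∀ i, Measurable fun t => x t i := fun i => (measurable_pi_apply i).comp hx
  have h2 : ∀ i, Measurable fun t => y t i := fun i => (measurable_pi_apply i).comp hy
  have e : {t | y t ∈ Sset (x t)} = (⋂ i, {t | x t i < y t i}) ∩
      (⋂ (i : Fin K) (j : Fin K) (_ : i < j), {t | y t j < x t i}) := by
    ext t
    simp only [Set.mem_iInter, Set.mem_inter_iff]
    rfl
  rw [e]
  exact (MeasurableSet.iInter fun i => measurableSet_lt (h1 _) (h2 _)).inter
    (MeasurableSet.iInter fun i => MeasurableSet.iInter fun j => MeasurableSet.iInter fun _ =>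
      measurableSet_lt (h2 _) (h1 _))

lemma eigR_bmap {N R D : ℕ} (hR : ∀ l, l ≤ N + 1 → min l R = min l D)
    (hK : 1 ≤ min (N + 1) R) (B : Fin N → Fin D → ℝ) :
    eigR (gramR N (extB B)) =
      (fun i : Fin (min (N + 1) R) => lev (arrB N R D B) N i) ∘ bmap D (min (N + 1) R) hK := by
  have h1 := hR (N + 1) le_rfl
  funext j
  rw [Function.comp_apply, lev_arrB (fun l hl => hR l (by omega)) _ le_rfl, ← wishEigR_fin]
  simp only [bmap]
  by_cases hj : (j : ℕ) ≤ min (N + 1) R - 1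
  · rw [min_eq_left hj]
  · rw [min_eq_right (by omega), wishEigR_zero _ _ _ (by omega), wishEigR_zero _ _ _ (by omega)]

lemma lintegral_pi_empty {ι : Type*} [Fintype ι] [IsEmpty ι] {α : ι → Type*}
    [∀ i, MeasureSpace (α i)] [∀ i, SigmaFinite (volume : Measure (α i))] (f : (∀ i, α i) → ℝ≥0∞) (x : ∀ i, α i) :
    ∫⁻ y, f y = f x := by
  rw [lintegral_unique, volume_pi, Measure.pi_univ, Finset.univ_eq_empty, Finset.prod_empty, mul_one]
  congr 1
  exact Subsingleton.elim _ _

theorem proc (D : ℕ) (hD : 1 ≤ D) (N R : ℕ) (hR : ∀ l, l ≤ N → min l R = min l D) :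
    ∃ c : ℝ≥0∞, c ≠ 0 ∧ c ≠ ∞ ∧ ∀ F : Arr N R → ℝ≥0∞, Measurable F →
      ∫⁻ B : Fin N → Fin D → ℝ, F (arrB N R D B) = c * ∫⁻ μ, dW D R N μ * F μ := by
  induction N with
  | zero =>
    refine ⟨1, one_ne_zero, ENNReal.one_ne_top, fun F hF => ?_⟩
    have : IsEmpty {p // p ∈ coords 0 R} := ⟨fun p => by simpa using (mem_coords.mp p.2).1⟩
    rw [one_mul, lintegral_pi_empty _ (fun i => isEmptyElim i), lintegral_pi_empty (fun μ : Arr 0 R => dW D R 0 μ * F μ)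
      (fun p => isEmptyElim p)]
    have h1 : dW D R 0 (fun p => isEmptyElim p) = 1 := by
      unfold dW
      rw [if_pos (show SC R 0 _ from fun l hl => by omega)]
      simp [Pden]
    rw [h1, one_mul]
    congr 1
    funext p; exact isEmptyElim p
  | succ N ih =>
    obtain ⟨c0, h0, hT, hc⟩ := ih fun l hl => hR l (by omega)
    have hRN := hR (N + 1) le_rfl
    have hK : 1 ≤ min (N + 1) R := by omega
    obtain ⟨c1, h10, h1T, hc1⟩ := step_kernel D (min (N + 1) R) hK (by omega)
    refine ⟨c1 * c0, mul_ne_zero h10 h0, ENNReal.mul_ne_top h1T hT, fun F hF => ?_⟩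
    refine (lintegral_snocB _ (hF.comp (arrB_measurable _ _ _))).trans ?_
    -- almost sure interlacing
    have hSC : ∀ᵐ B : Fin N → Fin D → ℝ, SC R N (lev (arrB N R D B)) := by
      have hs := SC_measurable R N (X := Arr N R) (L := lev) fun l i => lev_measurable l i
      have := hc (Set.indicator {μ | SC R N (lev μ)}ᶜ 1) (measurable_one.indicator hs.compl)
      have h2 : ∫⁻ μ : Arr N R, dW D R N μ * Set.indicator {μ | SC R N (lev μ)}ᶜ 1 μ = 0 := by
        refine (lintegral_congr fun μ => ?_).trans lintegral_zero
        by_cases h : SC R N (lev μ)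
        · simp [h]
        · simp [dW, h]
      rw [h2, mul_zero] at this
      replace this := (lintegral_eq_zero_iff
        ((measurable_one.indicator hs.compl).comp (arrB_measurable N R D))).mp this
      filter_upwards [this] with B hB
      by_contra h
      simp [h] at hB
    set G : Arr N R → ℝ≥0∞ := fun μ => ∫⁻ y : Fin (min (N + 1) R) → ℝ,
      (if y ∈ Sset (fun i : Fin (min (N + 1) R) => lev μ N i) then
        ENNReal.ofReal (Tker D (min (N + 1) R) hK (fun i => lev μ N i) y) * F (snocA μ y) else 0) with hG
    have hxm : Measurable fun μ : Arr N R => (fun i : Fin (min (N + 1) R) => lev μ N i) :=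
      measurable_pi_lambda _ fun i => lev_measurable _ _
    have hGm2 : Measurable fun q : Arr N R × (Fin (min (N + 1) R) → ℝ) =>
      (if q.2 ∈ Sset (fun i : Fin (min (N + 1) R) => lev q.1 N i) then
        ENNReal.ofReal (Tker D (min (N + 1) R) hK (fun i => lev q.1 N i) q.2) *
          F (snocA q.1 q.2) else 0) := by
      refine Measurable.ite (Sset_measurable2 (hxm.comp measurable_fst) measurable_snd) ?_
        measurable_const
      exact (Tker_measurable hK (hxm.comp measurable_fst) measurable_snd).ennreal_ofReal.mul
        (hF.comp (snocA_measurable N R))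
    have hGm : Measurable G := Measurable.lintegral_prod_right' hGm2
    have e1 : ∫⁻ B : Fin N → Fin D → ℝ, ∫⁻ a : Fin D → ℝ,
        (F ∘ arrB (N + 1) R D) (Fin.snoc B a : Fin (N + 1) → Fin D → ℝ)
        = ∫⁻ B : Fin N → Fin D → ℝ, c1 * G (arrB N R D B) := by
      refine lintegral_congr_ae ?_
      filter_upwards [hSC] with B hB
      simp only [Function.comp_apply, arrB_snoc hR]
      rw [hc1 (gramR N (extB B)) (fun i => lev (arrB N R D B) N i) (gramR_sym _ _)
        (hB.strictAnti (lev_Zb _)) (eigR_bmap hR hK B) (fun y => F (snocA (arrB N R D B) y))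
        (hF.comp ((snocA_measurable N R).comp (measurable_prodMk_left (x := arrB N R D B))))]
      rw [hG]
      simp only
      rw [← lintegral_indicator (Sset_measurable _)]
      congr 1
    refine e1.trans ?_
    rw [lintegral_const_mul' _ _ h1T, hc G hGm, mul_assoc]
    congr 2
    rw [lintegral_snocA (fun μ => dW D R (N + 1) μ * F μ) ((dW_measurable D R (N + 1)).mul hF)]
    refine lintegral_congr fun μ => ?_
    rw [hG]
    simp only
    rw [← lintegral_const_mul' _ _ (dW_ne_top D R N μ)]
    refine lintegral_congr fun y => ?_
    by_cases h1 : SC R N (lev μ)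
    · by_cases h2 : y ∈ Sset (fun i : Fin (min (N + 1) R) => lev μ N i)
      · have h3 := (SC_snocA μ y).mpr ⟨h1, h2⟩
        rw [if_pos h2]
        unfold dW
        rw [if_pos h1, if_pos h3, Pden_succ hD hR hK h3 (lev_Zb _),
          Pden_congr (L := lev (snocA μ y)) (L' := lev μ) (fun l hl => lev_snocA_le μ y hl),
          ENNReal.ofReal_mul (Pden_nonneg h1 (lev_Zb _)), lev_snocA_top, lev_snocA_le μ y le_rfl,
          mul_assoc]
        have : (fun i : Fin (min (N + 1) R) => extF y i) = y := by funext i; exact extF_fin y i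
        rw [this]
      · have h3 : ¬ SC R (N + 1) (lev (snocA μ y)) := fun h => h2 ((SC_snocA μ y).mp h).2
        simp [dW, h2, h3]
    · have h3 : ¬ SC R (N + 1) (lev (snocA μ y)) := fun h => h1 ((SC_snocA μ y).mp h).1
      simp [dW, h1, h3]

/-! ## Part I : the Dixon-Anderson integral -/

/-- base Dirichlet integrand -/
def dirI {K : ℕ} (u : Fin K → ℝ) : ℝ≥0∞ :=
  if (∀ i, 0 < u i) ∧ ∑ i, u i < 1 then
    ENNReal.ofReal ((∏ i, u i) ^ (-(1 / 2) : ℝ) * (1 - ∑ i, u i) ^ (-(1 / 2) : ℝ)) else 0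

lemma dirI_measurable {K : ℕ} : Measurable (dirI (K := K)) := by
  unfold dirI
  refine Measurable.ite ?_ ?_ measurable_const
  · have h1 : MeasurableSet {u : Fin K → ℝ | ∀ i, 0 < u i} := by
      have : {u : Fin K → ℝ | ∀ i, 0 < u i} = ⋂ i, {u | 0 < u i} := by
        ext u
        simp only [Set.mem_iInter]
        rfl
      rw [this]
      exact MeasurableSet.iInter fun i => measurableSet_lt measurable_const (measurable_pi_apply i)
    have h2 : MeasurableSet {u : Fin K → ℝ | ∑ i, u i < 1} :=
      measurableSet_lt (by fun_prop) measurable_const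
    exact h1.inter h2
  · refine (Measurable.mul (Measurable.pow_const ?_ _) (Measurable.pow_const ?_ _)).ennreal_ofReal
    · fun_prop
    · fun_prop

lemma lintegral_scale {K : ℕ} (d : Fin K → ℝ) (hd : ∀ i, 0 < d i) (f : (Fin K → ℝ) → ℝ≥0∞)
    (hf : Measurable f) :
    ∫⁻ w : Fin K → ℝ, f (fun i => w i / d i) = ENNReal.ofReal (∏ i, d i) * ∫⁻ u, f u := by
  have hdet : (Matrix.diagonal (fun i => (d i)⁻¹)).det ≠ 0 := by
    rw [Matrix.det_diagonal]
    exact Finset.prod_ne_zero_iff.mpr fun i _ => inv_ne_zero (hd i).ne'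
  have h := Real.map_matrix_volume_pi_eq_smul_volume_pi hdet
  have h2 : ∫⁻ w : Fin K → ℝ, f (fun i => w i / d i) =
      ∫⁻ u, f u ∂(Measure.map (Matrix.toLin' (Matrix.diagonal (fun i => (d i)⁻¹))) volume) := by
    rw [lintegral_map hf]
    · refine lintegral_congr fun w => ?_
      congr 1
      funext i
      rw [Matrix.toLin'_apply, Matrix.mulVec_diagonal, div_eq_inv_mul]
    · exact (LinearMap.continuous_of_finiteDimensional _).measurable
  rw [h2, h, lintegral_smul_measure, Matrix.det_diagonal, Finset.prod_inv_distrib, inv_inv,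
    abs_of_pos (Finset.prod_pos fun i _ => hd i)]
  rfl

lemma Sset_lt_iff {K : ℕ} {X x : Fin K → ℝ} (hx : x ∈ Sset X) (hX : StrictAnti X) {b : ℝ}
    (hb : ∀ i, X i < b) : ((∀ i, x i < b) ↔ ∑ i, Wmap X x i / (b - X i) < 1) ∧
      1 - ∑ i, Wmap X x i / (b - X i) = (∏ i, (b - x i)) / ∏ i, (b - X i) := by
  have hpos : 0 < ∏ i, (b - X i) := Finset.prod_pos fun i _ => sub_pos.mpr (hb i)
  have h1 : pz x = Pw X (Wmap X x) := (pz_eq_Pw_iff hX.injective x _).mpr rfl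
  have h2 := congrArg (Polynomial.eval b) h1
  rw [pz_eval, Pw_eval' _ _ _ fun i => (hb i).ne'] at h2
  have h3 : 1 - ∑ i, Wmap X x i / (b - X i) = (∏ i, (b - x i)) / ∏ i, (b - X i) := by
    rw [h2, mul_div_cancel_left₀ _ hpos.ne']
  refine ⟨⟨fun h => ?_, fun h => ?_⟩, h3⟩
  · have : 0 < (∏ i, (b - x i)) / ∏ i, (b - X i) :=
      div_pos (Finset.prod_pos fun i _ => sub_pos.mpr (h i)) hpos
    linarith
  · have h4 : 0 < (∏ i, (b - x i)) / ∏ i, (b - X i) := by linarith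
    have h5 : 0 < ∏ i, (b - x i) := by
      have := mul_pos h4 hpos
      rwa [div_mul_cancel₀ _ hpos.ne'] at this
    intro i
    have hi0 : ∀ j : Fin K, 0 < (j : ℕ) → x j < b := by
      intro j hj
      exact (hx.2 ⟨0, by omega⟩ j (by rw [Fin.lt_def]; exact hj)).trans (hb _)
    by_cases hi : 0 < (i : ℕ)
    · exact hi0 i hi
    · rw [← Finset.mul_prod_erase univ _ (Finset.mem_univ i)] at h5
      have h6 : 0 < ∏ j ∈ univ.erase i, (b - x j) := by
        refine Finset.prod_pos fun j hj => sub_pos.mpr (hi0 j ?_)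
        have := (Finset.mem_erase.mp hj).1
        by_contra h0
        exact this (Fin.ext (by omega))
      have := (pos_iff_pos_of_mul_pos h5).mpr h6
      linarith

theorem dixon_anderson {K : ℕ} {X : Fin K → ℝ} (hX : StrictAnti X) {b : ℝ} (hb : ∀ i, X i < b) :
    ∫⁻ x in Sset X, (if ∀ i, x i < b then ENNReal.ofReal (aV x *
        ((∏ i, |x i - b|) * ∏ i, ∏ j, |x i - X j|) ^ (-(1 / 2) : ℝ)) else 0) =
      ∫⁻ u : Fin K → ℝ, dirI u := by
  have hd : ∀ i, 0 < b - X i := fun i => sub_pos.mpr (hb i)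
  have hpos : 0 < ∏ i, (b - X i) := Finset.prod_pos fun i _ => hd i
  have h1 := lintegral_scale (fun i => b - X i) hd dirI dirI_measurable
  have h2 : ∫⁻ u : Fin K → ℝ, dirI u = ∫⁻ w in {w : Fin K → ℝ | ∀ i, 0 < w i},
      ENNReal.ofReal (∏ i, (b - X i))⁻¹ * dirI (fun i => w i / (b - X i)) := by
    rw [lintegral_const_mul' _ _ ENNReal.ofReal_ne_top]
    have h3 : ∫⁻ w in {w : Fin K → ℝ | ∀ i, 0 < w i}, dirI (fun i => w i / (b - X i)) =
        ∫⁻ w : Fin K → ℝ, dirI (fun i => w i / (b - X i)) := by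
      refine setLIntegral_eq_of_support_subset fun w hw i => ?_
      by_contra h0
      refine hw ?_
      unfold dirI
      beta_reduce
      rw [if_neg]
      rintro ⟨h4, -⟩
      refine h0 ?_
      have := mul_pos (h4 i) (hd i)
      rwa [div_mul_cancel₀ _ (hd i).ne'] at this
    rw [h3, h1, ← mul_assoc, ← ENNReal.ofReal_mul (inv_nonneg.mpr hpos.le),
      inv_mul_cancel₀ hpos.ne', ENNReal.ofReal_one, one_mul]
  rw [h2, Wmap_cov hX]
  refine setLIntegral_congr_fun (Sset_measurable X) fun x hx => ?_
  beta_reduce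
  obtain ⟨h5, h6⟩ := Sset_lt_iff hx hX hb
  have hw : ∀ i, 0 < Wmap X x i / (b - X i) := fun i => div_pos (Wmap_pos hX hx i) (hd i)
  by_cases hlt : ∀ i, x i < b
  · rw [if_pos hlt]
    unfold dirI
    rw [if_pos ⟨hw, h5.mp hlt⟩, h6]
    have hxb : 0 < ∏ i, (b - x i) := Finset.prod_pos fun i _ => sub_pos.mpr (hlt i)
    have haX := aV_pos hX
    rw [← ENNReal.ofReal_mul (inv_nonneg.mpr hpos.le),
      ← ENNReal.ofReal_mul (div_nonneg (aV_nonneg _) (aV_nonneg _))]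
    congr 1
    rw [Finset.prod_div_distrib, prod_Wmap hX hx]
    have e1 : ∏ i, |x i - b| = ∏ i, (b - x i) :=
      Finset.prod_congr rfl fun i _ => by rw [abs_sub_comm, abs_of_pos (sub_pos.mpr (hlt i))]
    have e2 : ∏ i, ∏ j, |x i - X j| = ∏ i, ∏ j, |X i - x j| := by
      rw [Finset.prod_comm]
      exact Finset.prod_congr rfl fun i _ => Finset.prod_congr rfl fun j _ => abs_sub_comm _ _
    rw [e1, e2]
    set c := ∏ i, ∏ j, |X i - x j| with hc
    have hcn : 0 ≤ c := Finset.prod_nonneg fun _ _ => Finset.prod_nonneg fun _ _ => abs_nonneg _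
    set p := ∏ i, (b - x i)
    set q := ∏ i, (b - X i)
    rw [Real.mul_rpow hxb.le hcn, Real.div_rpow (by positivity) hpos.le, Real.div_rpow hcn (by positivity),
      Real.div_rpow hxb.le hpos.le]
    have e3 : (aV X ^ 2) ^ (-(1 / 2) : ℝ) = (aV X)⁻¹ := by
      rw [Real.rpow_neg (by positivity), ← Real.sqrt_eq_rpow, Real.sqrt_sq haX.le]
    have e4 : q ^ (-(1 / 2) : ℝ) * q ^ (-(1 / 2) : ℝ) = q⁻¹ := by
      rw [← Real.rpow_add hpos, ← Real.rpow_neg_one]; norm_num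
    have e5 : q ^ (-(1 / 2) : ℝ) ≠ 0 := (Real.rpow_pos_of_pos hpos _).ne'
    rw [e3, ← e4]
    field_simp
  · rw [if_neg hlt]
    unfold dirI
    rw [if_neg (fun h => hlt (h5.mpr h.2)), mul_zero, mul_zero]

/-! ## Part J : integrating out Gelfand-Tsetlin patterns -/

/-- the part of the density not involving powers of the top level -/
def Qden (R N : ℕ) (L : ℕ → ℕ → ℝ) : ℝ :=
  (∏ l ∈ Icc 1 N, vand (min l R) (L l)) *
  (∏ l ∈ Ico 1 N, cross (min l R) (min (l + 1) R) (L l) (L (l + 1)) ^ (-(1 / 2) : ℝ))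

lemma Pden_Qden (D R N : ℕ) (L : ℕ → ℕ → ℝ) : Pden D R N L =
    Qden R N L * ∏ i ∈ range (min N R), L (min N R) i ^ (((D : ℝ) - (min N R : ℕ) - 1) / 2) := rfl

lemma Qden_congr {R N : ℕ} {L L' : ℕ → ℕ → ℝ} (h : ∀ l, l ≤ N → L l = L' l) :
    Qden R N L = Qden R N L' := by
  unfold Qden
  congr 1
  · refine Finset.prod_congr rfl fun l hl => ?_
    rw [h l (Finset.mem_Icc.mp hl).2]
  · refine Finset.prod_congr rfl fun l hl => ?_
    have := (Finset.mem_Ico.mp hl).2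
    rw [h l (by omega), h (l + 1) (by omega)]

lemma Qden_succ {R N : ℕ} (hN : 1 ≤ N) (L : ℕ → ℕ → ℝ) : Qden R (N + 1) L =
    Qden R N L * (vand (min (N + 1) R) (L (N + 1)) *
      cross (min N R) (min (N + 1) R) (L N) (L (N + 1)) ^ (-(1 / 2) : ℝ)) := by
  unfold Qden
  rw [Finset.prod_Icc_succ_top (by omega), Finset.prod_Ico_succ_top (by omega)]
  ring

lemma Qden_nonneg {R N : ℕ} {L : ℕ → ℕ → ℝ} (h : SC R N L) (hz : Zb R N L) : 0 ≤ Qden R N L := by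
  unfold Qden
  refine (mul_nonneg (Finset.prod_nonneg fun l hl => ?_) (Finset.prod_nonneg fun l hl => ?_))
  · exact (vand_nonneg_of_SC h hz (Finset.mem_Icc.mp hl).2).le
  · exact Real.rpow_nonneg (cross_nonneg _ _ _ _) _

lemma Qden_measurable (R N : ℕ) {X : Type*} [MeasurableSpace X] {L : X → ℕ → ℕ → ℝ}
    (hL : ∀ l i, Measurable fun x => L x l i) : Measurable fun x => Qden R N (L x) := by
  unfold Qden
  exact (Measurable.mul (Finset.measurable_fun_prod _ fun l _ => vand_measurable (hL l) _)
    (Finset.measurable_fun_prod _ fun l _ =>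
      (cross_measurable (hL l) (hL (l + 1)) _ _).pow_const _))

/-- `Qden` as weight -/
def qW (R N : ℕ) (μ : Arr N R) : ℝ≥0∞ :=
  if SC R N (lev μ) then ENNReal.ofReal (Qden R N (lev μ)) else 0

lemma qW_measurable (R N : ℕ) : Measurable (qW R N) := by
  unfold qW
  refine Measurable.ite (SC_measurable R N fun l i => lev_measurable l i) ?_ measurable_const
  exact (Qden_measurable R N fun l i => lev_measurable l i).ennreal_ofReal

/-- strictly decreasing and positive first `N` entries -/
def SDP (N : ℕ) (L : ℕ → ℝ) : Prop := (∀ i j, i < j → j < N → L j < L i) ∧ ∀ i, i < N → 0 < L i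

lemma SDP_vand {N : ℕ} {L : ℕ → ℝ} (h : SDP N L) : 0 < vand N L := by
  unfold vand
  refine Finset.prod_pos fun i _ => Finset.prod_pos fun j hj => ?_
  split_ifs with hij
  · exact sub_pos.mpr (h.1 i j hij (Finset.mem_range.mp hj))
  · exact one_pos

lemma DA_nat (N : ℕ) {L : ℕ → ℝ} (hL : SDP (N + 1) L) :
    ∫⁻ x : Fin N → ℝ, (if (fun i : Fin (N + 1) => L i) ∈ Sset (fun i : Fin (N + 1) => extF x i) then
      ENNReal.ofReal (vand N (extF x) * cross N (N + 1) (extF x) L ^ (-(1 / 2) : ℝ)) else 0)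
      = ∫⁻ u : Fin N → ℝ, dirI u := by
  have hX : StrictAnti (fun i : Fin N => L (i + 1)) := fun i j hij => hL.1 _ _ (by
    rw [Fin.lt_def] at hij; omega) (by omega)
  have hb : ∀ i : Fin N, L (i + 1) < L 0 := fun i => hL.1 _ _ (by omega) (by omega)
  rw [← dixon_anderson hX hb, ← lintegral_indicator (Sset_measurable _)]
  refine lintegral_congr fun x => ?_
  have key : ((fun i : Fin (N + 1) => L i) ∈ Sset (fun i : Fin (N + 1) => extF x i)) ↔
      x ∈ Sset (fun i : Fin N => L (i + 1)) ∧ ∀ i, x i < L 0 := by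
    constructor
    · rintro ⟨h1, h2⟩
      have h1' : ∀ i : Fin N, x i < L i := fun i => by
        have := h1 (Fin.castSucc i)
        simp only [Fin.val_castSucc, extF_fin] at this
        exact this
      have h2' : ∀ (i : Fin N) (j : ℕ), (i : ℕ) < j → j < N + 1 → L j < x i := fun i j hij hj => by
        have := h2 (Fin.castSucc i) ⟨j, hj⟩ (by rw [Fin.lt_def]; simpa using hij)
        simp only [Fin.val_castSucc, extF_fin] at this
        exact this
      refine ⟨⟨fun i => h2' i (i + 1) (by omega) (by omega), fun i j hij => ?_⟩, fun i => ?_⟩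
      · rw [Fin.lt_def] at hij
        refine lt_of_lt_of_le (h1' j) ?_
        rcases Nat.eq_or_lt_of_le (show (i : ℕ) + 1 ≤ j by omega) with h | h
        · show L j ≤ L (i + 1)
          rw [h]
        · exact (hL.1 _ _ h (by omega)).le
      · refine lt_of_lt_of_le (h1' i) ?_
        rcases Nat.eq_or_lt_of_le (Nat.zero_le (i : ℕ)) with h | h
        · rw [← h]
        · exact (hL.1 _ _ h (by omega)).le
    · rintro ⟨⟨h1, h2⟩, h3⟩
      refine ⟨fun i => ?_, fun i j hij => ?_⟩
      · by_cases hi : (i : ℕ) < N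
        · have e : extF x i = x ⟨i, hi⟩ := by simp [extF, hi]
          beta_reduce
          rw [e]
          by_cases h0 : (i : ℕ) = 0
          · have := h3 ⟨i, hi⟩
            have e2 : L (i : ℕ) = L 0 := by rw [h0]
            rw [e2]
            exact this
          · have := h2 ⟨i - 1, by omega⟩ ⟨i, hi⟩ (by rw [Fin.lt_def]; simp only; omega)
            simp only at this
            rwa [Nat.sub_add_cancel (by omega)] at this
        · have e : extF x i = 0 := by simp [extF, hi]
          beta_reduce
          rw [e]
          exact hL.2 _ i.2
      · rw [Fin.lt_def] at hij
        have hi : (i : ℕ) < N := by omega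
        have e : extF x i = x ⟨i, hi⟩ := by simp [extF, hi]
        beta_reduce
        rw [e]
        refine lt_of_le_of_lt ?_ (h1 ⟨i, hi⟩)
        rcases Nat.eq_or_lt_of_le (show (i : ℕ) + 1 ≤ j by omega) with h | h
        · show L j ≤ L (i + 1)
          rw [h]
        · exact (hL.1 _ _ h (by omega)).le
  by_cases hx : x ∈ Sset (fun i : Fin N => L (i + 1))
  · rw [Set.indicator_of_mem hx]
    by_cases hlt : ∀ i, x i < L 0
    · rw [if_pos (key.mpr ⟨hx, hlt⟩), if_pos hlt,
        vand_eq (Sset.strictAnti hx) (extF x) (fun i => extF_fin x i), cross_eq,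
        ← Finset.prod_mul_distrib]
      congr 4
      funext i
      rw [Fin.prod_univ_succ, extF_fin]
      rfl
    · rw [if_neg (fun h => hlt (key.mp h).2), if_neg hlt]
  · rw [Set.indicator_of_notMem hx, if_neg (fun h => hx (key.mp h).1)]

lemma e3m {N : ℕ} (L : ℕ → ℝ) : Measurable fun x : Fin N → ℝ =>
    (if (fun i : Fin (N + 1) => L i) ∈ Sset (fun i : Fin (N + 1) => extF x i) then
      ENNReal.ofReal (vand N (extF x) * cross N (N + 1) (extF x) L ^ (-(1 / 2) : ℝ))
          else 0) := by
  have hx : ∀ i, Measurable fun x : Fin N → ℝ => extF x i := by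
    intro i
    unfold extF
    by_cases hi : i < N
    · simp only [hi, dif_pos]; exact measurable_pi_apply _
    · simp only [hi, dif_neg, not_false_iff]; exact measurable_const
  refine Measurable.ite ?_ ?_ measurable_const
  · exact Sset_measurable2 (y := fun _ : Fin N → ℝ => (fun i : Fin (N + 1) => L i))
      (measurable_pi_lambda _ fun i => hx i) measurable_const
  · have h1 : Measurable fun x : Fin N → ℝ => vand N (extF x) := vand_measurable hx N
    have h2 : Measurable fun x : Fin N → ℝ => cross N (N + 1) (extF x) L :=
      cross_measurable (L' := fun _ => L) hx (fun i => measurable_const) N (N + 1)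
    exact (h1.mul (h2.pow_const _)).ennreal_ofReal

theorem gtvol (R N : ℕ) (hN : N + 1 ≤ R) : ∃ C : ℝ≥0∞, ∀ L : ℕ → ℝ,
    ∫⁻ μ : Arr N R, qW R (N + 1) (snocA μ (fun i => L i)) =
      C * (if SDP (N + 1) L then ENNReal.ofReal (vand (N + 1) L) else 0) := by
  induction N with
  | zero =>
    refine ⟨1, fun L => ?_⟩
    have : IsEmpty {p // p ∈ coords 0 R} := ⟨fun p => by simpa using (mem_coords.mp p.2).1⟩
    rw [lintegral_pi_empty (fun μ : Arr 0 R => qW R (0 + 1) (snocA μ (fun i => L i)))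
      (fun p => isEmptyElim p), one_mul]
    set μ0 : Arr 0 R := fun p => isEmptyElim p
    have h1 : SC R (0 + 1) (lev (snocA μ0 (fun i => L i))) ↔ SDP (0 + 1) L := by
      rw [SC_snocA]
      constructor
      · rintro ⟨-, h⟩
        refine ⟨fun i j _ _ => by omega, fun i hi => ?_⟩
        have := h.1 ⟨0, by omega⟩
        simp only [lev_zero] at this
        obtain rfl : i = 0 := by omega
        exact this
      · intro h
        refine ⟨fun l hl => by omega, fun i => ?_, fun i j hij => ?_⟩
        · simp only [lev_zero]
          exact h.2 _ (by omega)
        · rw [Fin.lt_def] at hij; omega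
    unfold qW
    by_cases h : SDP (0 + 1) L
    · rw [if_pos (h1.mpr h), if_pos h]
      congr 1
      have : min 1 R = 1 := by omega
      simp [Qden, vand, this]
    · rw [if_neg (fun h' => h (h1.mp h')), if_neg h]
  | succ N ih =>
    obtain ⟨C, hC⟩ := ih (by omega)
    refine ⟨C * ∫⁻ u : Fin (N + 1) → ℝ, dirI u, fun L => ?_⟩
    have hk : N + 1 = min (N + 1) R := by omega
    have hk2 : N + 1 + 1 = min (N + 1 + 1) R := by omega
    have hm : Measurable fun μ : Arr (N + 1) R => qW R (N + 1 + 1) (snocA μ (fun i => L i)) :=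
      (qW_measurable R (N + 1 + 1)).comp ((snocA_measurable (N + 1) R).comp
        (measurable_prodMk_right (y := (fun i : Fin (min (N + 1 + 1) R) => L i))))
    rw [lintegral_snocA' hk _ hm]
    have e0 : ∀ x : Fin (N + 1) → ℝ, (fun i : Fin (min (N + 1) R) => x (Fin.cast hk.symm i)) =
        fun i : Fin (min (N + 1) R) => extF x i := by
      intro x; funext i
      have : (i : ℕ) < N + 1 := by omega
      simp [extF, this]
      rfl
    have e0' : ∀ x : Fin (N + 1) → ℝ, extF (fun i : Fin (min (N + 1) R) => extF x i) = extF x := by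
      intro x; funext i
      unfold extF
      by_cases hi : i < N + 1
      · have : i < min (N + 1) R := by omega
        simp [hi, this]
      · simp [hi]
    have eL : ∀ i, i < N + 1 + 1 → extF (fun i : Fin (min (N + 1 + 1) R) => L i) i = L i := by
      intro i hi
      have : i < min (N + 1 + 1) R := by omega
      simp [extF]; omega
    have evL : vand (N + 1 + 1) (extF (fun i : Fin (min (N + 1 + 1) R) => L i)) = vand (N + 1 + 1) L := by
      unfold vand
      refine Finset.prod_congr rfl fun i hi => Finset.prod_congr rfl fun j hj => ?_
      rw [eL i (Finset.mem_range.mp hi), eL j (Finset.mem_range.mp hj)]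
    have ecL : ∀ x, cross (N + 1) (N + 1 + 1) x (extF (fun i : Fin (min (N + 1 + 1) R) => L i)) =
        cross (N + 1) (N + 1 + 1) x L := by
      intro x
      unfold cross
      refine Finset.prod_congr rfl fun i hi => Finset.prod_congr rfl fun j hj => ?_
      rw [eL j (Finset.mem_range.mp hj)]
    have evL' : ∀ b, b = N + 1 + 1 →
        vand b (extF (fun i : Fin (min (N + 1 + 1) R) => L i)) = vand (N + 1 + 1) L := by
      intro b hb; rw [hb, evL]
    have ecL' : ∀ a b, a = N + 1 → b = N + 1 + 1 → ∀ x,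
        cross a b x (extF (fun i : Fin (min (N + 1 + 1) R) => L i)) =
        cross (N + 1) (N + 1 + 1) x L := by
      intro a b ha hb x; rw [ha, hb, ecL]
    have hSs : ∀ x : Fin (N + 1) → ℝ, (fun i : Fin (min (N + 1 + 1) R) => L i) ∈
        Sset (fun i : Fin (min (N + 1 + 1) R) => extF x i) ↔ (fun i : Fin (N + 1 + 1) => L i) ∈
        Sset (fun i : Fin (N + 1 + 1) => extF x i) := by
      intro x; rw [← hk2]
    have e1 : ∀ x : Fin (N + 1) → ℝ, ∫⁻ μ : Arr N R,
        qW R (N + 1 + 1) (snocA (snocA μ (fun i => x (Fin.cast hk.symm i))) (fun i => L i)) =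
        (C * ENNReal.ofReal (vand (N + 1 + 1) L)) *
        (if (fun i : Fin (N + 1 + 1) => L i) ∈ Sset (fun i : Fin (N + 1 + 1) => extF x i) then
          ENNReal.ofReal (cross (N + 1) (N + 1 + 1) (extF x) L ^ (-(1 / 2) : ℝ)) *
          (if SDP (N + 1) (extF x) then ENNReal.ofReal (vand (N + 1) (extF x)) else 0) else 0) := by
      intro x
      rw [e0]
      by_cases hS : (fun i : Fin (N + 1 + 1) => L i) ∈ Sset (fun i : Fin (N + 1 + 1) => extF x i)
      · rw [if_pos hS]
        have e2 : ∀ μ : Arr N R, qW R (N + 1 + 1) (snocA (snocA μ (fun i => extF x i)) (fun i => L i)) =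
            ENNReal.ofReal (vand (N + 1 + 1) L * cross (N + 1) (N + 1 + 1) (extF x) L ^ (-(1 / 2) : ℝ)) *
            qW R (N + 1) (snocA μ (fun i => extF x i)) := by
          intro μ
          have h3 := SC_snocA (snocA μ (fun i => extF x i)) (fun i => L i)
          rw [lev_snocA_top, e0', hSs] at h3
          unfold qW
          by_cases h4 : SC R (N + 1) (lev (snocA μ (fun i => extF x i)))
          · rw [if_pos h4, if_pos (h3.mpr ⟨h4, hS⟩), Qden_succ (by omega), lev_snocA_top,
              lev_snocA_le _ _ le_rfl, lev_snocA_top, e0', evL' _ hk2.symm, ecL' _ _ hk.symm hk2.symm,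
              Qden_congr (fun l hl => lev_snocA_le _ _ hl),
              ENNReal.ofReal_mul (Qden_nonneg h4 (lev_Zb _)), mul_comm]
          · rw [if_neg h4, if_neg (fun h => h4 (h3.mp h).1), mul_zero]
        simp_rw [e2]
        rw [lintegral_const_mul' _ _ ENNReal.ofReal_ne_top, hC]
        have h5 : 0 ≤ vand (N + 1 + 1) L := by
          rw [vand_eq (Sset.strictAnti hS) L (fun i => rfl)]; exact aV_nonneg _
        rw [ENNReal.ofReal_mul h5]
        ring
      · rw [if_neg hS, mul_zero]
        refine (lintegral_congr fun μ => ?_).trans lintegral_zero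
        unfold qW
        have h3 := SC_snocA (snocA μ (fun i => extF x i)) (fun i => L i)
        rw [lev_snocA_top, e0', hSs] at h3
        rw [if_neg (fun h => hS (h3.mp h).2)]
    simp_rw [e1]
    by_cases hL : SDP (N + 1 + 1) L
    · rw [if_pos hL, ← DA_nat (N + 1) hL]
      have e3 : ∀ x : Fin (N + 1) → ℝ,
          (if (fun i : Fin (N + 1 + 1) => L i) ∈ Sset (fun i : Fin (N + 1 + 1) => extF x i) then
          ENNReal.ofReal (cross (N + 1) (N + 1 + 1) (extF x) L ^ (-(1 / 2) : ℝ)) *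
          (if SDP (N + 1) (extF x) then ENNReal.ofReal (vand (N + 1) (extF x)) else 0) else 0) =
          (if (fun i : Fin (N + 1 + 1) => L i) ∈ Sset (fun i : Fin (N + 1 + 1) => extF x i) then
      ENNReal.ofReal (vand (N + 1) (extF x) * cross (N + 1) (N + 1 + 1) (extF x) L ^ (-(1 / 2) : ℝ))
          else 0) := by
        intro x
        split_ifs with h1 h2
        · rw [ENNReal.ofReal_mul (SDP_vand h2).le, mul_comm]
        · exfalso
          have a1 : ∀ i (hi : i < N + 1), extF x i < L i := fun i hi => h1.1 ⟨i, by omega⟩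
          have a2 : ∀ i j, i < j → j < N + 1 + 1 → L j < extF x i := fun i j hij hj =>
            h1.2 ⟨i, by omega⟩ ⟨j, hj⟩ hij
          refine h2 ⟨fun i j hij hj => ?_, fun i hi => ?_⟩
          · exact (a1 j hj).trans (a2 i j hij (by omega))
          · exact (hL.2 (i + 1) (by omega)).trans (a2 i (i + 1) (by omega) (by omega))
        · rfl
      simp_rw [e3]
      rw [lintegral_const_mul _ (e3m L)]
      ring
    · rw [if_neg hL, mul_zero]
      refine (lintegral_congr fun x => ?_).trans lintegral_zero
      split_ifs with h1 h2
      · exfalso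
        refine hL ⟨fun i j hij hj => ?_, fun i hi => ?_⟩
        · exact Sset.strictAnti h1 (a := ⟨i, by omega⟩) (b := ⟨j, hj⟩) hij
        · refine lt_of_le_of_lt ?_ (h1.1 ⟨i, hi⟩)
          simp only
          by_cases hi' : i < N + 1
          · exact (h2.2 i hi').le
          · simp [extF, hi']
      · simp
      · simp

/-! ## Part K : Haar measure on the orthogonal group -/

lemma mat_elem_measurable {a b : ℕ} (i : Fin a) (j : Fin b) :
    Measurable fun V : Matrix (Fin a) (Fin b) ℝ => V i j :=
  (measurable_pi_apply j).comp (measurable_pi_apply (X := fun _ : Fin a => Fin b → ℝ) i)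

lemma orth_compact (n : ℕ) : CompactSpace (Matrix.unitaryGroup (Fin n) ℝ) := by
  refine isCompact_iff_compactSpace.mp
    (?_ : IsCompact (↑(Matrix.unitaryGroup (Fin n) ℝ) : Set (Matrix (Fin n) (Fin n) ℝ)))
  have h1 : IsCompact (Set.univ.pi fun _ : Fin n => Set.univ.pi fun _ : Fin n => Set.Icc (-1 : ℝ) 1) :=
    isCompact_univ_pi fun _ => isCompact_univ_pi fun _ => isCompact_Icc
  refine IsCompact.of_isClosed_subset (X := Matrix (Fin n) (Fin n) ℝ) h1 ?_ ?_
  · have : (↑(Matrix.unitaryGroup (Fin n) ℝ) : Set (Matrix (Fin n) (Fin n) ℝ)) =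
        {V | star V * V = 1} := by
      ext V
      exact Matrix.mem_unitaryGroup_iff'
    rw [this]
    exact isClosed_eq (continuous_star.mul continuous_id) continuous_const
  · intro V hV i _ j _
    have := entry_norm_bound_of_unitary hV i j
    rw [Real.norm_eq_abs, abs_le] at this
    exact this

lemma exists_haar (n : ℕ) : ∃ ρ : Measure (Matrix (Fin n) (Fin n) ℝ), IsProbabilityMeasure ρ ∧
    (∀ᵐ V ∂ρ, V.transpose * V = 1) ∧ ∀ U : Matrix (Fin n) (Fin n) ℝ, U.transpose * U = 1 →
      ∀ f : Matrix (Fin n) (Fin n) ℝ → ℝ≥0∞, Measurable f →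
        ∫⁻ V, f (U * V) ∂ρ = ∫⁻ V, f V ∂ρ := by
  have := orth_compact n
  let _ : MeasurableSpace (Matrix.unitaryGroup (Fin n) ℝ) := borel _
  have : BorelSpace (Matrix.unitaryGroup (Fin n) ℝ) := ⟨rfl⟩
  set ρ0 : Measure (Matrix.unitaryGroup (Fin n) ℝ) := Measure.haarMeasure ⊤ with hρ0
  have hinv : ρ0.IsMulLeftInvariant := Measure.isMulLeftInvariant_haarMeasure _
  have hprob : IsProbabilityMeasure ρ0 := ⟨by
    have := Measure.haarMeasure_self (K₀ := (⊤ : TopologicalSpace.PositiveCompacts (Matrix.unitaryGroup (Fin n) ℝ)))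
    simpa using this⟩
  have hval : Measurable (Subtype.val : Matrix.unitaryGroup (Fin n) ℝ → Matrix (Fin n) (Fin n) ℝ) := by
    refine measurable_pi_lambda _ fun i => measurable_pi_lambda _ fun j => ?_
    have : Continuous fun V : Matrix.unitaryGroup (Fin n) ℝ => V.1 i j :=
      (continuous_subtype_val).matrix_elem i j
    exact this.measurable
  refine ⟨ρ0.map Subtype.val, Measure.isProbabilityMeasure_map hval.aemeasurable, ?_, ?_⟩
  · rw [ae_map_iff hval.aemeasurable]
    · refine Filter.Eventually.of_forall fun V => ?_
      exact Matrix.mem_unitaryGroup_iff'.mp V.2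
    · have : MeasurableSet (⋂ (i : Fin n) (j : Fin n), {V : Matrix (Fin n) (Fin n) ℝ |
          ∑ k, V k i * V k j = (1 : Matrix (Fin n) (Fin n) ℝ) i j}) := by
        refine MeasurableSet.iInter fun i => MeasurableSet.iInter fun j => ?_
        refine measurableSet_eq_fun ?_ measurable_const
        exact Finset.measurable_fun_sum _ fun k _ =>
          (mat_elem_measurable k i).mul (mat_elem_measurable k j)
      convert this using 1
      ext V
      simp only [Set.mem_iInter]
      constructor
      · intro h i j
        have := congrFun (congrFun h i) j
        rwa [Matrix.mul_apply] at this
      · intro h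
        ext i j
        rw [Matrix.mul_apply]
        exact h i j
  · intro U hU f hf
    have hmul : Measurable fun V : Matrix (Fin n) (Fin n) ℝ => U * V := by
      refine measurable_pi_lambda _ fun i => measurable_pi_lambda _ fun j => ?_
      have : (fun V : Matrix (Fin n) (Fin n) ℝ => (U * V) i j) = fun V => ∑ k, U i k * V k j := by
        funext V; rw [Matrix.mul_apply]
      rw [this]
      exact Finset.measurable_fun_sum _ fun k _ => measurable_const.mul (mat_elem_measurable k j)
    rw [lintegral_map (f := fun V => f (U * V)) (hf.comp hmul) hval, lintegral_map hf hval]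
    set u : Matrix.unitaryGroup (Fin n) ℝ := ⟨U, Matrix.mem_unitaryGroup_iff'.mpr hU⟩
    exact lintegral_mul_left_eq_self (μ := ρ0) (fun V => f V.1) u

/-! ## Part L : averaging over the orthogonal group -/

lemma mulVec_mp {D : ℕ} (U : Matrix (Fin D) (Fin D) ℝ) (hU : U.transpose * U = 1) :
    MeasurePreserving (fun a : Fin D → ℝ => U.mulVec a) volume volume := by
  have hm : Measurable fun a : Fin D → ℝ => U.mulVec a := by
    refine measurable_pi_lambda _ fun i => ?_
    simp only [Matrix.mulVec, dotProduct]
    exact Finset.measurable_fun_sum _ fun k _ => measurable_const.mul (measurable_pi_apply k)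
  refine ⟨hm, Measure.ext_of_lintegral _ fun f hf => ?_⟩
  rw [lintegral_map hf hm]
  exact lintegral_mulVec U hU f hf

/-- rotate all rows -/
def rotB {N D : ℕ} (U : Matrix (Fin D) (Fin D) ℝ) (B : Fin N → Fin D → ℝ) : Fin N → Fin D → ℝ :=
  fun i => U.mulVec (B i)

lemma rotB_mp {N D : ℕ} (U : Matrix (Fin D) (Fin D) ℝ) (hU : U.transpose * U = 1) :
    MeasurePreserving (rotB (N := N) U) volume volume :=
  volume_preserving_pi fun _ => mulVec_mp U hU

lemma gramR_rot {N D : ℕ} (U : Matrix (Fin D) (Fin D) ℝ) (B : Fin N → Fin D → ℝ) (k : ℕ) :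
    gramR k (extB (rotB U B)) = U * gramR k (extB B) * U.transpose := by
  have h : rowsM k (extB (rotB U B)) = rowsM k (extB B) * U.transpose := by
    ext i j
    rw [Matrix.mul_apply]
    unfold rowsM extB rotB
    simp only [Matrix.of_apply, Matrix.transpose_apply]
    split_ifs
    · simp only [Matrix.mulVec, dotProduct]
      exact Finset.sum_congr rfl fun k _ => mul_comm _ _
    · simp
  rw [gramR_eq, gramR_eq, h, Matrix.transpose_mul, Matrix.transpose_transpose, Matrix.mul_assoc,
    Matrix.mul_assoc, Matrix.mul_assoc]

lemma wishEigR_rot {N D : ℕ} (U : Matrix (Fin D) (Fin D) ℝ) (hU : U.transpose * U = 1)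
    (B : Fin N → Fin D → ℝ) (k : ℕ) :
    wishEigR k (extB (rotB U B)) = wishEigR k (extB B) := by
  rw [wishEigR_eq, wishEigR_eq]
  congr 1
  have h := eigR_spec (gramR_sym k (extB B))
  refine eigR_eq h.1 ?_
  rw [gramR_rot, charpoly_conj _ _ hU, h.2.1]

lemma arrB_rot {N R D : ℕ} (U : Matrix (Fin D) (Fin D) ℝ) (hU : U.transpose * U = 1)
    (B : Fin N → Fin D → ℝ) : arrB N R D (rotB U B) = arrB N R D B := by
  funext p
  unfold arrB
  rw [wishEigR_rot U hU]

/-- weighted column lengths -/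
def colW {N D : ℕ} (w : ℕ → ℝ) (B : Fin N → Fin D → ℝ) : ℝ := ∑ j : Fin D, w j * ∑ i, B i j ^ 2

lemma colW_measurable {N D : ℕ} (w : ℕ → ℝ) : Measurable (colW (N := N) (D := D) w) := by
  unfold colW
  fun_prop

lemma colW_gram {N D : ℕ} (w : ℕ → ℝ) (B : Fin N → Fin D → ℝ) :
    colW w B = ∑ j : Fin D, w j * gramR N (extB B) j j := by
  unfold colW gramR
  refine Finset.sum_congr rfl fun j _ => ?_
  simp only [Matrix.of_apply, Finset.sum_range]
  congr 1
  refine Finset.sum_congr rfl fun i _ => ?_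
  simp [extB, sq]

/-- Haar average of the Gaussian weight -/
def GH (n : ℕ) (w : ℕ → ℝ) (ρ : Measure (Matrix (Fin n) (Fin n) ℝ)) (L : ℕ → ℝ) : ℝ≥0∞ :=
  ∫⁻ V, ENNReal.ofReal (Real.exp (-(1 / 2) * ∑ j : Fin n, w j * ∑ k : Fin n, L k * V k j ^ 2)) ∂ρ

lemma GH_le_one {n : ℕ} {w : ℕ → ℝ} (hw : ∀ j, 0 ≤ w j) {ρ : Measure (Matrix (Fin n) (Fin n) ℝ)}
    [IsProbabilityMeasure ρ] {L : ℕ → ℝ} (hL : ∀ k, 0 ≤ L k) : GH n w ρ L ≤ 1 := by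
  unfold GH
  refine (lintegral_mono (g := fun _ => 1) fun V => ?_).trans (by simp)
  rw [ENNReal.ofReal_le_one, Real.exp_le_one_iff]
  have : 0 ≤ ∑ j : Fin n, w j * ∑ k : Fin n, L k * V k j ^ 2 :=
    Finset.sum_nonneg fun j _ => mul_nonneg (hw _) (Finset.sum_nonneg fun k _ =>
      mul_nonneg (hL _) (sq_nonneg _))
  linarith

lemma GH_measurable {n : ℕ} {w : ℕ → ℝ} {ρ : Measure (Matrix (Fin n) (Fin n) ℝ)}
    [IsProbabilityMeasure ρ] {X : Type*} [MeasurableSpace X] {L : X → ℕ → ℝ}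
    (hL : ∀ i, Measurable fun x => L x i) : Measurable fun x => GH n w ρ (L x) := by
  unfold GH
  refine Measurable.lintegral_prod_right' (f := fun p : X × Matrix (Fin n) (Fin n) ℝ =>
    ENNReal.ofReal (Real.exp (-(1 / 2) * ∑ j : Fin n, w j * ∑ k : Fin n, L p.1 k * p.2 k j ^ 2))) ?_
  refine (Real.measurable_exp.comp (measurable_const.mul (Finset.measurable_fun_sum _ fun j _ =>
    measurable_const.mul (Finset.measurable_fun_sum _ fun k _ => ?_)))).ennreal_ofReal
  exact ((hL k).comp measurable_fst).mul (((mat_elem_measurable k j).comp measurable_snd).pow_const 2)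

lemma rotB_measurable2 {N D : ℕ} : Measurable fun p : (Fin N → Fin D → ℝ) × Matrix (Fin D) (Fin D) ℝ =>
    rotB p.2.transpose p.1 := by
  refine measurable_pi_lambda _ fun i => measurable_pi_lambda _ fun j => ?_
  simp only [rotB, Matrix.mulVec, dotProduct, Matrix.transpose_apply]
  refine Finset.measurable_fun_sum _ fun k _ => ?_
  refine ((mat_elem_measurable k j).comp measurable_snd).mul ?_
  exact (measurable_pi_apply k).comp ((measurable_pi_apply i).comp measurable_fst)

lemma diag_form {D : ℕ} (W : Matrix (Fin D) (Fin D) ℝ) (z : Fin D → ℝ) (j : Fin D) :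
    (W.transpose * Matrix.diagonal z * W) j j = ∑ k, z k * W k j ^ 2 := by
  rw [Matrix.mul_apply]
  refine Finset.sum_congr rfl fun k _ => ?_
  rw [Matrix.mul_diagonal, Matrix.transpose_apply]
  ring

theorem haar_avg {N D : ℕ} (w : ℕ → ℝ) {ρ : Measure (Matrix (Fin D) (Fin D) ℝ)}
    [IsProbabilityMeasure ρ] (h1 : ∀ᵐ V ∂ρ, V.transpose * V = 1)
    (h2 : ∀ U : Matrix (Fin D) (Fin D) ℝ, U.transpose * U = 1 →
      ∀ f : Matrix (Fin D) (Fin D) ℝ → ℝ≥0∞, Measurable f →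
        ∫⁻ V, f (U * V) ∂ρ = ∫⁻ V, f V ∂ρ)
    (f : (Fin N → Fin D → ℝ) → ℝ≥0∞) (hf : Measurable f)
    (hinv : ∀ U : Matrix (Fin D) (Fin D) ℝ, U.transpose * U = 1 → ∀ B, f (rotB U B) = f B) :
    ∫⁻ B, f B * ENNReal.ofReal (Real.exp (-(1 / 2) * colW w B)) =
      ∫⁻ B, f B * GH D w ρ (wishEigR N (extB B)) := by
  have hE : Measurable fun B : Fin N → Fin D → ℝ =>
      ENNReal.ofReal (Real.exp (-(1 / 2) * colW w B)) :=
    (Real.measurable_exp.comp (measurable_const.mul (colW_measurable w))).ennreal_ofReal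
  have a1 : ∀ᵐ V ∂ρ, ∫⁻ B, f B * ENNReal.ofReal (Real.exp (-(1 / 2) * colW w (rotB V.transpose B)))
      = ∫⁻ B, f B * ENNReal.ofReal (Real.exp (-(1 / 2) * colW w B)) := by
    filter_upwards [h1] with V hV
    have hV' : V.transpose.transpose * V.transpose = 1 := by
      rw [Matrix.transpose_transpose]; exact mul_eq_one_comm.mp hV
    refine Eq.trans (lintegral_congr fun B => ?_)
      ((rotB_mp V.transpose hV').lintegral_comp (hf.mul hE))
    rw [hinv _ hV']
  have a2 : ∫⁻ V, (∫⁻ B, f B * ENNReal.ofReal (Real.exp (-(1 / 2) * colW w (rotB V.transpose B)))) ∂ρ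
      = ∫⁻ B, f B * ENNReal.ofReal (Real.exp (-(1 / 2) * colW w B)) := by
    rw [lintegral_congr_ae a1]; simp
  rw [← a2, lintegral_lintegral_swap]
  · refine lintegral_congr fun B => ?_
    have hm : Measurable fun V : Matrix (Fin D) (Fin D) ℝ =>
        ENNReal.ofReal (Real.exp (-(1 / 2) * colW w (rotB V.transpose B))) :=
      hE.comp (rotB_measurable2.comp (measurable_prodMk_left (x := B)))
    rw [lintegral_const_mul _ hm]
    congr 1
    obtain ⟨-, -, U, hU1, hU2, hMU⟩ := eigR_spec (gramR_sym N (extB B))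
    have hUt : U.transpose.transpose * U.transpose = 1 := by rw [Matrix.transpose_transpose, hU2]
    unfold GH
    have hGm : Measurable fun V : Matrix (Fin D) (Fin D) ℝ => ENNReal.ofReal (Real.exp (-(1 / 2) *
        ∑ j : Fin D, w j * ∑ k : Fin D, wishEigR N (extB B) k * V k j ^ 2)) := by
      refine (Real.measurable_exp.comp (measurable_const.mul (Finset.measurable_fun_sum _ fun j _ =>
        measurable_const.mul (Finset.measurable_fun_sum _ fun k _ => ?_)))).ennreal_ofReal
      exact measurable_const.mul ((mat_elem_measurable k j).pow_const 2)
    rw [← h2 U.transpose hUt _ hGm]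
    refine lintegral_congr fun V => ?_
    congr 3
    rw [colW_gram]
    refine Finset.sum_congr rfl fun j _ => ?_
    congr 1
    rw [gramR_rot, Matrix.transpose_transpose, hMU]
    have : V.transpose * (U * Matrix.diagonal (eigR (gramR N (extB B))) * U.transpose) * V =
        (U.transpose * V).transpose * Matrix.diagonal (eigR (gramR N (extB B))) * (U.transpose * V) := by
      rw [Matrix.transpose_mul, Matrix.transpose_transpose]
      simp only [Matrix.mul_assoc]
    rw [← hMU, hMU, this, diag_form]
    refine Finset.sum_congr rfl fun k _ => ?_
    rw [wishEigR_fin]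
  · refine Measurable.aemeasurable ?_
    exact (hf.comp measurable_snd).mul (hE.comp (rotB_measurable2.comp measurable_swap))

/-! ## Part M : transposition and traces -/

lemma mp_of_box {m n : ℕ} {X : Type*} [MeasurableSpace X] (ν : Measure X)
    (e : X → (Fin m → Fin n → ℝ)) (he : Measurable e)
    (h : ∀ s : Fin m → Fin n → Set ℝ, (∀ i j, MeasurableSet (s i j)) →
      ν (e ⁻¹' (Set.univ.pi fun i => Set.univ.pi (s i))) = ∏ i, ∏ j, volume (s i j)) :
    MeasurePreserving e ν volume := by
  refine ⟨he, ?_⟩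
  symm
  rw [volume_pi]
  refine Measure.pi_eq_generateFrom
    (C := fun _ : Fin m => Set.pi Set.univ '' Set.pi Set.univ fun _ : Fin n => {s : Set ℝ | MeasurableSet s})
    (fun i => generateFrom_pi) (fun i => isPiSystem_pi) (fun i => ?_) ?_
  · exact Measure.FiniteSpanningSetsIn.pi fun j => (volume : Measure ℝ).toFiniteSpanningSetsIn
  · intro s hs
    choose t ht1 ht2 using hs
    have ht : ∀ i j, MeasurableSet (t i j) := fun i j => ht1 i j (Set.mem_univ j)
    have : s = fun i => Set.univ.pi (t i) := by funext i; exact (ht2 i).symm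
    rw [this, Measure.map_apply he (MeasurableSet.univ_pi fun i => MeasurableSet.univ_pi (ht i)), h t ht]
    refine Finset.prod_congr rfl fun i _ => ?_
    rw [volume_pi, Measure.pi_pi]

/-- transposition -/
def trB {m n : ℕ} (B : Fin m → Fin n → ℝ) : Fin n → Fin m → ℝ := fun j i => B i j

lemma trB_mp (m n : ℕ) : MeasurePreserving (trB (m := m) (n := n)) volume volume := by
  refine mp_of_box _ _ ?_ ?_
  · unfold trB
    fun_prop
  · intro s hs
    have : (trB (m := m) (n := n)) ⁻¹' (Set.univ.pi fun i => Set.univ.pi (s i)) =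
        Set.univ.pi fun i => Set.univ.pi fun j => s j i := by
      ext B
      simp only [Set.mem_preimage, Set.mem_univ_pi, trB]
      exact ⟨fun h i j => h j i, fun h i j => h j i⟩
    rw [this, volume_pi, Measure.pi_pi]
    simp_rw [volume_pi, Measure.pi_pi]
    exact Finset.prod_comm

/-- currying -/
def curB {m n : ℕ} (Z : Fin m × Fin n → ℝ) : Fin m → Fin n → ℝ := fun i j => Z (i, j)

lemma curB_mp (m n : ℕ) : MeasurePreserving (curB (m := m) (n := n)) volume volume := by
  refine mp_of_box _ _ ?_ ?_
  · unfold curB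
    fun_prop
  · intro s hs
    have : (curB (m := m) (n := n)) ⁻¹' (Set.univ.pi fun i => Set.univ.pi (s i)) =
        Set.univ.pi fun q : Fin m × Fin n => s q.1 q.2 := by
      ext B
      simp only [Set.mem_preimage, Set.mem_univ_pi, curB]
      exact ⟨fun h q => h q.1 q.2, fun h i j => h (i, j)⟩
    rw [this, volume_pi, Measure.pi_pi, Fintype.prod_prod_type]

lemma wishEigR_trB {m n : ℕ} (B : Fin m → Fin n → ℝ) :
    wishEigR n (extB (trB B)) = wishEigR m (extB B) := by
  unfold wishEigR
  rw [gramR_eq, gramR_eq, eigs_gram_swap (rowsM m (extB B))]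
  have : rowsM n (extB (trB B)) = (rowsM m (extB B)).transpose := by
    ext i j
    simp [rowsM, extB, trB]
  rw [this, Matrix.transpose_transpose]

lemma asum_wish {D : ℕ} (k : ℕ) (B : ℕ → Fin D → ℝ) :
    asum (min k D) (wishEigR k B) = ∑ i ∈ range k, ∑ j, B i j ^ 2 := by
  have h1 : asum (min k D) (wishEigR k B) = ∑ i : Fin D, eigR (gramR k B) i := by
    unfold asum
    have : ∑ i ∈ range (min k D), wishEigR k B i = ∑ i ∈ range D, wishEigR k B i := by
      refine Finset.sum_subset (fun i hi => ?_) (fun i _ hi => ?_)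
      · rw [Finset.mem_range] at hi ⊢; omega
      · rw [Finset.mem_range, not_lt] at hi
        exact wishEigR_zero k B i hi
    rw [this, Finset.sum_range]
    exact Finset.sum_congr rfl fun i _ => wishEigR_fin k B i
  obtain ⟨-, -, U, hU1, hU2, hMU⟩ := eigR_spec (gramR_sym k B)
  have h2 : Matrix.trace (gramR k B) = ∑ i : Fin D, eigR (gramR k B) i := by
    conv_lhs => rw [hMU]
    rw [Matrix.trace_mul_comm, ← Matrix.mul_assoc, hU1, Matrix.one_mul, Matrix.trace_diagonal]
  rw [h1, ← h2, Matrix.trace]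
  simp only [Matrix.diag_apply, gramR, Matrix.of_apply, ← sq]
  exact Finset.sum_comm

/-- weights of level differences -/
def wtA (R N : ℕ) (w : ℕ → ℝ) (L : ℕ → ℕ → ℝ) : ℝ :=
  ∑ l ∈ Icc 1 N, w (l - 1) * (asum (min l R) (L l) - asum (min (l - 1) R) (L (l - 1)))

lemma wtA_measurable (R N : ℕ) (w : ℕ → ℝ) {X : Type*} [MeasurableSpace X] {L : X → ℕ → ℕ → ℝ}
    (hL : ∀ l i, Measurable fun x => L x l i) : Measurable fun x => wtA R N w (L x) := by
  unfold wtA asum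
  refine Finset.measurable_fun_sum _ fun l _ => measurable_const.mul ?_
  exact (Finset.measurable_fun_sum _ fun i _ => hL l i).sub
    (Finset.measurable_fun_sum _ fun i _ => hL (l - 1) i)

lemma wtA_arrB {N R D : ℕ} (hR : ∀ l, l ≤ N → min l R = min l D) (w : ℕ → ℝ) (B : Fin N → Fin D → ℝ) :
    wtA R N w (lev (arrB N R D B)) = ∑ i : Fin N, w i * ∑ j, B i j ^ 2 := by
  unfold wtA
  have h : ∀ l, l ≤ N → asum (min l R) (lev (arrB N R D B) l) =
      ∑ i ∈ range l, ∑ j, extB B i j ^ 2 := by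
    intro l hl
    rw [lev_arrB hR B hl, hR l hl, asum_wish]
  have h2 : ∑ l ∈ Icc 1 N, w (l - 1) * (asum (min l R) (lev (arrB N R D B) l) -
      asum (min (l - 1) R) (lev (arrB N R D B) (l - 1))) =
      ∑ l ∈ Icc 1 N, w (l - 1) * ∑ j, extB B (l - 1) j ^ 2 := by
    refine Finset.sum_congr rfl fun l hl => ?_
    obtain ⟨h3, h4⟩ := Finset.mem_Icc.mp hl
    obtain ⟨k, rfl⟩ := Nat.exists_eq_add_of_le' h3
    rw [h _ h4, Nat.add_sub_cancel, h k (by omega), Finset.sum_range_succ]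
    ring
  rw [h2]
  have h5 : Icc 1 N = Ico (0 + 1) (N + 1) := by ext; simp
  rw [h5, ← Finset.sum_Ico_add' (fun l => w (l - 1) * ∑ j, extB B (l - 1) j ^ 2) 0 N 1]
  simp only [Nat.add_sub_cancel]
  rw [← Finset.range_eq_Ico, Finset.sum_range]
  refine Finset.sum_congr rfl fun i _ => ?_
  simp [extB]

/-! ## Part N : Gaussian matrices -/

lemma gauss_law (m n : ℕ) (p : Fin m → Fin n → ℝ) (hp : ∀ i j, 0 < p i j) :
    ∃ c : ℝ≥0∞, c ≠ 0 ∧ c ≠ ∞ ∧ ∀ F : (Fin m → Fin n → ℝ) → ℝ≥0∞, Measurable F →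
      ∫⁻ Z, F (curB Z) ∂(Measure.pi fun q : Fin m × Fin n => gaussianReal 0 ((p q.1 q.2)⁻¹).toNNReal) =
      c * ∫⁻ B, ENNReal.ofReal (Real.exp (-(1 / 2) * ∑ i, ∑ j, p i j * B i j ^ 2)) * F B := by
  have hv : ∀ q : Fin m × Fin n, ((p q.1 q.2)⁻¹).toNNReal ≠ 0 := fun q => by
    have := inv_pos.mpr (hp q.1 q.2)
    simpa using this
  have hvr : ∀ q : Fin m × Fin n, ((((p q.1 q.2)⁻¹).toNNReal : ℝ≥0) : ℝ) = (p q.1 q.2)⁻¹ := fun q =>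
    Real.coe_toNNReal _ (inv_pos.mpr (hp q.1 q.2)).le
  set κ : ℝ := ∏ q : Fin m × Fin n, (√(2 * Real.pi * (p q.1 q.2)⁻¹))⁻¹ with hκ
  have hκ0 : 0 < κ := Finset.prod_pos fun q _ => inv_pos.mpr (Real.sqrt_pos.mpr (by
    have := inv_pos.mpr (hp q.1 q.2)
    positivity))
  have e1 : (Measure.pi fun q : Fin m × Fin n => gaussianReal 0 ((p q.1 q.2)⁻¹).toNNReal) =
      (volume : Measure (Fin m × Fin n → ℝ)).withDensity fun Z =>
        ENNReal.ofReal κ * ENNReal.ofReal (Real.exp (-(1 / 2) * ∑ i, ∑ j, p i j * curB Z i j ^ 2)) := by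
    have h1 : (fun q : Fin m × Fin n => gaussianReal 0 ((p q.1 q.2)⁻¹).toNNReal) = fun q =>
        (volume : Measure ℝ).withDensity (gaussianPDF 0 ((p q.1 q.2)⁻¹).toNNReal) := by
      funext q
      exact gaussianReal_of_var_ne_zero 0 (hv q)
    have : ∀ q : Fin m × Fin n, SigmaFinite ((volume : Measure ℝ).withDensity
        (gaussianPDF 0 ((p q.1 q.2)⁻¹).toNNReal)) := fun q => by
      rw [← gaussianReal_of_var_ne_zero 0 (hv q)]; infer_instance
    rw [h1, pi_withDensity (fun q => measurable_gaussianPDF _ _), volume_pi]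
    congr 1
    funext Z
    rw [← ENNReal.ofReal_mul hκ0.le]
    unfold gaussianPDF
    rw [← ENNReal.ofReal_prod_of_nonneg (fun q _ => gaussianPDFReal_nonneg _ _ _)]
    congr 1
    unfold gaussianPDFReal
    rw [Finset.prod_mul_distrib, ← Real.exp_sum, ← Fintype.sum_prod_type' (f := fun i j => p i j * curB Z i j ^ 2),
      Finset.mul_sum]
    congr 1
    · exact Finset.prod_congr rfl fun q _ => by rw [hvr]
    · congr 1
      refine Finset.sum_congr rfl fun q _ => ?_
      rw [hvr]
      have := (hp q.1 q.2).ne'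
      simp only [curB, sub_zero]
      field_simp
  refine ⟨ENNReal.ofReal κ, by simpa using hκ0, ENNReal.ofReal_ne_top, fun F hF => ?_⟩
  have hE : Measurable fun B : Fin m → Fin n → ℝ =>
      ENNReal.ofReal (Real.exp (-(1 / 2) * ∑ i, ∑ j, p i j * B i j ^ 2)) := by fun_prop
  have hc := (curB_mp m n)
  have hE' : Measurable fun Z : Fin m × Fin n → ℝ =>
      ENNReal.ofReal κ * ENNReal.ofReal (Real.exp (-(1 / 2) * ∑ i, ∑ j, p i j * curB Z i j ^ 2)) :=
    (hE.comp hc.measurable).const_mul _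
  have hF' : Measurable fun Z : Fin m × Fin n → ℝ => F (curB Z) := hF.comp hc.measurable
  rw [e1]
  refine (lintegral_withDensity_eq_lintegral_mul _ hE' hF').trans ?_
  have h3 := hc.lintegral_comp (hE.mul hF)
  simp only [Pi.mul_apply] at h3
  rw [← h3, ← lintegral_const_mul' _ _ ENNReal.ofReal_ne_top]
  refine lintegral_congr fun Z => ?_
  simp only [Pi.mul_apply]
  rw [mul_assoc]

lemma gauss_mass (m n : ℕ) :
    ∫⁻ B : Fin m → Fin n → ℝ, ENNReal.ofReal (Real.exp (-(1 / 2) * ∑ i, ∑ j, B i j ^ 2)) ≠ 0 ∧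
    ∫⁻ B : Fin m → Fin n → ℝ, ENNReal.ofReal (Real.exp (-(1 / 2) * ∑ i, ∑ j, B i j ^ 2)) ≠ ∞ := by
  obtain ⟨c, h0, h1, h⟩ := gauss_law m n (fun _ _ => 1) (fun _ _ => one_pos)
  have := h (fun _ => 1) measurable_const
  simp only [lintegral_const, measure_univ, mul_one, one_mul] at this
  constructor
  · intro h2
    rw [h2, mul_zero] at this
    exact one_ne_zero this
  · intro h2
    rw [h2, ENNReal.mul_top h0] at this
    exact ENNReal.one_ne_top this

/-! ## Part O : law of the top level -/

/-- density of the top level -/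
def tt (a b : ℕ) (L : ℕ → ℝ) : ℝ≥0∞ :=
  if SDP a L then ENNReal.ofReal (vand a L * ∏ i ∈ range a, L i ^ (((b : ℝ) - a - 1) / 2)) else 0

lemma extF_cast {a b : ℕ} (h : a = b) (y : Fin a → ℝ) :
    extF (fun i : Fin b => y (Fin.cast h.symm i)) = extF y := by
  subst h; rfl

lemma extF_restrict {a : ℕ} {L : ℕ → ℝ} (h : ∀ i, a ≤ i → L i = 0) :
    extF (fun i : Fin a => L i) = L := by
  funext i
  unfold extF
  split_ifs with hi
  · rfl
  · exact (h i (by omega)).symm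

lemma extF_measurable {a : ℕ} (i : ℕ) : Measurable fun x : Fin a → ℝ => extF x i := by
  unfold extF
  split_ifs
  · exact measurable_pi_apply _
  · exact measurable_const

lemma dW_snoc_top {D R N : ℕ} (μ : Arr N R) (y : Fin (min (N + 1) R) → ℝ) (hR : N + 1 ≤ R) :
    dW D R (N + 1) (snocA μ y) = qW R (N + 1) (snocA μ y) *
      ENNReal.ofReal (∏ i ∈ range (N + 1), extF y i ^ (((D : ℝ) - (N + 1 : ℕ) - 1) / 2)) := by
  unfold dW qW
  split_ifs with h
  · rw [← ENNReal.ofReal_mul (Qden_nonneg h (lev_Zb _)), Pden_Qden, ← lev_snocA_top μ y]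
    simp only [min_eq_left hR]
  · simp

lemma tt_measurable (a b : ℕ) : Measurable fun x : Fin a → ℝ => tt a b (extF x) := by
  unfold tt
  refine Measurable.ite ?_ ?_ measurable_const
  · have : {x : Fin a → ℝ | SDP a (extF x)} =
      (⋂ (i : ℕ) (j : ℕ) (_ : i < j) (_ : j < a), {x | extF x j < extF x i}) ∩
      ⋂ (i : ℕ) (_ : i < a), {x | 0 < extF x i} := by
      ext x
      simp only [Set.mem_inter_iff, Set.mem_iInter, Set.mem_ofPred_eq, SDP]
    rw [this]
    refine MeasurableSet.inter ?_ ?_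
    · refine MeasurableSet.iInter fun i => MeasurableSet.iInter fun j => MeasurableSet.iInter fun _ =>
        MeasurableSet.iInter fun _ => measurableSet_lt (extF_measurable j) (extF_measurable i)
    · refine MeasurableSet.iInter fun i => MeasurableSet.iInter fun _ =>
        measurableSet_lt measurable_const (extF_measurable i)
  · refine ((vand_measurable (fun i => extF_measurable i) _).mul
      (Finset.measurable_fun_prod _ fun i _ => (extF_measurable i).pow_const _)).ennreal_ofReal

theorem top_law (a b : ℕ) (ha : 1 ≤ a) (hab : a ≤ b) :
    ∃ C : ℝ≥0∞, C ≠ 0 ∧ C ≠ ∞ ∧ ∀ g : (Fin a → ℝ) → ℝ≥0∞, Measurable g →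
      ∫⁻ B : Fin a → Fin b → ℝ, g (fun i => wishEigR a (extB B) i) =
        C * ∫⁻ x : Fin a → ℝ, tt a b (extF x) * g x := by
  obtain ⟨N, rfl⟩ : ∃ N, a = N + 1 := ⟨a - 1, by omega⟩
  obtain ⟨c, hc0, hc1, hc⟩ := proc b (by omega) (N + 1) b (fun _ _ => rfl)
  obtain ⟨C, hC⟩ := gtvol b N hab
  have hk : N + 1 = min (N + 1) b := by omega
  have key : ∀ g : (Fin (N + 1) → ℝ) → ℝ≥0∞, Measurable g →
      ∫⁻ B : Fin (N + 1) → Fin b → ℝ, g (fun i => wishEigR (N + 1) (extB B) i) =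
        (c * C) * ∫⁻ x : Fin (N + 1) → ℝ, tt (N + 1) b (extF x) * g x := by
    intro g hg
    have hl : Measurable fun μ : Arr (N + 1) b => (fun i : Fin (N + 1) => lev μ (N + 1) i) :=
      measurable_pi_lambda _ fun i => lev_measurable _ _
    have hF : Measurable fun μ : Arr (N + 1) b => g (fun i => lev μ (N + 1) i) := hg.comp hl
    have h1 := hc _ hF
    have h2 : ∫⁻ B : Fin (N + 1) → Fin b → ℝ, g (fun i => wishEigR (N + 1) (extB B) i) =
        ∫⁻ B : Fin (N + 1) → Fin b → ℝ, g (fun i => lev (arrB (N + 1) b b B) (N + 1) i) := by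
      refine lintegral_congr fun B => ?_
      rw [lev_arrB (fun _ _ => rfl) B le_rfl]
    have hm : Measurable fun x : Fin (N + 1) → ℝ => tt (N + 1) b (extF x) * g x :=
      (tt_measurable _ _).mul hg
    have hG : Measurable fun μ : Arr (N + 1) b => dW b b (N + 1) μ * g (fun i => lev μ (N + 1) i) :=
      (dW_measurable b b (N + 1)).mul hF
    rw [h2, h1, lintegral_snocA' hk _ hG, mul_assoc]
    congr 1
    rw [← lintegral_const_mul _ hm]
    refine lintegral_congr fun y => ?_
    have e1 : (fun i : Fin (min (N + 1) b) => y (Fin.cast hk.symm i)) = fun i : Fin (min (N + 1) b) => extF y (i : ℕ) := by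
      funext i
      have := extF_fin y (Fin.cast hk.symm i)
      rw [← this]; rfl
    have e2 : ∀ μ : Arr N b, dW b b (N + 1) (snocA μ (fun i => y (Fin.cast hk.symm i))) *
        g (fun i => lev (snocA μ (fun i => y (Fin.cast hk.symm i))) (N + 1) i) =
        qW b (N + 1) (snocA μ (fun i => extF y i)) *
          (ENNReal.ofReal (∏ i ∈ range (N + 1), extF y i ^ (((b : ℝ) - (N + 1 : ℕ) - 1) / 2)) * g y) := by
      intro μ
      rw [dW_snoc_top _ _ hab, lev_snocA_top, extF_cast hk, e1, mul_assoc]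
      congr 3
      funext i
      exact extF_fin y i
    rw [lintegral_congr e2, lintegral_mul_const, hC]
    · unfold tt
      split_ifs with hS
      · rw [ENNReal.ofReal_mul (SDP_vand hS).le]
        ring
      · simp
    · have : Measurable fun μ : Arr N b => snocA μ (fun i => extF y i) :=
        (snocA_measurable N b).comp (measurable_id.prodMk measurable_const)
      exact (qW_measurable b (N + 1)).comp this
  have hex : Measurable fun x : Fin (N + 1) → ℝ =>
      ENNReal.ofReal (Real.exp (-(1 / 2) * ∑ i, x i)) := by fun_prop
  have hk1 := key _ hex
  have hgm := gauss_mass (N + 1) b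
  have e3 : ∀ B : Fin (N + 1) → Fin b → ℝ, ∑ i : Fin (N + 1), wishEigR (N + 1) (extB B) i =
      ∑ i, ∑ j, B i j ^ 2 := by
    intro B
    have h := asum_wish (N + 1) (extB B)
    rw [min_eq_left hab] at h
    unfold asum at h
    rw [Finset.sum_range, Finset.sum_range] at h
    rw [h]
    refine Finset.sum_congr rfl fun i _ => ?_
    unfold extB
    simp only [i.2, dif_pos]
  simp only [e3] at hk1
  rw [hk1] at hgm
  refine ⟨c * C, fun h => hgm.1 (by rw [h, zero_mul]), fun h => ?_, key⟩
  rw [h] at hgm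
  exact hgm.2 (ENNReal.top_mul fun h0 => hgm.1 (by rw [h0, mul_zero]))

/-! ## Part P : the key identity -/

lemma top_law2 (m n k M : ℕ) (hm : 1 ≤ m) (hn : 1 ≤ n) (hk : k = min n m) (hM : M = max n m) :
    ∃ C : ℝ≥0∞, C ≠ 0 ∧ C ≠ ∞ ∧ ∀ g : (Fin k → ℝ) → ℝ≥0∞, Measurable g →
      ∫⁻ B : Fin m → Fin n → ℝ, g (fun i => wishEigR m (extB B) i) =
        C * ∫⁻ x : Fin k → ℝ, tt k M (extF x) * g x := by
  rcases le_total m n with h | h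
  · obtain rfl : k = m := by omega
    obtain rfl : M = n := by omega
    exact top_law k M hm h
  · obtain rfl : k = n := by omega
    obtain rfl : M = m := by omega
    obtain ⟨C, h0, h1, hC⟩ := top_law k M hn h
    refine ⟨C, h0, h1, fun g hg => ?_⟩
    rw [← hC g hg]
    have hG : Measurable fun B : Fin k → Fin M → ℝ => g (fun i => wishEigR k (extB B) i) :=
      hg.comp (measurable_pi_lambda _ fun i => wishEigR_measurable _ (fun i j => extB_measurable i j) _)
    rw [← (trB_mp M k).lintegral_comp hG]
    refine lintegral_congr fun B => ?_
    rw [wishEigR_trB]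

/-- the Bessel integral -/
def QB (m n' : ℕ) (piv : ℕ → ℝ) (L : ℕ → ℝ) : ℝ≥0∞ :=
  ∫⁻ ν : Arr n' (min (n' + 1) m), dW m (min (n' + 1) m) (n' + 1) (snocA ν (fun i => L i)) *
    ENNReal.ofReal (Real.exp (-(1 / 2) *
      wtA (min (n' + 1) m) (n' + 1) piv (lev (snocA ν (fun i => L i)))))

lemma wtE_measurable (R N : ℕ) (w : ℕ → ℝ) : Measurable fun μ : Arr N R =>
    ENNReal.ofReal (Real.exp (-(1 / 2) * wtA R N w (lev μ))) :=
  (Real.measurable_exp.comp ((wtA_measurable R N w fun l i => lev_measurable l i).const_mul _)).ennreal_ofReal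

lemma snocA_ext_measurable (N R k : ℕ) : Measurable fun q : (Fin k → ℝ) × Arr N R =>
    snocA q.2 (fun i => extF q.1 i) := by
  have h : Measurable fun q : (Fin k → ℝ) × Arr N R =>
      (q.2, fun i : Fin (min (N + 1) R) => extF q.1 i) :=
    measurable_snd.prodMk (measurable_pi_lambda _ fun i => (extF_measurable _).comp measurable_fst)
  exact (snocA_measurable N R).comp h

lemma QB_measurable (m n' k : ℕ) (piv : ℕ → ℝ) : Measurable fun x : Fin k → ℝ => QB m n' piv (extF x) := by
  unfold QB
  have h : Measurable fun q : (Fin k → ℝ) × Arr n' (min (n' + 1) m) =>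
      dW m (min (n' + 1) m) (n' + 1) (snocA q.2 (fun i => extF q.1 i)) *
    ENNReal.ofReal (Real.exp (-(1 / 2) *
      wtA (min (n' + 1) m) (n' + 1) piv (lev (snocA q.2 (fun i => extF q.1 i))))) :=
    ((dW_measurable _ _ _).comp (snocA_ext_measurable _ _ _)).mul
      ((wtE_measurable _ _ _).comp (snocA_ext_measurable _ _ _))
  exact h.lintegral_prod_right'

theorem key_id (m n' : ℕ) (hm : 1 ≤ m) (piv : ℕ → ℝ)
    {ρ : Measure (Matrix (Fin (n' + 1)) (Fin (n' + 1)) ℝ)}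
    [IsProbabilityMeasure ρ] (h1 : ∀ᵐ V ∂ρ, V.transpose * V = 1)
    (h2 : ∀ U : Matrix (Fin (n' + 1)) (Fin (n' + 1)) ℝ, U.transpose * U = 1 →
      ∀ f : Matrix (Fin (n' + 1)) (Fin (n' + 1)) ℝ → ℝ≥0∞, Measurable f →
        ∫⁻ V, f (U * V) ∂ρ = ∫⁻ V, f V ∂ρ) :
    ∃ c C : ℝ≥0∞, c ≠ 0 ∧ c ≠ ∞ ∧ C ≠ 0 ∧ C ≠ ∞ ∧ ∀ᵐ x : Fin (min (n' + 1) m) → ℝ,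
      c * QB m n' piv (extF x) =
        C * (tt (min (n' + 1) m) (max (n' + 1) m) (extF x) * GH (n' + 1) piv ρ (extF x)) := by
  obtain ⟨C, hC0, hC1, hC⟩ := top_law2 m (n' + 1) _ _ hm (by omega) rfl rfl
  obtain ⟨c, hc0, hc1, hc⟩ := proc m hm (n' + 1) (min (n' + 1) m) (fun l hl => by omega)
  refine ⟨c, C, hc0, hc1, hC0, hC1, ?_⟩
  have hk : min (n' + 1) m = min (n' + 1) (min (n' + 1) m) := by omega
  have hGH : Measurable fun x : Fin (min (n' + 1) m) → ℝ => GH (n' + 1) piv ρ (extF x) :=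
    GH_measurable fun i => extF_measurable i
  have key : ∀ g : (Fin (min (n' + 1) m) → ℝ) → ℝ≥0∞, Measurable g →
      ∫⁻ x, g x * (c * QB m n' piv (extF x)) =
      ∫⁻ x, g x * (C * (tt (min (n' + 1) m) (max (n' + 1) m) (extF x) * GH (n' + 1) piv ρ (extF x))) := by
    intro g hg
    have hfm : Measurable fun B : Fin m → Fin (n' + 1) → ℝ =>
        g (fun i : Fin (min (n' + 1) m) => wishEigR m (extB B) i) :=
      hg.comp (measurable_pi_lambda _ fun i => wishEigR_measurable _ (fun i j => extB_measurable i j) _)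
    have e1 := haar_avg piv h1 h2 _ hfm (fun U hU B => by simp only [wishEigR_rot U hU])
    have e2 : ∫⁻ B : Fin m → Fin (n' + 1) → ℝ, g (fun i : Fin (min (n' + 1) m) => wishEigR m (extB B) i) *
        GH (n' + 1) piv ρ (wishEigR m (extB B)) =
        C * ∫⁻ x, tt (min (n' + 1) m) (max (n' + 1) m) (extF x) * (g x * GH (n' + 1) piv ρ (extF x)) := by
      have hgg : Measurable fun x : Fin (min (n' + 1) m) → ℝ => g x * GH (n' + 1) piv ρ (extF x) :=
        hg.mul hGH
      rw [← hC _ hgg]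
      refine lintegral_congr fun B => ?_
      rw [extF_restrict (L := wishEigR m (extB B)) (fun i hi => wishEigR_zero _ _ _ (by omega))]
    have hFm : Measurable fun ν : Arr (n' + 1) (min (n' + 1) m) =>
        g (fun i : Fin (min (n' + 1) m) => lev ν (n' + 1) i) *
        ENNReal.ofReal (Real.exp (-(1 / 2) * wtA (min (n' + 1) m) (n' + 1) piv (lev ν))) :=
      (hg.comp (measurable_pi_lambda _ fun i => lev_measurable _ _)).mul (wtE_measurable _ _ _)
    have e3 := hc _ hFm
    have e4 : ∫⁻ B : Fin m → Fin (n' + 1) → ℝ, g (fun i : Fin (min (n' + 1) m) => wishEigR m (extB B) i) *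
        ENNReal.ofReal (Real.exp (-(1 / 2) * colW piv B)) =
        c * ∫⁻ ν : Arr (n' + 1) (min (n' + 1) m), dW m (min (n' + 1) m) (n' + 1) ν *
          (g (fun i : Fin (min (n' + 1) m) => lev ν (n' + 1) i) *
        ENNReal.ofReal (Real.exp (-(1 / 2) * wtA (min (n' + 1) m) (n' + 1) piv (lev ν)))) := by
      rw [← e3]
      have hFF : Measurable fun B : Fin (n' + 1) → Fin m → ℝ =>
          g (fun i : Fin (min (n' + 1) m) => lev (arrB (n' + 1) (min (n' + 1) m) m B) (n' + 1) i) *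
          ENNReal.ofReal (Real.exp (-(1 / 2) * wtA (min (n' + 1) m) (n' + 1) piv
            (lev (arrB (n' + 1) (min (n' + 1) m) m B)))) := hFm.comp (arrB_measurable _ _ _)
      rw [← (trB_mp m (n' + 1)).lintegral_comp hFF]
      refine lintegral_congr fun B => ?_
      rw [lev_arrB (fun l hl => by omega) _ le_rfl, wtA_arrB (fun l hl => by omega), wishEigR_trB]
      rfl
    have hGm : Measurable fun ν : Arr (n' + 1) (min (n' + 1) m) => dW m (min (n' + 1) m) (n' + 1) ν *
          (g (fun i : Fin (min (n' + 1) m) => lev ν (n' + 1) i) *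
        ENNReal.ofReal (Real.exp (-(1 / 2) * wtA (min (n' + 1) m) (n' + 1) piv (lev ν)))) :=
      (dW_measurable _ _ _).mul hFm
    rw [lintegral_snocA' hk _ hGm] at e4
    have e5 : ∀ y : Fin (min (n' + 1) m) → ℝ,
        ∫⁻ ν : Arr n' (min (n' + 1) m),
          dW m (min (n' + 1) m) (n' + 1) (snocA ν (fun i => y (Fin.cast hk.symm i))) *
          (g (fun i : Fin (min (n' + 1) m) =>
            lev (snocA ν (fun i => y (Fin.cast hk.symm i))) (n' + 1) i) *
        ENNReal.ofReal (Real.exp (-(1 / 2) * wtA (min (n' + 1) m) (n' + 1) piv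
          (lev (snocA ν (fun i => y (Fin.cast hk.symm i))))))) = g y * QB m n' piv (extF y) := by
      intro y
      have e6 : (fun i : Fin (min (n' + 1) (min (n' + 1) m)) => y (Fin.cast hk.symm i)) =
          fun i : Fin (min (n' + 1) (min (n' + 1) m)) => extF y (i : ℕ) := by
        funext i
        have := extF_fin y (Fin.cast hk.symm i)
        rw [← this]; rfl
      unfold QB
      rw [← lintegral_const_mul]
      · refine lintegral_congr fun ν => ?_
        have e7 : (fun i : Fin (min (n' + 1) m) =>
            lev (snocA ν (fun i => y (Fin.cast hk.symm i))) (n' + 1) i) = y := by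
          rw [lev_snocA_top, extF_cast hk]
          funext i
          exact extF_fin y i
        rw [e7, e6]
        ring
      · have hs : Measurable fun ν : Arr n' (min (n' + 1) m) => snocA ν (fun i => extF y i) :=
          (snocA_measurable _ _).comp (measurable_id.prodMk measurable_const)
        exact ((dW_measurable _ _ _).comp hs).mul ((wtE_measurable _ _ _).comp hs)
    rw [lintegral_congr e5] at e4
    have e8 := e4.symm.trans (e1.trans e2)
    have l1 : ∫⁻ x, g x * (c * QB m n' piv (extF x)) = c * ∫⁻ x, g x * QB m n' piv (extF x) := by
      rw [← lintegral_const_mul' _ _ hc1]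
      exact lintegral_congr fun x => by ring
    rw [l1, e8, ← lintegral_const_mul' _ _ hC1]
    exact lintegral_congr fun x => by ring
  refine ae_eq_of_forall_setLIntegral_eq_of_sigmaFinite ?_ ?_ fun s hs _ => ?_
  · exact (QB_measurable _ _ _ _).const_mul _
  · exact ((tt_measurable _ _).mul hGH).const_mul _
  · have := key (s.indicator 1) (measurable_one.indicator hs)
    rw [← lintegral_indicator hs, ← lintegral_indicator hs]
    convert this using 2 with x x
    · funext x; by_cases hx : x ∈ s <;> simp [hx]
    · funext x; by_cases hx : x ∈ s <;> simp [hx]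

/-! ## Part Q : weak and strict chains -/

lemma rpow_nonpos_zero {x : ℝ} (hx : x ≤ 0) : x ^ (-(1 / 2) : ℝ) = 0 := by
  rcases hx.lt_or_eq with h | h
  · rw [Real.rpow_def_of_neg h]
    have : Real.cos (-(1 / 2) * Real.pi) = 0 := by
      rw [show -(1 / 2) * Real.pi = -(Real.pi / 2) by ring, Real.cos_neg, Real.cos_pi_div_two]
    rw [this, mul_zero]
  · rw [h]
    exact Real.zero_rpow (by norm_num)

lemma SC_of_weak {R N : ℕ} {L : ℕ → ℕ → ℝ} (hz : Zb R N L)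
    (hw : ∀ l, 1 ≤ l → l < N → interlaces (min l R) (min (l + 1) R) (L l) (L (l + 1)))
    (hc : ∀ l, 1 ≤ l → l < N → cross (min l R) (min (l + 1) R) (L l) (L (l + 1)) ≠ 0)
    (hp : ∀ i, i < min N R → 0 < L (min N R) i) : SC R N L := by
  have hdown : ∀ d l, l + d = min N R → ∀ i, i < l → 0 < L l i := by
    intro d
    induction d with
    | zero => intro l hl i hi; rw [show l = min N R by omega]; exact hp i (by omega)
    | succ d ih =>
      intro l hl i hi
      have h1 := ih (l + 1) (by omega) (i + 1) (by omega)
      exact h1.trans_le ((hw l (by omega) (by omega)).2 i (by omega) (by omega))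
  have hup : ∀ d l, l = min N R + d → l ≤ N → ∀ i, i < min N R → 0 < L l i := by
    intro d
    induction d with
    | zero => intro l hl _ i hi; rw [show l = min N R by omega]; exact hp i (by omega)
    | succ d ih =>
      intro l hl hlN i hi
      have h1 := ih (l - 1) (by omega) (by omega) i hi
      have h2 := (hw (l - 1) (by omega) (by omega)).1 i (by omega)
      rw [show l - 1 + 1 = l by omega] at h2
      exact h1.trans_le h2
  have hpos : ∀ l, l ≤ N → ∀ i, i < min l R → 0 < L l i := by
    intro l hl i hi
    by_cases h : l ≤ min N R
    · exact hdown (min N R - l) l (by omega) i (by omega)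
    · exact hup (l - min N R) l (by omega) hl i (by omega)
  have hne : ∀ l, 1 ≤ l → l < N → ∀ i j, i < min l R → j < min (l + 1) R → L l i ≠ L (l + 1) j := by
    intro l h1 h2 i j hi hj he
    refine hc l h1 h2 ?_
    unfold cross
    refine Finset.prod_eq_zero (Finset.mem_range.mpr hi) (Finset.prod_eq_zero (Finset.mem_range.mpr hj) ?_)
    rw [he]; simp
  intro l hl
  constructor
  · intro i
    change L l i < L (l + 1) i
    by_cases hi : (i : ℕ) < min l R
    · exact lt_of_le_of_ne ((hw l (by omega) hl).1 i hi) (hne l (by omega) hl i i hi i.2)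
    · rw [hz l hl.le i (by omega)]
      exact hpos _ hl _ i.2
  · have key : ∀ i j : ℕ, i < j → j < min (l + 1) R → L (l + 1) j ≤ L l i := by
      intro i j hij
      induction j with
      | zero => omega
      | succ j ih =>
        intro hj
        by_cases h : i = j
        · subst h
          exact (hw l (by omega) hl).2 i (by omega) hj
        · refine le_trans ?_ (ih (by omega) (by omega))
          exact ((hw l (by omega) hl).2 j (by omega) hj).trans ((hw l (by omega) hl).1 j (by omega))
    intro i j hij
    rw [Fin.lt_def] at hij
    have hi := i.2
    have hj := j.2
    exact lt_of_le_of_ne (key i j hij j.2) (hne l (by omega) hl i j (by omega) j.2).symm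

lemma SC.weak {R N : ℕ} {L : ℕ → ℕ → ℝ} (h : SC R N L) (l : ℕ) (hl : l < N) :
    interlaces (min l R) (min (l + 1) R) (L l) (L (l + 1)) := by
  constructor
  · intro i hi
    exact ((h l hl).1 ⟨i, by omega⟩).le
  · intro i hi hi'
    exact ((h l hl).2 ⟨i, by omega⟩ ⟨i + 1, hi'⟩ (by rw [Fin.lt_def]; simp)).le

lemma vand_small {k : ℕ} (hk : k ≤ 1) (x : ℕ → ℝ) : vand k x = 1 := by
  unfold vand
  refine Finset.prod_eq_one fun i hi => Finset.prod_eq_one fun j hj => ?_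
  rw [Finset.mem_range] at hi hj
  rw [if_neg (by omega)]

/-- the product over levels appearing in the Bessel functions -/
def crossP (R N : ℕ) (L : ℕ → ℕ → ℝ) : ℝ :=
  ∏ l ∈ Ico 1 N, cross (min l R) (min (l + 1) R) (L l) (L (l + 1)) ^ (-(1 / 2) : ℝ) /
    (vand (min l R) (L l) ^ (-(1 / 2) : ℝ) * vand (min (l + 1) R) (L (l + 1)) ^ (-(1 / 2) : ℝ))

lemma crossP_eq {R N : ℕ} {L : ℕ → ℕ → ℝ} (hN : 1 ≤ N)
    (hv : ∀ l, 1 ≤ l → l ≤ N → 0 < vand (min l R) (L l)) :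
    crossP R N L = Qden R N L / vand (min N R) (L N) ^ (1 / 2 : ℝ) := by
  induction N, hN using Nat.le_induction with
  | base => simp [crossP, Qden, vand_small]
  | succ N hN ih =>
    have h1 := ih fun l a b => hv l a (by omega)
    rw [Qden_succ hN]
    unfold crossP at h1 ⊢
    rw [Finset.prod_Ico_succ_top (by omega), h1]
    have v1 := hv N hN (by omega)
    have v2 := hv (N + 1) (by omega) le_rfl
    set a := vand (min N R) (L N)
    set b := vand (min (N + 1) R) (L (N + 1))
    rw [Real.rpow_neg v1.le, Real.rpow_neg v2.le]
    have hb : b = b ^ (1 / 2 : ℝ) * b ^ (1 / 2 : ℝ) := by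
      rw [← Real.rpow_add v2]; norm_num
    have a0 : a ^ (1 / 2 : ℝ) ≠ 0 := (Real.rpow_pos_of_pos v1 _).ne'
    have b0 : b ^ (1 / 2 : ℝ) ≠ 0 := (Real.rpow_pos_of_pos v2 _).ne'
    generalize b ^ (1 / 2 : ℝ) = s at hb b0 ⊢
    rw [hb]
    field_simp

lemma crossP_zero {R N : ℕ} {L : ℕ → ℕ → ℝ} {l : ℕ} (h1 : 1 ≤ l) (h2 : l < N)
    (h : cross (min l R) (min (l + 1) R) (L l) (L (l + 1)) = 0) : crossP R N L = 0 := by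
  unfold crossP
  refine Finset.prod_eq_zero (Finset.mem_Ico.mpr ⟨h1, h2⟩) ?_
  rw [h, Real.zero_rpow (by norm_num), zero_div]

lemma prodlev_zero {k : ℕ} {x y : ℕ → ℝ} {i : ℕ} (hi : i < k) (h : x i ≤ 0) :
    ∏ i ∈ range k, x i ^ (-(1 / 2) : ℝ) / y i ^ (-(1 / 2) : ℝ) = 0 :=
  Finset.prod_eq_zero (Finset.mem_range.mpr hi) (by rw [rpow_nonpos_zero h, zero_div])

/-- the common algebra of both chains -/
lemma chain_expr {R N D : ℕ} {L : ℕ → ℕ → ℝ} (hN : 1 ≤ N) (h : SC R N L) (hz : Zb R N L)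
    (hD : min N R = N ∨ min N R = D) :
    (∏ i ∈ range (min N R), L (min N R) i ^ (-(1 / 2) : ℝ) / L N i ^ (-(1 / 2) : ℝ)) * crossP R N L =
      Pden D R N L * ((∏ i ∈ range (min N R), L N i ^ ((1 - ((D : ℝ) - (min N R : ℕ))) / 2)) /
        vand (min N R) (L N) ^ (1 / 2 : ℝ)) := by
  rw [crossP_eq hN (fun l _ hl => vand_nonneg_of_SC h hz hl), Pden_Qden]
  have hpos := h.pos hz
  have : (∏ i ∈ range (min N R), L (min N R) i ^ (-(1 / 2) : ℝ) / L N i ^ (-(1 / 2) : ℝ)) =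
      (∏ i ∈ range (min N R), L (min N R) i ^ (((D : ℝ) - (min N R : ℕ) - 1) / 2)) *
      ∏ i ∈ range (min N R), L N i ^ ((1 - ((D : ℝ) - (min N R : ℕ))) / 2) := by
    rw [← Finset.prod_mul_distrib]
    refine Finset.prod_congr rfl fun i hi => ?_
    have hi' := Finset.mem_range.mp hi
    have p1 := hpos N le_rfl i hi'
    rcases hD with hD | hD
    · rw [hD, div_self (Real.rpow_pos_of_pos p1 _).ne', ← Real.rpow_add p1]
      rw [← Real.rpow_zero (L N i)]
      congr 1
      ring
    · rw [hD, Real.rpow_neg p1.le (1 / 2)]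
      simp only [sub_self, zero_sub, sub_zero]
      rw [div_inv_eq_mul]
      congr 2
      norm_num
  rw [this]
  ring

/-! ## Part R : the Bessel density -/

lemma levT_snoc {n' k : ℕ} {lam : ℕ → ℝ} (hlam : ∀ i, min (n' + 1) k ≤ i → lam i = 0)
    (ν : Arr n' k) {l : ℕ} (hl : l ≤ n' + 1) :
    levT (m := n' + 1) (n := k) ν lam l = lev (snocA ν (fun i => lam i)) l := by
  by_cases h : l = n' + 1
  · subst h
    rw [lev_snocA_top, extF_restrict hlam]
    funext i
    simp [levT]
  · rw [lev_snocA_le _ _ (by omega)]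
    funext i
    simp [levT, lev, h]

lemma half_sub : (1 / 2 - 1 : ℝ) = -(1 / 2) := by norm_num

lemma interlaces_measurable {X : Type*} [MeasurableSpace X] {x y : X → ℕ → ℝ}
    (hx : ∀ i, Measurable fun t => x t i) (hy : ∀ i, Measurable fun t => y t i) (a b : ℕ) :
    MeasurableSet {t | interlaces a b (x t) (y t)} := by
  have : {t | interlaces a b (x t) (y t)} =
      (⋂ (i : ℕ) (_ : i < a), {t | x t i ≤ y t i}) ∩
      ⋂ (i : ℕ) (_ : i < a) (_ : i + 1 < b), {t | y t (i + 1) ≤ x t i} := by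
    ext t
    simp only [Set.mem_inter_iff, Set.mem_iInter, Set.mem_ofPred_eq, interlaces]
  rw [this]
  refine MeasurableSet.inter ?_ ?_
  · exact MeasurableSet.iInter fun i => MeasurableSet.iInter fun _ => measurableSet_le (hx i) (hy i)
  · exact MeasurableSet.iInter fun i => MeasurableSet.iInter fun _ => MeasurableSet.iInter fun _ =>
      measurableSet_le (hy _) (hx i)

lemma levT_measurable {m n : ℕ} (lam : ℕ → ℝ) (l i : ℕ) :
    Measurable fun μ : Arr (m - 1) n => levT μ lam l i := by
  unfold levT ent
  split_ifs
  · exact measurable_const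
  · exact measurable_const
  · exact measurable_pi_apply _
  · exact measurable_const

lemma GTset_measurable (m n : ℕ) (lam : ℕ → ℝ) : MeasurableSet (GTset m n lam) := by
  have : GTset m n lam = ⋂ (l : ℕ) (_ : 1 ≤ l) (_ : l < m),
      {μ | interlaces (min l n) (min (l + 1) n) (levT μ lam l) (levT μ lam (l + 1))} := by
    ext μ
    simp only [GTset, Set.mem_iInter, Set.mem_ofPred_eq]
  rw [this]
  exact MeasurableSet.iInter fun l => MeasurableSet.iInter fun _ => MeasurableSet.iInter fun _ =>
    interlaces_measurable (fun i => levT_measurable lam l i) (fun i => levT_measurable lam (l + 1) i) _ _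

lemma phiB_eq (m n' k : ℕ) (piv lam : ℕ → ℝ) (hk : min (n' + 1) m = k)
    (hz : ∀ i, k ≤ i → lam i = 0) :
    phiB (1 / 2) k (n' + 1) lam (fun i => -(1 / 2) * piv i) =
      (Real.Gamma (1 / 2))⁻¹ ^ (k * (k - 1) / 2 + k * (n' + 1 - k)) *
        ((QB m n' piv lam).toReal * ((∏ i ∈ range k, lam i ^ ((1 - ((m : ℝ) - k)) / 2)) /
          vand k lam ^ (1 / 2 : ℝ))) := by
  subst hk
  set k := min (n' + 1) m with hkdef
  have hkk : min (n' + 1) k = k := by omega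
  have hz' : ∀ i, min (n' + 1) k ≤ i → lam i = 0 := fun i hi => hz i (by omega)
  unfold phiB
  congr 1
  rw [← integral_indicator (GTset_measurable _ _ _)]
  have hpt : ∀ ν : Arr n' k, (GTset (n' + 1) k lam).indicator (fun μ : Arr n' k =>
      (Real.exp (∑ l ∈ Icc 1 (n' + 1),
          (-(1 / 2) * piv (l - 1)) * (asum (min l k) (levT (m := n' + 1) μ lam l) -
            asum (min (l - 1) k) (levT (m := n' + 1) μ lam (l - 1)))) *
        ∏ i ∈ range k, levT (m := n' + 1) μ lam k i ^ (1 / 2 - 1 : ℝ) / lam i ^ (1 / 2 - 1 : ℝ)) *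
      ∏ l ∈ Ico 1 (n' + 1),
        cross (min l k) (min (l + 1) k) (levT (m := n' + 1) μ lam l) (levT (m := n' + 1) μ lam (l + 1)) ^ (1 / 2 - 1 : ℝ) /
          (vand (min l k) (levT (m := n' + 1) μ lam l) ^ (1 / 2 - 1 : ℝ) *
            vand (min (l + 1) k) (levT (m := n' + 1) μ lam (l + 1)) ^ (1 / 2 - 1 : ℝ))) ν =
      (dW m k (n' + 1) (snocA ν (fun i => lam i)) *
        ENNReal.ofReal (Real.exp (-(1 / 2) * wtA k (n' + 1) piv (lev (snocA ν (fun i => lam i)))))).toReal *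
      ((∏ i ∈ range k, lam i ^ ((1 - ((m : ℝ) - k)) / 2)) / vand k lam ^ (1 / 2 : ℝ)) := by
    intro ν
    set L := lev (snocA ν (fun i => lam i)) with hL
    have hlt : ∀ l, l ≤ n' + 1 → levT (m := n' + 1) ν lam l = L l := fun l hl => levT_snoc hz' ν hl
    have htop : L (n' + 1) = lam := by rw [hL, lev_snocA_top, extF_restrict hz']
    have hZb : Zb k (n' + 1) L := lev_Zb _
    have hcp : ∏ l ∈ Ico 1 (n' + 1),
        cross (min l k) (min (l + 1) k) (levT (m := n' + 1) ν lam l) (levT (m := n' + 1) ν lam (l + 1)) ^ (1 / 2 - 1 : ℝ) /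
          (vand (min l k) (levT (m := n' + 1) ν lam l) ^ (1 / 2 - 1 : ℝ) *
            vand (min (l + 1) k) (levT (m := n' + 1) ν lam (l + 1)) ^ (1 / 2 - 1 : ℝ)) = crossP k (n' + 1) L := by
      unfold crossP
      refine Finset.prod_congr rfl fun l hl => ?_
      have := Finset.mem_Ico.mp hl
      rw [hlt l (by omega), hlt (l + 1) (by omega), half_sub]
    have hpr : ∏ i ∈ range k, levT (m := n' + 1) ν lam k i ^ (1 / 2 - 1 : ℝ) / lam i ^ (1 / 2 - 1 : ℝ) =
        ∏ i ∈ range k, L k i ^ (-(1 / 2) : ℝ) / L (n' + 1) i ^ (-(1 / 2) : ℝ) := by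
      rw [hlt k (by omega), half_sub, htop]
    have hex : ∑ l ∈ Icc 1 (n' + 1),
          (-(1 / 2) * piv (l - 1)) * (asum (min l k) (levT (m := n' + 1) ν lam l) -
            asum (min (l - 1) k) (levT (m := n' + 1) ν lam (l - 1))) = -(1 / 2) * wtA k (n' + 1) piv L := by
      unfold wtA
      rw [Finset.mul_sum]
      refine Finset.sum_congr rfl fun l hl => ?_
      have := Finset.mem_Icc.mp hl
      rw [hlt l (by omega), hlt (l - 1) (by omega)]
      ring
    have hGT : ν ∈ GTset (n' + 1) k lam ↔
        ∀ l, 1 ≤ l → l < n' + 1 → interlaces (min l k) (min (l + 1) k) (L l) (L (l + 1)) := by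
      refine forall_congr' fun l => forall_congr' fun _ => forall_congr' fun hl => ?_
      rw [hlt l (by omega), hlt (l + 1) (by omega)]
    by_cases hSC : SC k (n' + 1) L
    · rw [Set.indicator_of_mem (hGT.mpr fun l _ h2 => hSC.weak l h2)]
      rw [hcp, hpr, hex, mul_assoc]
      have hce := chain_expr (D := m) (by omega) hSC hZb (by omega)
      rw [hkk, htop] at hce
      rw [htop, hce]
      unfold dW
      rw [if_pos hSC, ENNReal.toReal_mul, ENNReal.toReal_ofReal (Pden_nonneg hSC hZb),
        ENNReal.toReal_ofReal (Real.exp_pos _).le]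
      ring
    · have hd : dW m k (n' + 1) (snocA ν (fun i => lam i)) = 0 := by
        unfold dW; rw [if_neg hSC]
      rw [hd, zero_mul, ENNReal.toReal_zero, zero_mul]
      by_cases hmem : ν ∈ GTset (n' + 1) k lam
      · rw [Set.indicator_of_mem hmem, hcp, hpr]
        by_contra hne
        refine hSC (SC_of_weak hZb (hGT.mp hmem) (fun l h1 h2 h3 => hne ?_) fun i hi => ?_)
        · rw [crossP_zero h1 h2 h3, mul_zero]
        · by_contra hi'
          rw [hkk] at hi hi'
          exact hne (by rw [prodlev_zero hi (not_lt.mp hi')]; simp)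
      · rw [Set.indicator_of_notMem hmem]
  refine (integral_congr_ae (ae_of_all _ hpt)).trans ?_
  rw [integral_mul_const, integral_toReal]
  · rfl
  · have hs : Measurable fun ν : Arr n' k => snocA ν (fun i => lam i) :=
      (snocA_measurable _ _).comp (measurable_id.prodMk measurable_const)
    exact (((dW_measurable _ _ _).comp hs).mul ((wtE_measurable _ _ _).comp hs)).aemeasurable
  · exact ae_of_all _ fun ν => ENNReal.mul_lt_top (dW_ne_top _ _ _ _).lt_top ENNReal.ofReal_lt_top

/-! ## Part S : the ensemble density -/

lemma gammaProd_pos (n m : ℕ) : 0 < gammaProd (1 / 2) n m := by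
  unfold gammaProd
  refine Finset.prod_pos fun k hk => Real.Gamma_pos_of_pos ?_
  have := Finset.mem_Icc.mp hk
  have : (0 : ℝ) < k := by exact_mod_cast (by omega : 0 < k)
  positivity

/-- normalising constant -/
def KcB (n k : ℕ) : ℝ := (Real.Gamma (1 / 2))⁻¹ ^ k * (gammaProd (1 / 2) k n / Real.Gamma (1 / 2) ^ k) *
  (Real.Gamma (1 / 2))⁻¹ ^ (k * (k - 1) / 2 + k * (n - k))

lemma KcB_pos (n k : ℕ) : 0 < KcB n k := by
  have := gammaProd_pos k n
  have h2 : 0 < Real.Gamma (1 / 2) := Real.Gamma_pos_of_pos (by norm_num)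
  unfold KcB
  positivity

lemma mvb_eq (m n' k M : ℕ) (hm : 1 ≤ m) (piv pih : ℕ → ℝ) (hk : min (n' + 1) m = k)
    (hM : max (n' + 1) m = M) (μ : Arr m (n' + 1)) :
    mvbDensity (1 / 2) (n' + 1) m piv pih μ = if SC (n' + 1) m (lev μ) then
      KcB (n' + 1) k * (Pden (n' + 1) (n' + 1) m (lev μ) * Real.exp (-(1 / 2) * wtA (n' + 1) m pih (lev μ)) *
        ((QB m n' piv (lev μ m)).toReal /
          (vand k (lev μ m) * ∏ i ∈ range k, lev μ m i ^ (((M : ℝ) - k - 1) / 2)))) else 0 := by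
  have hk' : min m (n' + 1) = k := by omega
  have hZb : Zb (n' + 1) m (lev μ) := lev_Zb _
  have hz : ∀ i, k ≤ i → lev μ m i = 0 := fun i hi => hZb m le_rfl i (by omega)
  have hcp : ∏ l ∈ Ico 1 m,
      cross (min l (n' + 1)) (min (l + 1) (n' + 1)) (lev μ l) (lev μ (l + 1)) ^ (1 / 2 - 1 : ℝ) /
        (vand (min l (n' + 1)) (lev μ l) ^ (1 / 2 - 1 : ℝ) *
          vand (min (l + 1) (n' + 1)) (lev μ (l + 1)) ^ (1 / 2 - 1 : ℝ)) = crossP (n' + 1) m (lev μ) := by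
    unfold crossP
    rw [half_sub]
  unfold mvbDensity
  by_cases hSC : SC (n' + 1) m (lev μ)
  · rw [if_pos hSC, Set.indicator_of_mem]
    swap
    · exact ⟨fun l _ h2 => hSC.weak l h2, fun l i _ hl hi => (hSC.pos hZb l hl i hi).le⟩
    have hpos : ∀ i, i < k → 0 < lev μ m i := fun i hi => hSC.pos hZb m le_rfl i (by omega)
    have hv : 0 < vand k (lev μ m) := by
      have := vand_nonneg_of_SC hSC hZb (le_refl m)
      rwa [hk'] at this
    have hce := chain_expr (D := n' + 1) hm hSC hZb (by omega)
    rw [hk'] at hce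
    rw [hcp, hk, hk', half_sub, mul_assoc (_ * _) _ (crossP _ _ _), hce]
    unfold mvBesselC mvBessel
    rw [phiB_eq m n' k piv (lev μ m) hk hz, half_sub]
    unfold wtA KcB
    have hc1 : ((n' + 1 - k : ℕ) : ℝ) = (n' + 1 : ℕ) - k := Nat.cast_sub (by omega)
    have hMM : (M : ℝ) = (n' + 1 : ℕ) + m - k := by
      have : M + k = (n' + 1) + m := by omega
      have : (M : ℝ) + k = (n' + 1 : ℕ) + m := by exact_mod_cast this
      linarith
    have hprod : ∀ e : ℝ, 0 < ∏ i ∈ range k, lev μ m i ^ e := fun e =>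
      Finset.prod_pos fun i hi => Real.rpow_pos_of_pos (hpos i (Finset.mem_range.mp hi)) _
    have hmul : ∀ e f : ℝ, (∏ i ∈ range k, lev μ m i ^ e) * (∏ i ∈ range k, lev μ m i ^ f) =
        ∏ i ∈ range k, lev μ m i ^ (e + f) := fun e f => by
      rw [← Finset.prod_mul_distrib]
      exact Finset.prod_congr rfl fun i hi =>
        (Real.rpow_add (hpos i (Finset.mem_range.mp hi)) _ _).symm
    rw [hc1, hMM]
    have e1 : (∏ i ∈ range k, lev μ m i ^ ((1 - (((n' + 1 : ℕ) : ℝ) - k)) / 2)) *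
        ((∏ i ∈ range k, lev μ m i ^ (-(1 / 2) : ℝ)) *
        (∏ i ∈ range k, lev μ m i ^ ((1 - ((m : ℝ) - k)) / 2))) *
        ∏ i ∈ range k, lev μ m i ^ ((((n' + 1 : ℕ) : ℝ) + m - k - k - 1) / 2) = 1 := by
      rw [hmul, hmul, hmul]
      refine Finset.prod_eq_one fun i _ => ?_
      rw [← Real.rpow_zero (lev μ m i)]
      congr 1
      ring
    have hs : vand k (lev μ m) ^ (1 / 2 : ℝ) * vand k (lev μ m) ^ (1 / 2 : ℝ) = vand k (lev μ m) := by
      rw [← Real.rpow_add hv]; norm_num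
    have hs0 : vand k (lev μ m) ^ (1 / 2 : ℝ) ≠ 0 := (Real.rpow_pos_of_pos hv _).ne'
    have p1 := (hprod ((1 - (((n' + 1 : ℕ) : ℝ) - k)) / 2)).ne'
    have p2 := (hprod (-(1 / 2) : ℝ)).ne'
    have p3 := (hprod ((1 - ((m : ℝ) - k)) / 2)).ne'
    have p4 := (hprod ((((n' + 1 : ℕ) : ℝ) + m - k - k - 1) / 2)).ne'
    have p5 := (hprod (1 / 2 * (((n' + 1 : ℕ) : ℝ) - k))).ne'
    generalize (∏ i ∈ range k, lev μ m i ^ ((1 - (((n' + 1 : ℕ) : ℝ) - k)) / 2)) = P1 at *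
    generalize (∏ i ∈ range k, lev μ m i ^ (-(1 / 2) : ℝ)) = P2 at *
    generalize (∏ i ∈ range k, lev μ m i ^ ((1 - ((m : ℝ) - k)) / 2)) = P3 at *
    generalize (∏ i ∈ range k, lev μ m i ^ ((((n' + 1 : ℕ) : ℝ) + m - k - k - 1) / 2)) = P4 at *
    generalize (∏ i ∈ range k, lev μ m i ^ (1 / 2 * (((n' + 1 : ℕ) : ℝ) - k))) = P5 at *
    have e2 : P4⁻¹ = P1 * (P2 * P3) := (eq_inv_of_mul_eq_one_left e1).symm
    generalize vand k (lev μ m) ^ (1 / 2 : ℝ) = s at *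
    rw [← hs]
    have hG : Real.Gamma (1 / 2) ≠ 0 := (Real.Gamma_pos_of_pos (by norm_num)).ne'
    rw [div_eq_mul_inv _ (s * s * P4), mul_inv (s * s), e2]
    generalize Real.Gamma (1 / 2) = G at *
    generalize gammaProd (1 / 2) k (n' + 1) = g at *
    field_simp
  · rw [if_neg hSC]
    by_cases hmem : chainSupp μ
    · rw [Set.indicator_of_mem (show μ ∈ {μ | chainSupp μ} from hmem), hcp, hk, half_sub]
      by_contra hne
      refine hSC (SC_of_weak hZb hmem.1 (fun l h1 h2 h3 => hne ?_) fun i hi => ?_)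
      · rw [crossP_zero h1 h2 h3]; simp
      · by_contra hi'
        rw [hk'] at hi hi'
        exact hne (by rw [prodlev_zero hi (not_lt.mp hi')]; simp)
    · rw [Set.indicator_of_notMem (show μ ∉ {μ | chainSupp μ} from hmem)]

/-! ## Part T : the law of the array -/

lemma ae_lev {m n k : ℕ} (hm : 1 ≤ m) (hk : k = min m n) {p : (Fin k → ℝ) → Prop}
    (hp : ∀ᵐ x, p x) : ∀ᵐ μ : Arr m n, p (fun i => lev μ m i) := by
  obtain ⟨m', rfl⟩ : ∃ m', m = m' + 1 := ⟨m - 1, by omega⟩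
  have hT : Measurable fun μ : Arr (m' + 1) n => (fun i : Fin k => lev μ (m' + 1) i) :=
    measurable_pi_lambda _ fun i => lev_measurable _ _
  have hq : Measure.QuasiMeasurePreserving
      (fun μ : Arr (m' + 1) n => (fun i : Fin k => lev μ (m' + 1) i)) volume volume := by
    refine ⟨hT, Measure.AbsolutelyContinuous.mk fun s hs h0 => ?_⟩
    rw [Measure.map_apply hT hs]
    have hi : Measurable fun μ : Arr (m' + 1) n =>
        s.indicator (1 : (Fin k → ℝ) → ℝ≥0∞) (fun i : Fin k => lev μ (m' + 1) i) :=
      (measurable_one.indicator hs).comp hT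
    have e : volume ((fun μ : Arr (m' + 1) n => (fun i : Fin k => lev μ (m' + 1) i)) ⁻¹' s) =
        ∫⁻ μ : Arr (m' + 1) n, s.indicator (1 : (Fin k → ℝ) → ℝ≥0∞) (fun i : Fin k => lev μ (m' + 1) i) := by
      rw [← lintegral_indicator_one (hT hs)]
      rfl
    rw [e, lintegral_snocA' hk _ hi]
    have e2 : ∀ (y : Fin k → ℝ) (μ : Arr m' n),
        (fun i : Fin k => lev (snocA μ (fun i => y (Fin.cast hk.symm i))) (m' + 1) i) = y := by
      intro y μ
      rw [lev_snocA_top, extF_cast hk]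
      funext i
      exact extF_fin y i
    simp only [e2]
    have : ∀ᵐ y : Fin k → ℝ, y ∉ s := measure_eq_zero_iff_ae_notMem.mp h0
    rw [← lintegral_zero (μ := (volume : Measure (Fin k → ℝ)))]
    refine lintegral_congr_ae ?_
    filter_upwards [this] with y hy
    simp [hy]
  exact hq.ae hp

theorem array_law (m n' : ℕ) (hm : 1 ≤ m) (piv pih : ℕ → ℝ)
    {ρ : Measure (Matrix (Fin (n' + 1)) (Fin (n' + 1)) ℝ)}
    [IsProbabilityMeasure ρ] (h1 : ∀ᵐ V ∂ρ, V.transpose * V = 1)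
    (h2 : ∀ U : Matrix (Fin (n' + 1)) (Fin (n' + 1)) ℝ, U.transpose * U = 1 →
      ∀ f : Matrix (Fin (n' + 1)) (Fin (n' + 1)) ℝ → ℝ≥0∞, Measurable f →
        ∫⁻ V, f (U * V) ∂ρ = ∫⁻ V, f V ∂ρ) :
    ∃ c : ℝ≥0∞, c ≠ 0 ∧ c ≠ ∞ ∧ ∀ F : Arr m (n' + 1) → ℝ≥0∞, Measurable F →
      ∫⁻ B : Fin m → Fin (n' + 1) → ℝ,
        ENNReal.ofReal (Real.exp (-(1 / 2) * ∑ i : Fin m, ∑ j : Fin (n' + 1),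
          (piv j + pih i) * B i j ^ 2)) * F (arrB m (n' + 1) (n' + 1) B) =
      c * ∫⁻ μ, dW (n' + 1) (n' + 1) m μ * (F μ *
        ENNReal.ofReal (Real.exp (-(1 / 2) * wtA (n' + 1) m pih (lev μ))) *
          GH (n' + 1) piv ρ (lev μ m)) := by
  obtain ⟨c, hc0, hc1, hc⟩ := proc (n' + 1) (by omega) m (n' + 1) (fun l _ => rfl)
  refine ⟨c, hc0, hc1, fun F hF => ?_⟩
  have hFE : Measurable fun μ : Arr m (n' + 1) => F μ *
      ENNReal.ofReal (Real.exp (-(1 / 2) * wtA (n' + 1) m pih (lev μ))) :=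
    hF.mul (wtE_measurable _ _ _)
  have hG : Measurable fun μ : Arr m (n' + 1) => GH (n' + 1) piv ρ (lev μ m) :=
    GH_measurable fun i => lev_measurable _ _
  have hf : Measurable fun B : Fin m → Fin (n' + 1) → ℝ => F (arrB m (n' + 1) (n' + 1) B) *
      ENNReal.ofReal (Real.exp (-(1 / 2) * wtA (n' + 1) m pih (lev (arrB m (n' + 1) (n' + 1) B)))) :=
    hFE.comp (arrB_measurable _ _ _)
  have e1 := haar_avg piv h1 h2 _ hf (fun U hU B => by simp only [arrB_rot U hU])
  have hFG : Measurable fun μ : Arr m (n' + 1) => F μ *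
      ENNReal.ofReal (Real.exp (-(1 / 2) * wtA (n' + 1) m pih (lev μ))) *
      GH (n' + 1) piv ρ (lev μ m) := hFE.mul hG
  rw [← hc _ hFG]
  refine Eq.trans ?_ (e1.trans ?_)
  · refine lintegral_congr fun B => ?_
    rw [mul_assoc, mul_comm, ← ENNReal.ofReal_mul (Real.exp_pos _).le, ← Real.exp_add,
      wtA_arrB (fun l _ => rfl)]
    congr 3
    rw [← mul_add]
    congr 1
    unfold colW
    simp only [Finset.mul_sum]
    rw [Finset.sum_comm (s := (Finset.univ : Finset (Fin (n' + 1)))), ← Finset.sum_add_distrib]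
    refine Finset.sum_congr rfl fun i _ => ?_
    rw [← Finset.sum_add_distrib]
    refine Finset.sum_congr rfl fun j _ => ?_
    ring
  · refine lintegral_congr fun B => ?_
    rw [lev_arrB (fun l _ => rfl) B le_rfl]

lemma density_ae (m n' : ℕ) (hm : 1 ≤ m) (piv pih : ℕ → ℝ) (hpiv : ∀ j, 0 ≤ piv j)
    {ρ : Measure (Matrix (Fin (n' + 1)) (Fin (n' + 1)) ℝ)}
    [IsProbabilityMeasure ρ] (h1 : ∀ᵐ V ∂ρ, V.transpose * V = 1)
    (h2 : ∀ U : Matrix (Fin (n' + 1)) (Fin (n' + 1)) ℝ, U.transpose * U = 1 →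
      ∀ f : Matrix (Fin (n' + 1)) (Fin (n' + 1)) ℝ → ℝ≥0∞, Measurable f →
        ∫⁻ V, f (U * V) ∂ρ = ∫⁻ V, f V ∂ρ) :
    ∃ c : ℝ, 0 < c ∧ ∀ᵐ μ : Arr m (n' + 1),
      dW (n' + 1) (n' + 1) m μ *
        (ENNReal.ofReal (Real.exp (-(1 / 2) * wtA (n' + 1) m pih (lev μ))) *
          GH (n' + 1) piv ρ (lev μ m)) =
      ENNReal.ofReal (c * mvbDensity (1 / 2) (n' + 1) m piv pih μ) := by
  obtain ⟨c, C, hc0, hc1, hC0, hC1, hae⟩ := key_id m n' hm piv h1 h2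
  have hcr : 0 < c.toReal := ENNReal.toReal_pos hc0 hc1
  have hCr : 0 < C.toReal := ENNReal.toReal_pos hC0 hC1
  have hK := KcB_pos (n' + 1) (min (n' + 1) m)
  refine ⟨c.toReal / C.toReal / KcB (n' + 1) (min (n' + 1) m), by positivity, ?_⟩
  filter_upwards [ae_lev (n := n' + 1) hm (by omega) hae] with μ hμ
  have hZb : Zb (n' + 1) m (lev μ) := lev_Zb _
  rw [extF_restrict (L := lev μ m) (fun i hi => hZb m le_rfl i (by omega))] at hμ
  rw [mvb_eq m n' _ _ hm piv pih rfl rfl μ]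
  unfold dW
  by_cases hSC : SC (n' + 1) m (lev μ)
  · rw [if_pos hSC, if_pos hSC]
    have hpos : ∀ i, i < min (n' + 1) m → 0 < lev μ m i :=
      fun i hi => hSC.pos hZb m le_rfl i (by omega)
    have hSDP : SDP (min (n' + 1) m) (lev μ m) :=
      ⟨fun i j hij hj => hSC.anti hZb m le_rfl i j hij (by omega), hpos⟩
    have hL : ∀ i, 0 ≤ lev μ m i := fun i => by
      by_cases hi : i < min (n' + 1) m
      · exact (hpos i hi).le
      · rw [hZb m le_rfl i (by omega)]
    have hG1 : GH (n' + 1) piv ρ (lev μ m) ≠ ∞ :=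
      ((GH_le_one hpiv hL).trans_lt ENNReal.one_lt_top).ne
    have hP := Pden_nonneg (D := n' + 1) hSC hZb
    have ht : 0 < vand (min (n' + 1) m) (lev μ m) * ∏ i ∈ range (min (n' + 1) m),
        lev μ m i ^ ((((max (n' + 1) m : ℕ) : ℝ) - (min (n' + 1) m : ℕ) - 1) / 2) :=
      mul_pos (SDP_vand hSDP) (Finset.prod_pos fun i hi =>
        Real.rpow_pos_of_pos (hpos i (Finset.mem_range.mp hi)) _)
    unfold tt at hμ
    rw [if_pos hSDP] at hμ
    generalize vand (min (n' + 1) m) (lev μ m) * ∏ i ∈ range (min (n' + 1) m),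
        lev μ m i ^ ((((max (n' + 1) m : ℕ) : ℝ) - (min (n' + 1) m : ℕ) - 1) / 2) = t at *
    have hr := congrArg ENNReal.toReal hμ
    simp only [ENNReal.toReal_mul, ENNReal.toReal_ofReal ht.le] at hr
    rw [← ENNReal.ofReal_toReal hG1, ← ENNReal.ofReal_mul (Real.exp_pos _).le, ← ENNReal.ofReal_mul hP]
    congr 1
    have hq : (QB m n' piv (lev μ m)).toReal =
        C.toReal * (t * (GH (n' + 1) piv ρ (lev μ m)).toReal) / c.toReal := by
      rw [← hr]; field_simp
    rw [hq]
    field_simp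
  · rw [if_neg hSC, if_neg hSC]
    simp

/-! ## Part U : the main theorem -/

theorem main_aux (n : ℕ) (hn : 1 ≤ n) (piv pih : ℕ → ℝ)
    (hpiv : ∀ j, 0 ≤ piv j)
    (hsum : ∀ i j, j < n → 0 < piv j + pih i)
    {Ω : Type} [MeasurableSpace Ω] (P : Measure Ω) [IsProbabilityMeasure P]
    (A : ℕ → Fin n → Ω → ℝ) (hmeas : ∀ i j, Measurable (A i j))
    (hindep : iIndepFun (fun q : ℕ × Fin n => A q.1 q.2) P)
    (hgauss : ∀ i j, Measure.map (A i j) P =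
      gaussianReal 0 ((piv (j : ℕ) + pih i)⁻¹).toNNReal)
    (m : ℕ) (hm : 1 ≤ m) :
    ∃ c : ℝ, 0 < c ∧ Measure.map (wishArrR n m A) P =
      volume.withDensity fun μ => ENNReal.ofReal (c * mvbDensity (1 / 2) n m piv pih μ) := by
  obtain ⟨n', rfl⟩ : ∃ n', n = n' + 1 := ⟨n - 1, by omega⟩
  obtain ⟨ρ, hρ, h1, h2⟩ := exists_haar (n' + 1)
  obtain ⟨c1, hc10, hc11, hc1⟩ := gauss_law m (n' + 1) (fun i j => piv j + pih i)
    (fun i j => hsum i j j.2)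
  obtain ⟨c2, hc20, hc21, hc2⟩ := array_law m n' hm piv pih h1 h2
  obtain ⟨c3, hc3, hae⟩ := density_ae m n' hm piv pih hpiv h1 h2
  have hr1 : 0 < c1.toReal := ENNReal.toReal_pos hc10 hc11
  have hr2 : 0 < c2.toReal := ENNReal.toReal_pos hc20 hc21
  refine ⟨c1.toReal * c2.toReal * c3, by positivity, ?_⟩
  -- law of the Gaussian entries
  have hZm : Measurable fun (ω : Ω) (q : Fin m × Fin (n' + 1)) => A q.1 q.2 ω :=
    measurable_pi_lambda _ fun q => hmeas _ _
  have hind : iIndepFun (fun q : Fin m × Fin (n' + 1) => A q.1 q.2) P := by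
    have hinj : Function.Injective fun q : Fin m × Fin (n' + 1) => ((q.1 : ℕ), q.2) := by
      rintro ⟨a, b⟩ ⟨a', b'⟩ h
      simp only [Prod.mk.injEq] at h
      exact Prod.ext (Fin.ext h.1) h.2
    exact hindep.precomp hinj
  have hZ : Measure.map (fun (ω : Ω) (q : Fin m × Fin (n' + 1)) => A q.1 q.2 ω) P =
      Measure.pi fun q : Fin m × Fin (n' + 1) =>
        gaussianReal 0 ((piv (q.2 : ℕ) + pih q.1)⁻¹).toNNReal := by
    rw [(iIndepFun_iff_map_fun_eq_pi_map (fun q => (hmeas _ _).aemeasurable)).mp hind]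
    congr 1
    funext q
    exact hgauss _ _
  have hcur : Measurable (curB (m := m) (n := n' + 1)) := (curB_mp _ _).measurable
  have hX : wishArrR (n' + 1) m A = fun ω => arrB m (n' + 1) (n' + 1)
      (curB (fun q : Fin m × Fin (n' + 1) => A q.1 q.2 ω)) := by
    funext ω p
    unfold wishArrR arrB
    refine congrFun (wishEigR_congr fun i hi => ?_) _
    have hp : p.1.1 < m := (mem_coords.mp p.2).1
    have hi' : i < m := by omega
    funext j
    simp [extB, curB, hi']
  have hXm : Measurable (wishArrR (n' + 1) m A) := by
    rw [hX]
    exact (arrB_measurable _ _ _).comp (hcur.comp hZm)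
  have hdm : Measurable fun μ : Arr m (n' + 1) => dW (n' + 1) (n' + 1) m μ *
        (ENNReal.ofReal (Real.exp (-(1 / 2) * wtA (n' + 1) m pih (lev μ))) *
          GH (n' + 1) piv ρ (lev μ m)) :=
    (dW_measurable _ _ _).mul ((wtE_measurable _ _ _).mul (GH_measurable fun i => lev_measurable _ _))
  have hden : (fun μ : Arr m (n' + 1) => ENNReal.ofReal (c1.toReal * c2.toReal * c3 *
      mvbDensity (1 / 2) (n' + 1) m piv pih μ)) =ᵐ[volume]
      fun μ : Arr m (n' + 1) => c1 * c2 * (dW (n' + 1) (n' + 1) m μ *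
        (ENNReal.ofReal (Real.exp (-(1 / 2) * wtA (n' + 1) m pih (lev μ))) *
          GH (n' + 1) piv ρ (lev μ m))) := by
    filter_upwards [hae] with μ hμ
    rw [hμ, mul_assoc (_ * _) c3, ENNReal.ofReal_mul (by positivity), ENNReal.ofReal_mul hr1.le,
      ENNReal.ofReal_toReal hc11, ENNReal.ofReal_toReal hc21]
  rw [withDensity_congr_ae hden]
  refine Measure.ext_of_lintegral _ fun F hF => ?_
  rw [lintegral_map hF hXm]
  have hd2 := hdm.const_mul (c1 * c2)
  rw [lintegral_withDensity_eq_lintegral_mul _ hd2 hF]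
  have hFA : Measurable fun B : Fin m → Fin (n' + 1) → ℝ => F (arrB m (n' + 1) (n' + 1) B) :=
    hF.comp (arrB_measurable _ _ _)
  have hFAZ : Measurable fun Z : Fin m × Fin (n' + 1) → ℝ => F (arrB m (n' + 1) (n' + 1) (curB Z)) :=
    hFA.comp hcur
  have e1 := lintegral_map (μ := P) hFAZ hZm
  rw [hZ] at e1
  have e2 := e1.symm.trans (hc1 _ hFA)
  rw [hX]
  refine e2.trans ?_
  rw [hc2 F hF, ← mul_assoc, ← lintegral_const_mul' _ _ (ENNReal.mul_ne_top hc11 hc21)]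
  refine lintegral_congr fun μ => ?_
  simp only [Pi.mul_apply]
  ring

/-- the β = 1 multilevel generalized Wishart eigenvalues form a
multivariate Bessel ensemble. -/
theorem wishart_eq_mvb_beta1
    (n : ℕ) (hn : 1 ≤ n) (piv pih : ℕ → ℝ)
    (hpiv : ∀ j, 0 ≤ piv j) (hpih : ∀ i, 0 ≤ pih i)
    (hsum : ∀ i j, j < n → 0 < piv j + pih i)
    {Ω : Type} [MeasurableSpace Ω] (P : Measure Ω) [IsProbabilityMeasure P]
    (A : ℕ → Fin n → Ω → ℝ) (hmeas : ∀ i j, Measurable (A i j))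
    (hindep : iIndepFun (fun q : ℕ × Fin n => A q.1 q.2) P)
    (hgauss : ∀ (i : ℕ) (j : Fin n),
      Measure.map (A i j) P = gaussianReal 0 ((piv (j : ℕ) + pih i)⁻¹).toNNReal)
    (m : ℕ) (hm : 1 ≤ m) :
    ∃ c : ℝ, 0 < c ∧
      Measure.map (wishArrR n m A) P
        = volume.withDensity fun μ =>
            ENNReal.ofReal (c * mvbDensity (1 / 2) n m piv pih μ) := by
  exact main_aux n hn piv pih hpiv hsum P A hmeas hindep hgauss m hm

end RMT
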